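/- Let n ≥ 4. The group B_n/Z(B_n), the quotient of the braid group B_n by its center, is co-Hopfian: every injective group endomorphism of B_n/Z(B_n) is surjective, hence an automorphism. -/

import Mathlib

/-- Relators for the braid group with generators `σ_0, …, σ_{m-1}`:
the braid relations `σ_i σ_j σ_i = σ_j σ_i σ_j` for `j = i+1`, and the
commutation relations `σ_i σ_j = σ_j σ_i` for `j ≥ i+2`. -/
def braidRels (m : ℕ) : Set (FreeGroup (Fin m)) :=
  { r | ∃ i j : Fin m,
      ((i : ℕ) + 1 = (j : ℕ) ∧
        r = FreeGroup.of i * FreeGroup.of j * FreeGroup.of i *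
            (FreeGroup.of j * FreeGroup.of i * FreeGroup.of j)⁻¹) ∨
      ((i : ℕ) + 2 ≤ (j : ℕ) ∧
        r = FreeGroup.of i * FreeGroup.of j * (FreeGroup.of j * FreeGroup.of i)⁻¹) }

/-- The braid group on `n` strands: the presented group with generators
`σ_1, …, σ_{n-1}` (indexed by `Fin (n-1)`) and the braid relators. -/
abbrev BraidGroup (n : ℕ) : Type := PresentedGroup (braidRels (n - 1))

/-- The standard generator `σ_{i+1}` of the braid group (0-indexed). -/
def braidσ (n : ℕ) (i : Fin (n - 1)) : BraidGroup n := PresentedGroup.of i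

/-- The element `δ = σ_1 σ_2 ⋯ σ_{n-1}` of the braid group. -/
def braidδ (n : ℕ) : BraidGroup n := (List.ofFn (braidσ n)).prod

/-- The full twist `z = (σ_1 σ_2 ⋯ σ_{n-1})^n`. -/
def fullTwist (n : ℕ) : BraidGroup n := braidδ n ^ n

namespace BraidCoHopf

section FreeProduct

variable {W : Type*} [Group W]

/-- `AltList P b l`: the letters of `l` are nontrivial and lie alternately in the subgroups
`P b`, `P !b`, starting with `P b`. -/
def AltList (P : Bool → Subgroup W) : Bool → List W → Prop
  | _, [] => True
  | b, x :: l => (x ∈ P b ∧ x ≠ 1) ∧ AltList P (!b) l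

/-- `W` is the internal free product of the subgroups `P true` and `P false`. -/
structure IsFreeProd (P : Bool → Subgroup W) : Prop where
  exists_alt : ∀ g : W, ∃ b l, AltList P b l ∧ l.prod = g
  eq_nil : ∀ b l, AltList P b l → l.prod = 1 → l = []

variable {P : Bool → Subgroup W}

/-- The type of the letter that follows `l` in an alternating list starting with type `b`. -/
def nextType (b : Bool) (l : List W) : Bool := xor b (decide (l.length % 2 = 1))

omit [Group W] in
@[simp] lemma nextType_nil (b : Bool) : nextType b ([] : List W) = b := by simp [nextType]

omit [Group W] in
@[simp] lemma nextType_cons (b : Bool) (x : W) (l : List W) :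
    nextType b (x :: l) = nextType (!b) l := by
  rcases Nat.mod_two_eq_zero_or_one l.length with h | h <;>
    simp [nextType, Nat.add_mod, h]

omit [Group W] in
lemma nextType_even (b : Bool) {l : List W} (h : Even l.length) : nextType b l = b := by
  simp [nextType, Nat.even_iff.mp h]

omit [Group W] in
lemma nextType_not (b : Bool) (l : List W) : nextType (!b) l = !nextType b l := by
  simp [nextType]

@[simp] lemma altList_nil (b : Bool) : AltList P b [] := trivial

@[simp] lemma altList_cons {b : Bool} {x : W} {l : List W} :
    AltList P b (x :: l) ↔ (x ∈ P b ∧ x ≠ 1) ∧ AltList P (!b) l := Iff.rfl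

lemma altList_append {b : Bool} {l l' : List W} :
    AltList P b (l ++ l') ↔ AltList P b l ∧ AltList P (nextType b l) l' := by
  induction l generalizing b with
  | nil => simp
  | cons x l ih => simp [ih, and_assoc]

lemma altList_ri {b : Bool} {l : List W} (h : AltList P b l) :
    AltList P (!nextType b l) (l.map (·⁻¹)).reverse := by
  induction l generalizing b with
  | nil => simp
  | cons x l ih =>
    obtain ⟨⟨hx, hx1⟩, hl⟩ := h
    simp only [List.map_cons, List.reverse_cons, nextType_cons]
    rw [altList_append]
    refine ⟨ih hl, ?_⟩
    have : nextType (!nextType (!b) l) (l.map (·⁻¹)).reverse = b := by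
      rw [nextType_not, nextType_not]
      simp only [nextType, List.length_reverse, List.length_map]
      cases b <;> simp
    rw [this]
    simp [hx, hx1]

lemma prod_ri (l : List W) : (l.map (·⁻¹)).reverse.prod = l.prod⁻¹ :=
  (List.prod_inv_reverse l).symm

lemma AltList.map {b : Bool} {l : List W} (h : AltList P b l) (τ : W →* W)
    (hτ : ∀ b, ∀ x ∈ P b, τ x ∈ P b) (hτ1 : ∀ b, ∀ x ∈ P b, τ x = 1 → x = 1) :
    AltList P b (l.map τ) := by
  induction l generalizing b with
  | nil => simp
  | cons x l ih =>
    obtain ⟨⟨hx, hx1⟩, hl⟩ := h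
    exact ⟨⟨hτ _ _ hx, fun h => hx1 (hτ1 _ _ hx h)⟩, ih hl⟩

lemma AltList.mem {b : Bool} {l : List W} (h : AltList P b l) {x : W} (hx : x ∈ l) :
    ∃ c, x ∈ P c := by
  induction l generalizing b with
  | nil => simp at hx
  | cons y l ih =>
    rcases List.mem_cons.mp hx with rfl | hx
    · exact ⟨b, h.1.1⟩
    · exact ih h.2 hx

namespace IsFreeProd

variable (hP : IsFreeProd P)
include hP

lemma disjoint {b : Bool} {x : W} (h : x ∈ P b) (h' : x ∈ P (!b)) : x = 1 := by
  by_contra hx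
  have := hP.eq_nil b [x, x⁻¹] (by simp [h, h', hx]) (by simp)
  simp at this

lemma alt_unique {b c : Bool} {l l' : List W} (h : AltList P b l) (h' : AltList P c l')
    (e : l.prod = l'.prod) : l = l' := by
  induction l generalizing b c l' with
  | nil => exact (hP.eq_nil c l' h' (by simpa using e.symm)).symm
  | cons x t ih =>
    cases l' with
    | nil => exact hP.eq_nil b _ h (by simpa using e)
    | cons y t' =>
      by_cases hbc : b = c
      · subst hbc
        by_cases hxy : x = y
        · subst hxy
          rw [ih h.2 h'.2 (by simpa using e)]
        · exfalso
          have h1 := altList_ri h.2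
          have := hP.eq_nil (!nextType (!b) t) ((t.map (·⁻¹)).reverse ++ ((x⁻¹ * y) :: t')) (by
            rw [altList_append]
            refine ⟨h1, ?_⟩
            have : nextType (!nextType (!b) t) (t.map (·⁻¹)).reverse = b := by
              rw [nextType_not, nextType_not]
              simp only [nextType, List.length_reverse, List.length_map]
              cases b <;> simp
            rw [this]
            refine ⟨⟨mul_mem (inv_mem h.1.1) h'.1.1, ?_⟩, h'.2⟩
            rwa [Ne, inv_mul_eq_one]) (by
            rw [List.prod_append, prod_ri, List.prod_cons]
            simp only [List.prod_cons] at e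
            rw [mul_assoc, ← e]; group)
          simp at this
      · exfalso
        have h1 := altList_ri h
        have := hP.eq_nil (!nextType b (x :: t)) (((x :: t).map (·⁻¹)).reverse ++ (y :: t')) (by
            rw [altList_append]
            refine ⟨h1, ?_⟩
            have : nextType (!nextType b (x :: t)) ((x :: t).map (·⁻¹)).reverse = c := by
              rw [nextType_not]
              simp only [nextType, List.length_reverse, List.length_map]
              cases b <;> cases c <;> simp_all
            rwa [this]) (by
            rw [List.prod_append, prod_ri, e]; simp)
        simp at this

lemma exists_left (b : Bool) (g : W) :
    ∃ a ∈ P b, ∃ l, AltList P (!b) l ∧ g = a * l.prod := by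
  obtain ⟨c, l, hl, rfl⟩ := hP.exists_alt g
  by_cases hc : c = b
  · subst hc
    cases l with
    | nil => exact ⟨1, one_mem _, [], by simp, by simp⟩
    | cons x t => exact ⟨x, hl.1.1, t, hl.2, by simp⟩
  · have : c = !b := by cases b <;> cases c <;> simp_all
    subst this
    exact ⟨1, one_mem _, l, hl, by simp⟩

lemma left_unique {b : Bool} {a a' : W} (ha : a ∈ P b) (ha' : a' ∈ P b) {l l' : List W}
    (hl : AltList P (!b) l) (hl' : AltList P (!b) l') (e : a * l.prod = a' * l'.prod) :
    a = a' ∧ l = l' := by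
  by_cases h : a = a'
  · subst h
    exact ⟨rfl, hP.alt_unique hl hl' (by simpa using e)⟩
  · exfalso
    have h1 : AltList P b ((a'⁻¹ * a) :: l) :=
      ⟨⟨mul_mem (inv_mem ha') ha, by rwa [Ne, inv_mul_eq_one, eq_comm]⟩, hl⟩
    have := hP.alt_unique h1 hl' (by rw [List.prod_cons, mul_assoc, e]; group)
    subst this
    exact hl'.1.2 (hP.disjoint h1.1.1 hl'.1.1)

omit hP in
lemma exists_alt_mul_right {b c : Bool} {w : List W} (hw : AltList P c w) {k : W} (hk : k ∈ P b)
    (h0 : w = [] → c = b) : ∃ w', AltList P c w' ∧ w'.prod = w.prod * k := by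
  induction w generalizing c with
  | nil =>
    obtain rfl := h0 rfl
    by_cases h : k = 1
    · exact ⟨[], by simp, by simp [h]⟩
    · exact ⟨[k], by simp [h, hk], by simp⟩
  | cons x t ih =>
    by_cases ht : t = [] ∧ c = b
    · obtain ⟨rfl, rfl⟩ := ht
      by_cases h : x * k = 1
      · exact ⟨[], by simp, by simp [h]⟩
      · exact ⟨[x * k], by simp [h, mul_mem hw.1.1 hk], by simp⟩
    · obtain ⟨w', h1, h2⟩ := ih hw.2 (by
        intro h; cases b <;> cases c <;> simp_all)
      exact ⟨x :: w', ⟨hw.1, h1⟩, by simp [h2, mul_assoc]⟩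

/-- If `g ∈ P b` conjugates `τ γ` to `γ ∉ P b`, where `τ` preserves both factors,
then `g` is a twisted coboundary in `P b`. -/
lemma exists_twisted {τ : W →* W} (hτ : ∀ b, ∀ x ∈ P b, τ x ∈ P b)
    (hτ1 : ∀ b, ∀ x ∈ P b, τ x = 1 → x = 1) {b : Bool} {g γ : W} (hg : g ∈ P b)
    (hγ : γ ∉ P b) (e : g * τ γ * g⁻¹ = γ) : ∃ a ∈ P b, g * τ a = a := by
  obtain ⟨a, ha, l, hl, rfl⟩ := hP.exists_left b γ
  have hne : l ≠ [] := by
    rintro rfl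
    exact hγ (by simpa using ha)
  obtain ⟨w, hw, hw'⟩ := exists_alt_mul_right (hl.map τ hτ hτ1) (inv_mem hg)
    (by intro h; simp [hne] at h)
  refine ⟨a, ha, (hP.left_unique (mul_mem hg (hτ _ _ ha)) ha hw hl ?_).1⟩
  rw [hw', ← e, map_mul, map_list_prod]
  simp only [mul_assoc]

lemma mem_of_commute {b : Bool} {a γ : W} (ha : a ∈ P b) (ha1 : a ≠ 1) (h : a * γ = γ * a) :
    γ ∈ P b := by
  by_contra hγ
  obtain ⟨k, hk, l, hl, rfl⟩ := hP.exists_left b γ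
  have hne : l ≠ [] := by
    rintro rfl
    exact hγ (by simpa using hk)
  obtain ⟨w, hw, hw'⟩ := exists_alt_mul_right hl ha (by intro h; simp [hne] at h)
  have := (hP.left_unique (mul_mem ha hk) hk hl hw (by rw [hw', mul_assoc, h, mul_assoc])).1
  exact ha1 (by simpa using this)

omit hP in
lemma exists_alt_length_le (L : List W) (hL : ∀ z ∈ L, ∃ b, z ∈ P b) :
    ∃ b l, AltList P b l ∧ l.length ≤ L.length ∧ l.prod = L.prod := by
  induction L with
  | nil => exact ⟨true, [], by simp, by simp, rfl⟩
  | cons x L ih =>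
    obtain ⟨b, l, h1, h2, h3⟩ := ih (fun z hz => hL z (List.mem_cons_of_mem _ hz))
    obtain ⟨c, hc⟩ := hL x List.mem_cons_self
    by_cases hx : x = 1
    · exact ⟨b, l, h1, by simp; omega, by simp [hx, h3]⟩
    cases l with
    | nil => exact ⟨c, [x], by simp [hc, hx], by simp, by simp [← h3]⟩
    | cons y t =>
      by_cases hbc : b = c
      · subst hbc
        by_cases hxy : x * y = 1
        · refine ⟨!b, t, h1.2, by simp at h2 ⊢; omega, ?_⟩
          rw [List.prod_cons, ← h3, List.prod_cons, ← mul_assoc, hxy, one_mul]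
        · exact ⟨b, (x * y) :: t, ⟨⟨mul_mem hc h1.1.1, hxy⟩, h1.2⟩, by simp at h2 ⊢; omega,
            by rw [List.prod_cons, List.prod_cons, ← h3, List.prod_cons, mul_assoc]⟩
      · have : b = !c := by cases b <;> cases c <;> simp_all
        subst this
        exact ⟨c, x :: y :: t, ⟨⟨hc, hx⟩, h1⟩, by simp at h2 ⊢; omega, by simp [← h3]⟩

omit hP in
lemma isRotated_of_append_eq {α : Type*} {l l' u : List α} (h : l ++ u = u ++ l') : l ~r l' := by
  induction hn : u.length using Nat.strong_induction_on generalizing u with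
  | _ n ih =>
  rcases List.append_eq_append_iff.mp h with ⟨t, h1, h2⟩ | ⟨t, h1, h2⟩
  · by_cases hl : l = []
    · subst hl
      have : l'.length = 0 := by simpa using congrArg List.length h
      rw [List.length_eq_zero_iff.mp this]
    · refine ih t.length ?_ (u := t) ?_ rfl
      · rw [← hn, h1, List.length_append]
        have := List.length_pos_iff.mpr hl
        omega
      · rw [← h1, h2]
  · subst h1 h2
    exact List.isRotated_append

lemma append_eq_of_conj {c : Bool} {l l' u : List W} (hl : AltList P c l) (hl' : AltList P c l')
    (hu : AltList P c u) (el : Even l.length) (el' : Even l'.length)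
    (hle : l'.length ≤ l.length) (e : l.prod * u.prod = u.prod * l'.prod) :
    l ++ u = u ++ l' := by
  have h1 : AltList P c (l ++ u) := by
    rw [altList_append, nextType_even _ el]; exact ⟨hl, hu⟩
  rcases Nat.even_or_odd u.length with eu | ou
  · have h2 : AltList P c (u ++ l') := by
      rw [altList_append, nextType_even _ eu]; exact ⟨hu, hl'⟩
    exact hP.alt_unique h1 h2 (by simpa using e)
  · cases l' with
    | nil =>
      exact hP.alt_unique h1 (c := c) (by simpa using hu) (by simpa using e)
    | cons y t =>
      exfalso
      obtain ⟨u', x, rfl⟩ : ∃ u' x, u = u' ++ [x] := by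
        rcases List.eq_nil_or_concat u with rfl | h
        · simp at ou
        · simpa using h
      have eu' : Even u'.length := by
        simpa [Nat.odd_add_one] using ou
      rw [altList_append, nextType_even _ eu'] at hu
      obtain ⟨hu', ⟨hx, hx1⟩, -⟩ := hu
      obtain ⟨b, w, hw, hwl, hwp⟩ := exists_alt_length_le (P := P) (u' ++ (x * y) :: t) (by
        intro z hz
        rcases List.mem_append.mp hz with hz | hz
        · exact hu'.mem hz
        · rcases List.mem_cons.mp hz with rfl | hz
          · exact ⟨_, mul_mem hx hl'.1.1⟩
          · exact hl'.2.mem hz)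
      have := hP.alt_unique h1 hw (by rw [hwp]; simpa [mul_assoc] using e)
      have := congrArg List.length this
      simp at this hle hwl; omega

lemma isRotated_of_conj {b : Bool} {l l' : List W} (hl : AltList P b l) (hl' : AltList P b l')
    (el : Even l.length) (el' : Even l'.length) {g : W} (e : g * l.prod * g⁻¹ = l'.prod) :
    l ~r l' := by
  wlog hle : l'.length ≤ l.length generalizing l l' g
  · exact (this hl' hl el' el (g := g⁻¹) (by rw [← e]; group) (by omega)).symm
  obtain ⟨c, u, hu, hug⟩ := hP.exists_alt g⁻¹
  have e1 : l.prod * u.prod = u.prod * l'.prod := by rw [hug, ← e]; group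
  by_cases hc : c = b
  · subst hc
    exact isRotated_of_append_eq (hP.append_eq_of_conj hl hl' hu el el' hle e1)
  · have hc : c = !b := by cases b <;> cases c <;> simp_all
    subst hc
    have h1 := altList_ri hl
    have h2 := altList_ri hl'
    rw [nextType_even _ el] at h1
    rw [nextType_even _ el'] at h2
    have := isRotated_of_append_eq (hP.append_eq_of_conj h1 h2 hu (by simpa using el)
      (by simpa using el') (by simpa using hle) (by
        rw [prod_ri, prod_ri, inv_mul_eq_iff_eq_mul, ← mul_assoc, eq_mul_inv_iff_mul_eq, e1]))
    have := (List.isRotated_reverse_iff.mp this).map (·⁻¹)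
    simpa using this

omit hP in
/-- Every element is conjugate into a factor or to a cyclically reduced word. -/
lemma exists_conj (hP : IsFreeProd P) (γ : W) :
    (∃ g b, g * γ * g⁻¹ ∈ P b) ∨
      ∃ g l, AltList P true l ∧ l ≠ [] ∧ Even l.length ∧ g * γ * g⁻¹ = l.prod := by
  obtain ⟨b, l, hl, rfl⟩ := hP.exists_alt γ
  induction hn : l.length using Nat.strong_induction_on generalizing b l with
  | _ n ih =>
  cases l with
  | nil => exact Or.inl ⟨1, true, by simp⟩
  | cons x t =>
    have hconj : (x⁻¹ * (x :: t).prod * x⁻¹⁻¹) = (t ++ [x]).prod := by simp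
    rcases Nat.even_or_odd (x :: t).length with ev | od
    · right
      cases b with
      | true => exact ⟨1, x :: t, hl, by simp, ev, by simp⟩
      | false =>
        refine ⟨x⁻¹, t ++ [x], ?_, by simp, by simpa using ev, hconj⟩
        rw [altList_append]
        refine ⟨hl.2, ?_⟩
        have : nextType true t = false := by
          have := nextType_even false ev
          simpa using this
        rw [this]
        exact ⟨hl.1, by simp⟩
    · rcases List.eq_nil_or_concat t with rfl | ⟨t', y, rfl⟩
      · exact Or.inl ⟨1, b, by simpa using hl.1.1⟩
      · have et : Odd t'.length := by
          simpa [Nat.odd_add_one] using od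
        have hl2 := hl.2
        rw [List.concat_eq_append, altList_append] at hl2
        have : nextType (!b) t' = b := by simp [nextType, Nat.odd_iff.mp et]
        rw [this] at hl2
        obtain ⟨c, w, hw, hwl, hwp⟩ := exists_alt_length_le (P := P) (t' ++ [y * x]) (by
          intro z hz
          rcases List.mem_append.mp hz with hz | hz
          · exact hl2.1.mem hz
          · obtain rfl := List.mem_singleton.mp hz
            exact ⟨b, mul_mem hl2.2.1.1 hl.1.1⟩)
        have hc : x⁻¹ * (x :: t'.concat y).prod * x⁻¹⁻¹ = w.prod := by
          rw [hwp]; simp [mul_assoc]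
        rcases ih w.length (by rw [← hn]; simp at hwl ⊢; omega) c w hw rfl with
          ⟨g, b', h⟩ | ⟨g, l, h1, h2, h3, h4⟩
        · exact Or.inl ⟨g * x⁻¹, b', by rw [← hc] at h; convert h using 1; group⟩
        · exact Or.inr ⟨g * x⁻¹, l, h1, h2, h3, by rw [← hc] at h4; rw [← h4]; group⟩

omit hP in
lemma altList_pow {b : Bool} {l : List W} (hl : AltList P b l) (el : Even l.length) (k : ℕ) :
    AltList P b (List.replicate k l).flatten := by
  induction k with
  | zero => simp
  | succ k ih =>
    rw [List.replicate_succ, List.flatten_cons, altList_append, nextType_even _ el]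
    exact ⟨hl, ih⟩

/-- A torsion element is conjugate into a factor. -/
lemma conj_mem_of_pow_eq_one {γ : W} {k : ℕ} (hk : k ≠ 0) (h : γ ^ k = 1) :
    ∃ g b, g * γ * g⁻¹ ∈ P b := by
  rcases hP.exists_conj γ with h' | ⟨g, l, h1, h2, h3, h4⟩
  · exact h'
  · exfalso
    have := hP.eq_nil _ _ (altList_pow h1 h3 k) (by
      rw [List.prod_flatten, List.map_replicate, List.prod_replicate, ← h4, conj_pow, h]; simp)
    rw [List.flatten_eq_nil_iff] at this
    exact h2 (this l (by simp [hk]))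

/-- If the class of `γ` is invariant under a factor-preserving `τ`, then `γ` is conjugate into a
factor or to a word whose letters are fixed by a power of `τ`. -/
lemma conj_mem_or_fixed {τ : W →* W} (hτ : ∀ b, ∀ x ∈ P b, τ x ∈ P b)
    (hτ1 : ∀ b, ∀ x ∈ P b, τ x = 1 → x = 1) {γ g : W} (e : g * τ γ * g⁻¹ = γ) :
    (∃ g b, g * γ * g⁻¹ ∈ P b) ∨
      ∃ g l, AltList P true l ∧ g * γ * g⁻¹ = l.prod ∧
        ∃ L ≠ 0, ∀ x ∈ l, τ^[L] x = x := by
  rcases hP.exists_conj γ with h' | ⟨u, l, h1, h2, h3, h4⟩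
  · exact Or.inl h'
  · refine Or.inr ⟨u, l, h1, h4, l.length, by simpa using h2, ?_⟩
    have h5 : (l.map τ) ~r l := by
      refine hP.isRotated_of_conj (h1.map τ hτ hτ1) h1 (by simpa using h3) h3
        (g := u * g * (τ u)⁻¹) ?_
      rw [← map_list_prod, ← h4]
      simp only [map_mul, map_inv]
      conv_rhs => rw [← e]
      group
    obtain ⟨r, hr⟩ := h5.symm
    have h6 : ∀ k, l.map (τ^[k]) = l.rotate (r * k) := by
      intro k
      induction k with
      | zero => simp
      | succ k ih =>
        rw [Function.iterate_succ, ← List.map_map, ← hr, List.map_rotate, ih, List.rotate_rotate]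
        congr 1
    have h7 := h6 l.length
    rw [mul_comm, List.rotate_length_mul] at h7
    intro x hx
    have h8 : l.map (τ^[l.length]) = l.map id := by simpa using h7
    exact List.map_inj_left.mp h8 x hx

end IsFreeProd
end FreeProduct
end BraidCoHopf

namespace BraidCoHopf

section FreeCyc

variable {ι W : Type} [Group W]

/-- `W` is the free product of cyclic groups of order `N` (infinite for `N = 0`) generated by the
elements `x i`. -/
structure IsFreeCyc (N : ℕ) (x : ι → W) : Prop where
  closure_range : Subgroup.closure (Set.range x) = ⊤
  pow : ∀ i, x i ^ N = 1
  lift : ∀ {G : Type} [Group G] (y : ι → G), (∀ i, y i ^ N = 1) → ∃ φ : W →* G, ∀ i, φ (x i) = y i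

/-- The subgroup generated by the `x i` with `f i = b`. -/
def blockSubgroup (x : ι → W) (f : ι → Bool) (b : Bool) : Subgroup W :=
  Subgroup.closure (x '' {i | f i = b})

lemma mem_blockSubgroup (x : ι → W) (f : ι → Bool) (i : ι) : x i ∈ blockSubgroup x f (f i) :=
  Subgroup.subset_closure ⟨i, rfl, rfl⟩

lemma mem_blockSubgroup' {x : ι → W} {f : ι → Bool} {i : ι} {b : Bool} (h : f i = b) :
    x i ∈ blockSubgroup x f b :=
  h ▸ mem_blockSubgroup x f i

lemma eqOn_blockSubgroup {G : Type*} [Group G] {x : ι → W} {f : ι → Bool} {b : Bool}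
    {φ ψ : W →* G} (h : ∀ i, f i = b → φ (x i) = ψ (x i)) {w : W}
    (hw : w ∈ blockSubgroup x f b) : φ w = ψ w := by
  have : Set.EqOn φ ψ (x '' {i | f i = b}) := by
    rintro _ ⟨i, hi, rfl⟩; exact h i hi
  exact MonoidHom.eqOn_closure this hw

lemma map_mem_blockSubgroup {x : ι → W} {f : ι → Bool} {b : Bool} {K : Subgroup W}
    {φ : W →* W} (h : ∀ i, f i = b → φ (x i) ∈ K) {w : W}
    (hw : w ∈ blockSubgroup x f b) : φ w ∈ K := by
  have : blockSubgroup x f b ≤ K.comap φ := by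
    rw [blockSubgroup, Subgroup.closure_le]
    rintro _ ⟨i, hi, rfl⟩; exact h i hi
  exact this hw

namespace IsFreeCyc

variable {N : ℕ} {x : ι → W} (hx : IsFreeCyc N x)
include hx

lemma hom_ext {G : Type*} [Group G] {φ ψ : W →* G} (h : ∀ i, φ (x i) = ψ (x i)) : φ = ψ :=
  MonoidHom.eq_of_eqOn_top (by
    rw [← hx.closure_range]
    exact MonoidHom.eqOn_closure (by rintro _ ⟨i, rfl⟩; exact h i))

lemma isFreeProd (f : ι → Bool) : IsFreeProd (blockSubgroup x f) := by
  classical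
  constructor
  · intro g
    suffices h : ∃ L : List W, (∀ z ∈ L, ∃ b, z ∈ blockSubgroup x f b) ∧ L.prod = g by
      obtain ⟨L, h1, h2⟩ := h
      obtain ⟨b, l, h3, -, h4⟩ := IsFreeProd.exists_alt_length_le L h1
      exact ⟨b, l, h3, h4.trans h2⟩
    have hg : g ∈ Subgroup.closure (Set.range x) := by rw [hx.closure_range]; trivial
    induction hg using Subgroup.closure_induction with
    | mem g hg =>
      obtain ⟨i, rfl⟩ := hg
      refine ⟨[x i], fun z hz => ?_, by simp⟩
      rw [List.mem_singleton.mp hz]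
      exact ⟨_, mem_blockSubgroup x f i⟩
    | one => exact ⟨[], by simp, rfl⟩
    | mul a b _ _ ha hb =>
      obtain ⟨L, h1, rfl⟩ := ha
      obtain ⟨L', h2, rfl⟩ := hb
      refine ⟨L ++ L', ?_, by simp⟩
      intro z hz
      rcases List.mem_append.mp hz with h | h
      exacts [h1 z h, h2 z h]
    | inv a _ ha =>
      obtain ⟨L, h1, rfl⟩ := ha
      refine ⟨(L.map (·⁻¹)).reverse, ?_, prod_ri L⟩
      intro z hz
      simp only [List.mem_reverse, List.mem_map] at hz
      obtain ⟨y, hy, rfl⟩ := hz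
      obtain ⟨b, hb⟩ := h1 y hy
      exact ⟨b, inv_mem hb⟩
  · obtain ⟨φ, hφ⟩ := hx.lift (G := Monoid.CoprodI fun b => blockSubgroup x f b)
      (fun i => Monoid.CoprodI.of (i := f i) ⟨x i, mem_blockSubgroup x f i⟩) (by
        intro i
        rw [← map_pow]
        have : (⟨x i, mem_blockSubgroup x f i⟩ : blockSubgroup x f (f i)) ^ N = 1 :=
          Subtype.ext (by simpa using hx.pow i)
        rw [this, map_one])
    have h1 : ∀ b (k : blockSubgroup x f b), φ k =
        Monoid.CoprodI.of (M := fun b => blockSubgroup x f b) (i := b) k := by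
      rintro b ⟨k, hk⟩
      induction hk using Subgroup.closure_induction with
      | mem k hk => obtain ⟨i, rfl, rfl⟩ := hk; exact hφ i
      | one => rw [map_one]; exact (map_one _).symm
      | mul a c ha hc h1 h2 =>
        rw [map_mul]
        erw [h1, h2]
        rw [← map_mul]; rfl
      | inv a ha h1 =>
        rw [map_inv]
        erw [h1]
        rw [← map_inv]; rfl
    have h2 : ∀ b l, AltList (blockSubgroup x f) b l → ∃ w : Monoid.CoprodI.Word
        (fun b => blockSubgroup x f b), w.prod = φ l.prod ∧
        ((l = [] ∧ w = Monoid.CoprodI.Word.empty) ∨ w.fstIdx = some b) := by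
      intro b l
      induction l generalizing b with
      | nil => exact fun _ => ⟨Monoid.CoprodI.Word.empty,
        by rw [Monoid.CoprodI.Word.prod_empty, List.prod_nil, map_one], Or.inl ⟨rfl, rfl⟩⟩
      | cons y t ih =>
        rintro ⟨⟨hy, hy1⟩, ht⟩
        obtain ⟨w, hw, hw'⟩ := ih _ ht
        refine ⟨Monoid.CoprodI.Word.cons (i := b) ⟨y, hy⟩ w ?_ ?_, ?_, Or.inr (Monoid.CoprodI.Word.fstIdx_cons _ _ _ _)⟩
        · rcases hw' with ⟨-, rfl⟩ | h
          · simp [Monoid.CoprodI.Word.fstIdx]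
          · rw [h]; simp
        · intro h; exact hy1 (congrArg Subtype.val h)
        · rw [Monoid.CoprodI.Word.prod_cons, hw, List.prod_cons, map_mul, ← h1]
    intro b l hl he
    obtain ⟨w, hw, hw'⟩ := h2 b l hl
    rw [he, map_one] at hw
    have : w = Monoid.CoprodI.Word.empty :=
      Monoid.CoprodI.Word.equiv.symm.injective (by simpa [Monoid.CoprodI.Word.equiv] using hw)
    rcases hw' with h | h
    · exact h.1
    · rw [this] at h; simp [Monoid.CoprodI.Word.fstIdx] at h

/-- The exponent sum of `x i`, modulo `N`. -/
lemma exists_coord [DecidableEq ι] (i : ι) : ∃ χ : W →* Multiplicative (ZMod N),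
    ∀ j, χ (x j) = if j = i then Multiplicative.ofAdd 1 else 1 :=
  hx.lift _ (by
    intro j
    split_ifs
    · rw [← ofAdd_nsmul]; simp
    · simp)

end IsFreeCyc

lemma ofAdd_one_ne_one {N : ℕ} (hN : N ≠ 1) : (Multiplicative.ofAdd (1 : ZMod N)) ≠ 1 := by
  have : (1 : ZMod N) ≠ 0 := by
    have := (ZMod.nontrivial_iff).mpr hN
    exact one_ne_zero
  exact this

lemma conj_map_eq {G : Type*} [CommGroup G] (χ : W →* G) (u w : W) : χ (u * w * u⁻¹) = χ w := by
  simp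

namespace IsFreeCyc

variable {N : ℕ} {x : ι → W} (hx : IsFreeCyc N x) (hN : N ≠ 1)
include hx hN

lemma ne_one (i : ι) : x i ≠ 1 := by
  classical
  obtain ⟨χ, hχ⟩ := hx.exists_coord i
  intro h
  have := hχ i
  rw [h] at this
  simp only [map_one, if_true] at this
  exact ofAdd_one_ne_one hN this.symm

omit hx hN in
lemma blockSubgroup_singleton [DecidableEq ι] (i : ι) :
    blockSubgroup x (fun j => decide (j = i)) true = Subgroup.zpowers (x i) := by
  have : x '' {j | decide (j = i) = true} = {x i} := by ext; simp [eq_comm]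
  rw [blockSubgroup, this, Subgroup.zpowers_eq_closure]

omit hN in
lemma mem_zpowers_of_commute {i : ι} {k : ℤ} (hk : x i ^ k ≠ 1) {w : W}
    (h : x i ^ k * w = w * x i ^ k) : w ∈ Subgroup.zpowers (x i) := by
  classical
  rw [← blockSubgroup_singleton]
  refine (hx.isFreeProd _).mem_of_commute ?_ hk h
  rw [blockSubgroup_singleton]
  exact Subgroup.zpow_mem_zpowers (x i) k

lemma mem_zpowers_of_commute' {i : ι} {w : W} (h : x i * w = w * x i) :
    w ∈ Subgroup.zpowers (x i) :=
  hx.mem_zpowers_of_commute (k := 1) (by simpa using hx.ne_one hN i) (by simpa using h)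

omit hN in
lemma eq_one_of_mem_zpowers {i j : ι} (hij : i ≠ j) {w : W} (h : w ∈ Subgroup.zpowers (x i))
    (h' : w ∈ Subgroup.zpowers (x j)) : w = 1 := by
  classical
  refine (hx.isFreeProd (fun k => decide (k = i))).disjoint (b := true) ?_ ?_
  · rwa [blockSubgroup_singleton]
  · refine (Subgroup.zpowers_le.mpr ?_) h'
    exact mem_blockSubgroup' (by simp [hij.symm])

end IsFreeCyc

/-- `h` commutes, up to an inner automorphism, with the partial conjugation of `W` that fixes
`x i`, `x i'` and conjugates the other generators by `x i * x i'`. -/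
def HasTwist (h : W →* W) (x : ι → W) (i i' : ι) : Prop :=
  ∃ (t : W →* W) (f : W), t (x i) = x i ∧ t (x i') = x i' ∧
    (∀ j, j ≠ i → j ≠ i' → t (x j) = (x i * x i') * x j * (x i * x i')⁻¹) ∧
    ∀ w, h (t w) = f * t (h w) * f⁻¹

lemma HasTwist.conj {h : W →* W} {x : ι → W} {i i' : ι} (H : HasTwist h x i i') (g : W) :
    HasTwist ((MulAut.conj g).toMonoidHom.comp h) x i i' := by
  obtain ⟨t, f, h1, h2, h3, h4⟩ := H
  refine ⟨t, g * f * (t g)⁻¹, h1, h2, h3, fun w => ?_⟩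
  simp [h4, mul_assoc]

namespace IsFreeCyc

variable {N : ℕ} {x : ι → W} (hx : IsFreeCyc N x) (hN : N ≠ 1)
include hx hN

lemma pair_conj_of_fix {h : W →* W} (hc : ∀ j, IsConj (x j) (h (x j))) {i i' j : ι} (hii : i ≠ i')
    (hji : j ≠ i) (hji' : j ≠ i') (H : HasTwist h x i i') (hi : h (x i) = x i) :
    ∃ u, u * x i * u⁻¹ = x i ∧ h (x i') = u * x i' * u⁻¹ := by
  classical
  obtain ⟨t, f, ht1, ht2, ht3, ht⟩ := H
  set c := x i * x i' with hcdef
  have hf : f ∈ Subgroup.zpowers (x i) := by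
    apply hx.mem_zpowers_of_commute' hN
    have := ht (x i)
    rw [ht1, hi, ht1, eq_mul_inv_iff_mul_eq] at this
    exact this
  obtain ⟨k, rfl⟩ := hf
  let F : ι → Bool := fun l => decide (l = i ∨ l = i')
  let A : Bool → Subgroup W := blockSubgroup x F
  have hP : IsFreeProd A := hx.isFreeProd F
  have hiA : x i ∈ A true := mem_blockSubgroup' (by simp [F])
  have hiA' : x i' ∈ A true := mem_blockSubgroup' (by simp [F])
  have hcA : c ∈ A true := mul_mem hiA hiA'
  have htA : ∀ w ∈ A true, t w = w := fun w hw =>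
    eqOn_blockSubgroup (φ := t) (ψ := MonoidHom.id W) (by
      intro l hl
      rcases (by simpa [F] using hl : l = i ∨ l = i') with rfl | rfl
      exacts [ht1, ht2]) hw
  let τ : W →* W := (MulAut.conj c⁻¹).toMonoidHom.comp t
  have hτA : ∀ w ∈ A true, τ w = c⁻¹ * w * c := fun w hw => by simp [τ, htA w hw]
  have hτB : ∀ w ∈ A false, τ w = w := fun w hw =>
    eqOn_blockSubgroup (φ := τ) (ψ := MonoidHom.id W) (by
      intro l hl
      have : ¬ (l = i ∨ l = i') := by simpa [F] using hl
      push Not at this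
      simp [τ, ht3 l this.1 this.2, mul_assoc]) hw
  have hτt : ∀ w, t w = c * τ w * c⁻¹ := fun w => by simp [τ, mul_assoc]
  have hτ : ∀ b, ∀ w ∈ A b, τ w ∈ A b := by
    rintro (_ | _) w hw
    · rwa [hτB w hw]
    · rw [hτA w hw]; exact mul_mem (mul_mem (inv_mem hcA) hw) hcA
  have hτ1 : ∀ b, ∀ w ∈ A b, τ w = 1 → w = 1 := by
    rintro (_ | _) w hw h1
    · rwa [hτB w hw] at h1
    · rw [hτA w hw] at h1
      have : w = c * (c⁻¹ * w * c) * c⁻¹ := by group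
      rw [this, h1]; simp
  obtain ⟨χ, hχ⟩ := hx.exists_coord i'
  have hχc : χ c ≠ 1 := by
    rw [hcdef, map_mul, hχ, hχ, if_neg hii, if_pos rfl, one_mul]
    exact ofAdd_one_ne_one hN
  have hχi : χ (x i) = 1 := by rw [hχ, if_neg hii]
  have hγ : h (x i') ∈ A true := by
    by_contra hγ
    have e := ht (x i')
    rw [ht2, hτt] at e
    obtain ⟨a, ha, hae⟩ := hP.exists_twisted hτ hτ1 (g := x i ^ k * c)
      (mul_mem (zpow_mem hiA k) hcA) hγ (by
        conv_rhs => rw [e]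
        group)
    rw [hτA a ha] at hae
    have := congrArg χ hae
    simp only [map_mul, map_zpow, map_inv, hχi] at this
    apply hχc
    simpa using this
  have hα : h c ∈ A true := by rw [hcdef, map_mul, hi]; exact mul_mem hiA hγ
  have hχh : ∀ w, χ (h w) = χ w := by
    intro w
    refine DFunLike.congr_fun (hx.hom_ext (φ := χ.comp h) (ψ := χ) fun l => ?_) w
    obtain ⟨u, hu⟩ := isConj_iff.mp (hc l)
    simp [← hu]
  obtain ⟨a, ha, hae⟩ : ∃ a ∈ A true, (h c)⁻¹ * x i ^ k * c * τ a = a := by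
    refine hP.exists_twisted (γ := h (x j)) hτ hτ1
      (mul_mem (mul_mem (inv_mem hα) (zpow_mem hiA k)) hcA) ?_ ?_
    · intro hj
      obtain ⟨χj, hχj⟩ := hx.exists_coord j
      have h1 : χj (h (x j)) = 1 := by
        refine eqOn_blockSubgroup (φ := χj) (ψ := 1) ?_ hj
        intro l hl
        rcases (by simpa [F] using hl : l = i ∨ l = i') with rfl | rfl
        · rw [hχj, if_neg hji.symm]; rfl
        · rw [hχj, if_neg hji'.symm]; rfl
      obtain ⟨u, hu⟩ := isConj_iff.mp (hc j)
      rw [← hu, conj_map_eq, hχj, if_pos rfl] at h1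
      exact ofAdd_one_ne_one hN h1
    · have e := ht (x j)
      rw [ht3 j hji hji', hτt, map_mul, map_mul, map_inv] at e
      have : h (x j) = (h c)⁻¹ * (h c * h (x j) * (h c)⁻¹) * h c := by group
      conv_rhs => rw [this, e]
      group
  rw [hτA a ha] at hae
  have hαe : h c = x i ^ k * a * c * a⁻¹ := by
    have : h c * a = x i ^ k * a * c := by
      conv_lhs => rw [← hae]
      group
    rw [← this]; group
  have hk : x i ^ k = 1 := by
    by_contra hk
    have e := ht c
    have htc : t c = c := htA c hcA
    rw [htc, htA _ hα, eq_mul_inv_iff_mul_eq] at e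
    obtain ⟨l, hl⟩ := hx.mem_zpowers_of_commute hk e.symm
    apply hχc
    rw [← hχh, ← hl, map_zpow, hχi, one_zpow]
  rw [hk, one_mul] at hαe
  -- compare cyclically reduced words in the free product `⟨x i⟩ * ⟨others⟩`
  let Q := blockSubgroup x (fun l => decide (l = i))
  have hQ : IsFreeProd Q := hx.isFreeProd _
  have hQi : x i ∈ Q true := mem_blockSubgroup' (by simp)
  have hQi' : x i' ∈ Q false := mem_blockSubgroup' (by simp [hii.symm])
  obtain ⟨v, hv⟩ := isConj_iff.mp (hc i')
  obtain ⟨a0, ha0, l, hl, rfl⟩ := hQ.exists_left true v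
  obtain ⟨w, hw, ew, b, hb, hlw⟩ : ∃ w, AltList Q false w ∧ Even w.length ∧
      ∃ b ∈ Q false, l.prod = w.prod * b := by
    rcases Nat.even_or_odd l.length with el | ol
    · exact ⟨l, hl, el, 1, one_mem _, by simp⟩
    · rcases List.eq_nil_or_concat l with rfl | ⟨w, b, rfl⟩
      · simp at ol
      · have ew : Even w.length := by simpa [Nat.odd_add_one] using ol
        rw [List.concat_eq_append, altList_append, nextType_even _ ew] at hl
        exact ⟨w, hl.1, ew, b, hl.2.1.1, by simp⟩
  have hy : AltList Q true (x i :: (w ++ (b * x i' * b⁻¹) :: (w.map (·⁻¹)).reverse)) := by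
    refine ⟨⟨hQi, hx.ne_one hN i⟩, ?_⟩
    rw [altList_append]
    refine ⟨hw, ?_⟩
    have h1 := altList_ri hw
    simp only [nextType_even _ ew, Bool.not_true, Bool.not_false] at h1 ⊢
    refine ⟨⟨mul_mem (mul_mem hb hQi') (inv_mem hb), ?_⟩, h1⟩
    intro h
    exact hx.ne_one hN i' (by simpa using h)
  have hy2 : AltList Q true [x i, x i'] :=
    ⟨⟨hQi, hx.ne_one hN i⟩, ⟨hQi', hx.ne_one hN i'⟩, trivial⟩
  have hcomm : a0 * x i = x i * a0 := by
    have h1 := hQ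
    rw [show Q true = _ from blockSubgroup_singleton i] at ha0
    obtain ⟨n, rfl⟩ := ha0
    exact ((Commute.refl (x i)).zpow_left n).eq
  have hrot := hQ.isRotated_of_conj hy hy2 (by simp)
    (by simp) (g := a⁻¹ * a0) (by
      have e2 : x i * h (x i') = a * c * a⁻¹ := by rw [← hαe, hcdef, map_mul, hi]
      rw [← hv] at e2
      have e3 : [x i, x i'].prod = a⁻¹ * (a * c * a⁻¹) * a := by
        simp only [List.prod_cons, List.prod_nil, mul_one]; rw [hcdef]; group
      rw [e3, ← e2, hlw]
      simp only [List.prod_cons, List.prod_append, prod_ri, mul_inv_rev, mul_assoc]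
      congr 1
      rw [← mul_assoc a0, hcomm]
      simp only [mul_assoc, inv_inv])
  have hlen := hrot.perm.length_eq
  have hw0 : w = [] := by
    rw [← List.length_eq_zero_iff]
    simp at hlen; omega
  subst hw0
  have hmem : b * x i' * b⁻¹ = x i' := by
    have : b * x i' * b⁻¹ ∈ [x i, x i'] := hrot.perm.mem_iff.mp (by simp)
    simp only [List.mem_cons, List.not_mem_nil, or_false] at this
    rcases this with h | h
    · exfalso
      apply hx.ne_one hN i
      refine hQ.disjoint hQi ?_
      rw [← h]
      exact mul_mem (mul_mem hb hQi') (inv_mem hb)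
    · exact h
  refine ⟨a0, by rw [hcomm]; group, ?_⟩
  rw [← hv, hlw]
  conv_rhs => rw [← hmem]
  simp [mul_assoc]

lemma pair_conj {h : W →* W} (hc : ∀ j, IsConj (x j) (h (x j))) {i i' j : ι} (hii : i ≠ i')
    (hji : j ≠ i) (hji' : j ≠ i') (H : HasTwist h x i i') :
    ∃ u, h (x i) = u * x i * u⁻¹ ∧ h (x i') = u * x i' * u⁻¹ := by
  obtain ⟨g, hg⟩ := isConj_iff.mp (hc i)
  obtain ⟨u, h1, h2⟩ := hx.pair_conj_of_fix hN (h := (MulAut.conj g⁻¹).toMonoidHom.comp h)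
    (by
      intro l
      refine (hc l).trans (isConj_iff.mpr ⟨g⁻¹, by simp⟩)) hii hji hji' (H.conj g⁻¹)
    (by simp [← hg, mul_assoc])
  refine ⟨g * u, ?_, ?_⟩
  · rw [← hg]
    conv_lhs => rw [← h1]
    group
  · simp only [MonoidHom.comp_apply, MulEquiv.toMonoidHom_eq_coe, MonoidHom.coe_coe,
      MulAut.conj_apply] at h2
    have : h (x i') = g * (g⁻¹ * h (x i') * g⁻¹⁻¹) * g⁻¹ := by group
    rw [this, h2]; group

lemma fix_of_fix_pair {h : W →* W} (hc : ∀ j, IsConj (x j) (h (x j))) {i i' i'' : ι} (hii : i ≠ i')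
    (h02 : i ≠ i'') (h12 : i' ≠ i'') (H : HasTwist h x i i') (H' : HasTwist h x i' i'')
    (hi : h (x i) = x i) (hi' : h (x i') = x i') : h (x i'') = x i'' := by
  classical
  obtain ⟨u, hu1, hu2⟩ := hx.pair_conj hN hc h12 hii h02 H'
  have hu : u ∈ Subgroup.zpowers (x i') := by
    apply hx.mem_zpowers_of_commute' hN
    rw [hi', eq_mul_inv_iff_mul_eq] at hu1
    exact hu1
  obtain ⟨t, f, ht1, ht2, ht3, ht⟩ := H
  have hf1 : f = 1 := by
    refine hx.eq_one_of_mem_zpowers hii ?_ ?_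
    · apply hx.mem_zpowers_of_commute' hN
      have := ht (x i)
      rw [ht1, hi, ht1, eq_mul_inv_iff_mul_eq] at this
      exact this
    · apply hx.mem_zpowers_of_commute' hN
      have := ht (x i')
      rw [ht2, hi', ht2, eq_mul_inv_iff_mul_eq] at this
      exact this
  subst hf1
  set c := x i * x i' with hcdef
  have hhc : h c = c := by rw [hcdef, map_mul, hi, hi']
  have htu : t u = u := by
    obtain ⟨n, rfl⟩ := hu
    simp [ht2]
  have e := ht (x i'')
  rw [ht3 i'' h02.symm h12.symm, map_mul, map_mul, map_inv, hhc, hu2, map_mul, map_mul, map_inv,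
    ht3 i'' h02.symm h12.symm, htu] at e
  let F : ι → Bool := fun l => decide (l = i'')
  have hP := hx.isFreeProd F
  have h1 : x i ∈ blockSubgroup x F false := mem_blockSubgroup' (by simp [F, h02])
  have h2 : x i' ∈ blockSubgroup x F false := mem_blockSubgroup' (by simp [F, h12])
  have h3 : u ∈ blockSubgroup x F false := (Subgroup.zpowers_le.mpr h2) hu
  have h4 : (u * c)⁻¹ * (c * u) = 1 := by
    refine hP.disjoint (b := true) ?_
      (mul_mem (inv_mem (mul_mem h3 (mul_mem h1 h2))) (mul_mem (mul_mem h1 h2) h3))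
    refine hP.mem_of_commute (a := x i'') (mem_blockSubgroup' (by simp [F]))
      (hx.ne_one hN i'') ?_
    have e' : (c * u) * x i'' * (c * u)⁻¹ = (u * c) * x i'' * (u * c)⁻¹ := by
      simpa [mul_assoc] using e
    rw [mul_inv_eq_iff_eq_mul] at e'
    calc x i'' * ((u * c)⁻¹ * (c * u))
        = (u * c)⁻¹ * (u * c * x i'' * (u * c)⁻¹ * (c * u)) := by group
      _ = (u * c)⁻¹ * (c * u * x i'') := by rw [← e']
      _ = _ := by simp only [mul_assoc]
  rw [inv_mul_eq_one] at h4
  have h5 : u = 1 := by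
    refine hx.eq_one_of_mem_zpowers hii ?_ hu
    apply hx.mem_zpowers_of_commute' hN
    obtain ⟨n, rfl⟩ := hu
    have h6 : x i' * x i' ^ n = x i' ^ n * x i' := by group
    rw [hcdef] at h4
    simp only at h4
    have : x i * x i' ^ n * x i' = x i' ^ n * x i * x i' := by
      rw [mul_assoc, ← h6, ← mul_assoc, ← h4, mul_assoc]
    exact mul_right_cancel this
  rw [hu2, h5]; simp

end IsFreeCyc

/-- A conjugacy-preserving endomorphism of a free product of cyclic groups which commutes with the
partial conjugations of adjacent pairs up to inner automorphisms is inner. -/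
theorem IsFreeCyc.eq_conj {N m : ℕ} {x : Fin m → W} (hx : IsFreeCyc N x) (hN : N ≠ 1) (hm : 3 ≤ m)
    {h : W →* W} (hc : ∀ j, IsConj (x j) (h (x j)))
    (H : ∀ i (hi : i + 1 < m), HasTwist h x ⟨i, by omega⟩ ⟨i + 1, hi⟩) :
    ∃ u, ∀ w, h w = u * w * u⁻¹ := by
  obtain ⟨u, h0, h1⟩ := hx.pair_conj hN hc (i := ⟨0, by omega⟩) (i' := ⟨1, by omega⟩)
    (j := ⟨2, by omega⟩) (by simp) (by simp) (by simp) (H 0 (by omega))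
  refine ⟨u, ?_⟩
  set h' := (MulAut.conj u⁻¹).toMonoidHom.comp h with hh'
  have hc' : ∀ j, IsConj (x j) (h' (x j)) := fun l =>
    (hc l).trans (isConj_iff.mpr ⟨u⁻¹, by simp [h']⟩)
  have key : ∀ k (hk : k + 1 < m), h' (x ⟨k, by omega⟩) = x ⟨k, by omega⟩ ∧
      h' (x ⟨k + 1, hk⟩) = x ⟨k + 1, hk⟩ := by
    intro k
    induction k with
    | zero => intro hk; exact ⟨by simp [h', h0, mul_assoc], by simp [h', h1, mul_assoc]⟩
    | succ k ih =>
      intro hk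
      obtain ⟨h2, h3⟩ := ih (by omega)
      refine ⟨h3, hx.fix_of_fix_pair hN hc' (i := ⟨k, by omega⟩) (i' := ⟨k + 1, by omega⟩)
        (by simp) (by simp; omega) (by simp) ((H k (by omega)).conj u⁻¹) ((H (k + 1) (by omega)).conj u⁻¹) h2 h3⟩
  have hid : h' = MonoidHom.id W := hx.hom_ext (by
    rintro ⟨k, hk⟩
    cases k with
    | zero => exact (key 0 (by omega)).1
    | succ k => exact (key k hk).2)
  intro w
  have := DFunLike.congr_fun hid w
  simp only [hh', MonoidHom.comp_apply, MulEquiv.toMonoidHom_eq_coe, MonoidHom.coe_coe,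
    MulAut.conj_apply, MonoidHom.id_apply, inv_inv] at this
  calc h w = u * (u⁻¹ * h w * u) * u⁻¹ := by group
    _ = _ := by rw [this]

end FreeCyc
end BraidCoHopf

namespace BraidCoHopf

section Free

lemma isFreeCyc_freeGroup (ι : Type) : IsFreeCyc 0 (FreeGroup.of : ι → FreeGroup ι) where
  closure_range := FreeGroup.closure_range_of ι
  pow := fun _ => pow_zero _
  lift := fun y _ => ⟨FreeGroup.lift y, fun _ => FreeGroup.lift_apply_of⟩

lemma exists_zpow_of_commute {W : Type} [Group W] [IsFreeGroup W] {a b : W} (h : a * b = b * a) :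
    ∃ (r : W) (p q : ℤ), a = r ^ p ∧ b = r ^ q := by
  let H := Subgroup.closure ({a, b} : Set W)
  have hcomm : ∀ x ∈ H, ∀ y ∈ H, x * y = y * x := by
    intro x hx y hy
    have := Subgroup.isMulCommutative_closure (k := ({a, b} : Set W)) (by
      rintro x (rfl | rfl) y (rfl | rfl)
      exacts [rfl, h, h.symm, rfl])
    exact congrArg Subtype.val (mul_comm' (⟨x, hx⟩ : H) ⟨y, hy⟩)
  let e := IsFreeGroup.toFreeGroup H
  have hx := isFreeCyc_freeGroup (IsFreeGroup.Generators H)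
  have hsub : ∀ x y : IsFreeGroup.Generators H, x = y := by
    intro x y
    by_contra hxy
    have hc : FreeGroup.of x * FreeGroup.of y = FreeGroup.of y * FreeGroup.of x := by
      apply e.symm.injective
      rw [map_mul, map_mul]
      exact Subtype.ext (hcomm _ (e.symm _).2 _ (e.symm _).2)
    exact hx.ne_one (by norm_num) y (hx.eq_one_of_mem_zpowers hxy
      (hx.mem_zpowers_of_commute' (by norm_num) hc) (Subgroup.mem_zpowers _))
  have haH : a ∈ H := Subgroup.subset_closure (by simp)
  have hbH : b ∈ H := Subgroup.subset_closure (by simp)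
  rcases isEmpty_or_nonempty (IsFreeGroup.Generators H) with hE | ⟨⟨x⟩⟩
  · have : ∀ w : H, w = 1 := fun w => e.injective (Subsingleton.elim _ _)
    exact ⟨1, 0, 0, by simpa using congrArg Subtype.val (this ⟨a, haH⟩),
      by simpa using congrArg Subtype.val (this ⟨b, hbH⟩)⟩
  · have key : ∀ w : H, ∃ n : ℤ, w = e.symm (FreeGroup.of x) ^ n := by
      intro w
      have : e w ∈ Subgroup.closure (Set.range FreeGroup.of) := by rw [hx.closure_range]; trivial
      have hr : Set.range (FreeGroup.of (α := IsFreeGroup.Generators H)) = {FreeGroup.of x} := by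
        ext z
        constructor
        · rintro ⟨y, rfl⟩; rw [hsub y x]; rfl
        · rintro rfl; exact ⟨x, rfl⟩
      rw [hr, ← Subgroup.zpowers_eq_closure] at this
      obtain ⟨n, hn⟩ := this
      exact ⟨n, by rw [← map_zpow]; apply e.injective; simpa using hn.symm⟩
    obtain ⟨p, hp⟩ := key ⟨a, haH⟩
    obtain ⟨q, hq⟩ := key ⟨b, hbH⟩
    exact ⟨e.symm (FreeGroup.of x), p, q, by simpa using congrArg Subtype.val hp,
      by simpa using congrArg Subtype.val hq⟩

/-- A homomorphism from a perfect group to a free group is trivial. -/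
lemma eq_one_of_perfect {H W : Type} [Group H] [Group W] [IsFreeGroup W]
    (hH : commutator H = ⊤) (f : H →* W) : f = 1 := by
  let e := IsFreeGroup.toFreeGroup f.range
  have hE : IsEmpty (IsFreeGroup.Generators f.range) := by
    refine ⟨fun x => ?_⟩
    let φ : FreeGroup (IsFreeGroup.Generators f.range) →* Multiplicative ℤ :=
      FreeGroup.lift (fun _ => Multiplicative.ofAdd 1)
    have h1 : commutator H ≤ ((φ.comp e.toMonoidHom).comp f.rangeRestrict).ker :=
      Abelianization.commutator_subset_ker _
    rw [hH] at h1
    obtain ⟨⟨_, ⟨y, rfl⟩⟩, hy⟩ := e.surjective (FreeGroup.of x)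
    have h2 := h1 (Subgroup.mem_top y)
    rw [MonoidHom.mem_ker] at h2
    have h3 : φ (e (f.rangeRestrict y)) = 1 := h2
    have h4 : e (f.rangeRestrict y) = FreeGroup.of x := hy
    rw [h4] at h3
    simp [φ] at h3
  ext h
  have : f.rangeRestrict h = 1 := e.injective (Subsingleton.elim _ _)
  simpa using congrArg Subtype.val this

lemma map_eq_one_of_commute {W : Type} [Group W] [IsFreeGroup W] {a c : W} (h : a * c = c * a)
    (hc : c ≠ 1) (ψ : W →* Multiplicative ℤ) (hψ : ψ c = 1) : ψ a = 1 := by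
  obtain ⟨r, p, q, rfl, rfl⟩ := exists_zpow_of_commute h
  have hq : q ≠ 0 := by rintro rfl; simp at hc
  have : ψ r = 1 := by
    rw [map_zpow] at hψ
    have h2 : q = 0 ∨ ψ r = 1 := by simpa using congrArg Multiplicative.toAdd hψ
    exact h2.resolve_left hq
  simp [this]

end Free

section ConjClasses

variable {ι W : Type} [Group W]

lemma IsFreeCyc.exists_conj_zpow {N : ℕ} {x : ι → W} (hx : IsFreeCyc N x) {f g : ι → Bool}
    {i : ι} (hfi : ∀ j, f j = true → g j = true → j = i) {α u v : W}
    (hu : u * α * u⁻¹ ∈ blockSubgroup x f true) (hv : v * α * v⁻¹ ∈ blockSubgroup x g true) :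
    ∃ (w : W) (k : ℤ), w * α * w⁻¹ = x i ^ k := by
  obtain ⟨r, hr⟩ := hx.lift (fun j => if g j = true then x j else 1) (by
    intro j; split_ifs; exacts [hx.pow j, one_pow N])
  have h1 : r (v * α * v⁻¹) = v * α * v⁻¹ :=
    eqOn_blockSubgroup (φ := r) (ψ := MonoidHom.id W) (fun j hj => by simp [hr, hj]) hv
  have h2 : r (u * α * u⁻¹) ∈ Subgroup.zpowers (x i) :=
    map_mem_blockSubgroup (fun j hj => by
      rw [hr]
      split_ifs with hg
      · rw [hfi j hj hg]; exact Subgroup.mem_zpowers _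
      · exact one_mem _) hu
  obtain ⟨k, hk⟩ := h2
  refine ⟨r u * (r v)⁻¹ * v, k, ?_⟩
  have h3 : v * α * v⁻¹ = r v * r α * (r v)⁻¹ := by rw [← h1]; simp
  calc r u * (r v)⁻¹ * v * α * (r u * (r v)⁻¹ * v)⁻¹
      = r u * (r v)⁻¹ * (v * α * v⁻¹) * (r v * (r u)⁻¹) := by group
    _ = r u * r α * (r u)⁻¹ := by rw [h3]; group
    _ = x i ^ k := by rw [← map_mul, ← map_inv, ← map_mul]; exact hk.symm

lemma IsFreeCyc.conj_mem_pair [IsFreeGroup W] [DecidableEq ι] {x : ι → W} (hx : IsFreeCyc 0 x)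
    {i i' : ι} (hii : i ≠ i')
    {τ : W →* W} (hi : τ (x i) = (x i * x i')⁻¹ * x i * (x i * x i'))
    (hi' : τ (x i') = (x i * x i')⁻¹ * x i' * (x i * x i'))
    (ho : ∀ j, j ≠ i → j ≠ i' → τ (x j) = x j) {α g : W} (hα : g * τ α * g⁻¹ = α)
    {ψ : W →* Multiplicative ℤ} (hψ : ψ (x i * x i') = 1)
    (hψo : ∀ j, j ≠ i → j ≠ i' → ψ (x j) = 1) (hψα : ψ α ≠ 1) :
    ∃ u, u * α * u⁻¹ ∈ blockSubgroup x (fun l => decide (l = i ∨ l = i')) true := by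
  let F : ι → Bool := fun l => decide (l = i ∨ l = i')
  let A : Bool → Subgroup W := blockSubgroup x F
  set c := x i * x i' with hcdef
  have hP : IsFreeProd A := hx.isFreeProd F
  have hiA : x i ∈ A true := mem_blockSubgroup' (by simp [F])
  have hiA' : x i' ∈ A true := mem_blockSubgroup' (by simp [F])
  have hcA : c ∈ A true := mul_mem hiA hiA'
  have hτA : ∀ w ∈ A true, τ w = c⁻¹ * w * c := fun w hw => by
    have := eqOn_blockSubgroup (φ := τ) (ψ := (MulAut.conj c⁻¹).toMonoidHom) (by
      intro l hl
      rcases (by simpa [F] using hl : l = i ∨ l = i') with rfl | rfl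
      · simp [hi]
      · simp [hi']) hw
    simpa using this
  have hτB : ∀ w ∈ A false, τ w = w := fun w hw =>
    eqOn_blockSubgroup (φ := τ) (ψ := MonoidHom.id W) (by
      intro l hl
      have : ¬ (l = i ∨ l = i') := by simpa [F] using hl
      push Not at this
      simp [ho l this.1 this.2]) hw
  have hψB : ∀ w ∈ A false, ψ w = 1 := fun w hw =>
    eqOn_blockSubgroup (φ := ψ) (ψ := 1) (by
      intro l hl
      have : ¬ (l = i ∨ l = i') := by simpa [F] using hl
      push Not at this
      simp [hψo l this.1 this.2]) hw
  have hτ : ∀ b, ∀ w ∈ A b, τ w ∈ A b := by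
    rintro (_ | _) w hw
    · rwa [hτB w hw]
    · rw [hτA w hw]; exact mul_mem (mul_mem (inv_mem hcA) hw) hcA
  have hτ1 : ∀ b, ∀ w ∈ A b, τ w = 1 → w = 1 := by
    rintro (_ | _) w hw h1
    · rwa [hτB w hw] at h1
    · rw [hτA w hw] at h1
      have : w = c * (c⁻¹ * w * c) * c⁻¹ := by group
      rw [this, h1]; simp
  rcases hP.conj_mem_or_fixed hτ hτ1 hα with ⟨u, b, hu⟩ | ⟨u, l, hl, hul, L, hL, hfix⟩
  · cases b with
    | true => exact ⟨u, hu⟩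
    | false =>
      exfalso
      apply hψα
      rw [← conj_map_eq ψ u α, hψB _ hu]
  · exfalso
    apply hψα
    rw [← conj_map_eq ψ u α, hul, map_list_prod]
    apply List.prod_eq_one
    intro z hz
    obtain ⟨a, ha, rfl⟩ := List.mem_map.mp hz
    obtain ⟨b, hb⟩ := hl.mem ha
    cases b with
    | false => exact hψB a hb
    | true =>
      have hit : ∀ n : ℕ, τ^[n] a = (c ^ n)⁻¹ * a * c ^ n ∧ τ^[n] a ∈ A true := by
        intro n
        induction n with
        | zero => simpa using hb
        | succ n ih =>
          rw [Function.iterate_succ_apply', hτA _ ih.2, ih.1]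
          refine ⟨by rw [pow_succ]; group, ?_⟩
          rw [← ih.1]
          exact mul_mem (mul_mem (inv_mem hcA) ih.2) hcA
      have hcL : c ^ L ≠ 1 := by
        obtain ⟨χ, hχ⟩ := hx.exists_coord i
        intro h
        have h1 : χ (c ^ L) = 1 := by rw [h, map_one]
        rw [map_pow, hcdef, map_mul, hχ, hχ, if_pos rfl, if_neg hii.symm, mul_one,
          ← ofAdd_nsmul] at h1
        have h2 : (L • (1 : ZMod 0)) = 0 := h1
        rw [nsmul_eq_mul, mul_one] at h2
        exact hL (by exact_mod_cast (show ((L : ℤ)) = 0 from h2))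
      refine map_eq_one_of_commute (c := c ^ L) ?_ hcL ψ (by rw [map_pow, hψ, one_pow])
      have h1 := (hit L).1
      rw [hfix a ha] at h1
      calc a * c ^ L = c ^ L * ((c ^ L)⁻¹ * a * c ^ L) := by group
        _ = c ^ L * a := by rw [← h1]

end ConjClasses
end BraidCoHopf

namespace BraidCoHopf

/-- The braid group with `m` standard generators, that is, on `m + 1` strands. -/
abbrev Br (m : ℕ) : Type := PresentedGroup (braidRels m)

/-- The standard generators of `Br m`, extended by `1` outside their range. -/
def s (m i : ℕ) : Br m := if h : i < m then PresentedGroup.of ⟨i, h⟩ else 1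

lemma s_of_le {m i : ℕ} (h : m ≤ i) : s m i = 1 := by simp [s, h]

lemma s_comm (m : ℕ) {i j : ℕ} (h : i + 2 ≤ j) : s m i * s m j = s m j * s m i := by
  by_cases hj : j < m
  · have hi : i < m := by omega
    simp only [s, hi, hj, dif_pos]
    have := PresentedGroup.one_of_mem (rels := braidRels m)
      (x := FreeGroup.of ⟨i, hi⟩ * FreeGroup.of ⟨j, hj⟩ *
        (FreeGroup.of ⟨j, hj⟩ * FreeGroup.of ⟨i, hi⟩)⁻¹) ⟨⟨i, hi⟩, ⟨j, hj⟩, Or.inr ⟨h, rfl⟩⟩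
    rw [map_mul, map_inv, mul_inv_eq_one] at this
    exact this
  · simp [s_of_le (not_lt.mp hj)]

lemma s_comm' (m : ℕ) {i j : ℕ} (h : i + 2 ≤ j ∨ j + 2 ≤ i) : Commute (s m i) (s m j) :=
  h.elim (fun h => s_comm m h) fun h => (s_comm m h).symm

lemma s_braid {m i : ℕ} (h : i + 1 < m) :
    s m i * s m (i + 1) * s m i = s m (i + 1) * s m i * s m (i + 1) := by
  have hi : i < m := by omega
  simp only [s, hi, h, dif_pos]
  have := PresentedGroup.one_of_mem (rels := braidRels m)
    (x := FreeGroup.of ⟨i, hi⟩ * FreeGroup.of ⟨i + 1, h⟩ * FreeGroup.of ⟨i, hi⟩ *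
      (FreeGroup.of ⟨i + 1, h⟩ * FreeGroup.of ⟨i, hi⟩ * FreeGroup.of ⟨i + 1, h⟩)⁻¹)
      ⟨⟨i, hi⟩, ⟨i + 1, h⟩, Or.inl ⟨rfl, rfl⟩⟩
  rw [map_mul, map_inv, mul_inv_eq_one] at this
  exact this

lemma exists_lift {m : ℕ} {G : Type*} [Group G] (f : ℕ → G)
    (hb : ∀ i, i + 1 < m → f i * f (i + 1) * f i = f (i + 1) * f i * f (i + 1))
    (hc : ∀ i j, i + 2 ≤ j → j < m → f i * f j = f j * f i) :
    ∃ φ : Br m →* G, ∀ i < m, φ (s m i) = f i := by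
  refine ⟨PresentedGroup.toGroup (f := fun i : Fin m => f i) ?_, fun i hi => ?_⟩
  · rintro r ⟨⟨i, hi⟩, ⟨j, hj⟩, ⟨h, rfl⟩ | ⟨h, rfl⟩⟩
    · obtain rfl : i + 1 = j := h
      simp only [map_mul, map_inv, FreeGroup.lift_apply_of, mul_inv_eq_one]
      exact hb i hj
    · simp only [map_mul, map_inv, FreeGroup.lift_apply_of, mul_inv_eq_one]
      exact hc i j h hj
  · rw [s, dif_pos hi]
    exact PresentedGroup.toGroup.of _

lemma closure_s (m : ℕ) : Subgroup.closure {g | ∃ i < m, g = s m i} = ⊤ := by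
  rw [eq_top_iff, ← PresentedGroup.closure_range_of (braidRels m)]
  apply Subgroup.closure_mono
  rintro _ ⟨⟨i, hi⟩, rfl⟩
  exact ⟨i, hi, by simp [s, hi]⟩

lemma hom_ext {m : ℕ} {G : Type*} [Group G] {φ ψ : Br m →* G}
    (h : ∀ i < m, φ (s m i) = ψ (s m i)) : φ = ψ :=
  MonoidHom.eq_of_eqOn_top (by
    rw [← closure_s]
    exact MonoidHom.eqOn_closure (by rintro _ ⟨i, hi, rfl⟩; exact h i hi))

lemma le_of_s_mem {m : ℕ} {K : Subgroup (Br m)} (h : ∀ i < m, s m i ∈ K) (g : Br m) : g ∈ K := by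
  have : Subgroup.closure {g | ∃ i < m, g = s m i} ≤ K := by
    rw [Subgroup.closure_le]; rintro _ ⟨i, hi, rfl⟩; exact h i hi
  rw [closure_s] at this
  exact this trivial

/-- Cocycles on the braid group with values in `G`, for an action of `Br m` on `S`. -/
lemma exists_cocycle {m : ℕ} {S G : Type*} [Group G] (p : Br m →* Equiv.Perm S) (e : ℕ → S → G)
    (hb : ∀ i, i + 1 < m → ∀ k, e i (p (s m (i + 1)) (p (s m i) k)) * e (i + 1) (p (s m i) k) *
      e i k = e (i + 1) (p (s m i) (p (s m (i + 1)) k)) * e i (p (s m (i + 1)) k) * e (i + 1) k)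
    (hc : ∀ i j, i + 2 ≤ j → j < m → ∀ k,
      e i (p (s m j) k) * e j k = e j (p (s m i) k) * e i k) :
    ∃ c : Br m → S → G, (∀ g h k, c (g * h) k = c g (p h k) * c h k) ∧
      ∀ i < m, ∀ k, c (s m i) k = e i k := by
  let a : ℕ → Equiv.Perm (S × G) := fun i =>
    { toFun := fun q => (p (s m i) q.1, e i q.1 * q.2)
      invFun := fun q => ((p (s m i))⁻¹ q.1, (e i ((p (s m i))⁻¹ q.1))⁻¹ * q.2)
      left_inv := fun q => by simp
      right_inv := fun q => by simp }
  have ha : ∀ i k x, a i (k, x) = (p (s m i) k, e i k * x) := fun i k x => rfl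
  have hp : ∀ g h k, p g (p h k) = p (g * h) k := fun g h k => by simp
  obtain ⟨Φ, hΦ⟩ := exists_lift (m := m) a (by
      intro i hi
      ext1 ⟨k, x⟩
      simp only [Equiv.Perm.mul_apply, ha, ← mul_assoc, hb i hi k]
      simp only [hp, ← mul_assoc, s_braid hi]) (by
      intro i j hij hj
      ext1 ⟨k, x⟩
      simp only [Equiv.Perm.mul_apply, ha, ← mul_assoc, hc i j hij hj k]
      simp only [hp, s_comm m hij])
  let K : Subgroup (Br m) :=
    { carrier := {g | ∀ k x, Φ g (k, x) = (p g k, (Φ g (k, 1)).2 * x)}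
      one_mem' := fun k x => by simp
      mul_mem' := fun {g h} hg hh k x => by
        rw [map_mul, Equiv.Perm.mul_apply, hh, hg, Equiv.Perm.mul_apply, hh k 1,
          hg _ (_ * 1)]
        simp [mul_assoc]
      inv_mem' := fun {g} hg k x => by
        have h1 : ∀ y, Φ g⁻¹ (k, y) = (p g⁻¹ k, ((Φ g (p g⁻¹ k, 1)).2)⁻¹ * y) := by
          intro y
          rw [map_inv, Equiv.Perm.inv_eq_iff_eq, hg]
          simp
        rw [h1, h1]; simp }
  have hK : ∀ g k x, Φ g (k, x) = (p g k, (Φ g (k, 1)).2 * x) := fun g =>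
    le_of_s_mem (K := K) (fun i hi k x => by rw [hΦ i hi, ha, ha]; simp) g
  refine ⟨fun g k => (Φ g (k, 1)).2, fun g h k => ?_, fun i hi k => ?_⟩
  · show (Φ (g * h) (k, 1)).2 = _
    rw [map_mul, Equiv.Perm.mul_apply, hK h, hK g]
    simp
  · simp only [hΦ i hi, ha, mul_one]

end BraidCoHopf

namespace BraidCoHopf

/-- An automorphism of a group generated by the `x i` with the formula of an Artin generator. -/
structure IsArt {ι W : Type} [Group W] (x : ι → W) (p q : ι) (φ : MulAut W) : Prop where
  left : φ (x p) = x q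
  right : φ (x q) = (x q)⁻¹ * x p * x q
  other : ∀ l, l ≠ p → l ≠ q → φ (x l) = x l

section Art

variable {ι W : Type} [Group W] {N : ℕ} {x : ι → W}

lemma IsFreeCyc.mulAut_ext (hx : IsFreeCyc N x) {φ ψ : MulAut W} (h : ∀ i, φ (x i) = ψ (x i)) :
    φ = ψ := by
  have := hx.hom_ext (φ := φ.toMonoidHom) (ψ := ψ.toMonoidHom) h
  ext w
  exact DFunLike.congr_fun this w

lemma IsFreeCyc.exists_isArt [DecidableEq ι] (hx : IsFreeCyc N x) {p q : ι} (hpq : p ≠ q) :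
    ∃ φ, IsArt x p q φ := by
  obtain ⟨f, hf⟩ := hx.lift (fun l => if l = p then x q else
    if l = q then (x q)⁻¹ * x p * x q else x l) (by
      intro l
      split_ifs
      · exact hx.pow q
      · have h := conj_pow (a := (x q)⁻¹) (b := x p) (i := N)
        rw [inv_inv, hx.pow] at h
        simpa using h
      · exact hx.pow l)
  obtain ⟨g, hg⟩ := hx.lift (fun l => if l = q then x p else
    if l = p then x p * x q * (x p)⁻¹ else x l) (by
      intro l
      split_ifs
      · exact hx.pow p
      · have h := conj_pow (a := x p) (b := x q) (i := N)
        rw [hx.pow] at h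
        simpa using h
      · exact hx.pow l)
  have hfp : f (x p) = x q := by simp [hf]
  have hfq : f (x q) = (x q)⁻¹ * x p * x q := by simp [hf, hpq.symm]
  have hgq : g (x q) = x p := by simp [hg]
  have hgp : g (x p) = x p * x q * (x p)⁻¹ := by simp [hg, hpq]
  have hfo : ∀ l, l ≠ p → l ≠ q → f (x l) = x l := fun l h1 h2 => by simp [hf, h1, h2]
  have hgo : ∀ l, l ≠ p → l ≠ q → g (x l) = x l := fun l h1 h2 => by simp [hg, h1, h2]
  have h1 : g.comp f = MonoidHom.id W := hx.hom_ext fun l => by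
    by_cases hlp : l = p
    · subst hlp; simp [hfp, hgq]
    by_cases hlq : l = q
    · subst hlq; simp [hfq, hgq, hgp, mul_assoc]
    simp [hfo l hlp hlq, hgo l hlp hlq]
  have h2 : f.comp g = MonoidHom.id W := hx.hom_ext fun l => by
    by_cases hlp : l = p
    · subst hlp; simp [hgp, hfp, hfq, mul_assoc]
    by_cases hlq : l = q
    · subst hlq; simp [hfp, hgq]
    simp [hfo l hlp hlq, hgo l hlp hlq]
  exact ⟨MonoidHom.toMulEquiv f g h1 h2, hfp, hfq, hfo⟩

lemma IsArt.braid (hx : IsFreeCyc N x) {p q r : ι} (hpq : p ≠ q) (hqr : q ≠ r) (hpr : p ≠ r)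
    {φ ψ : MulAut W} (hφ : IsArt x p q φ) (hψ : IsArt x q r ψ) : φ * ψ * φ = ψ * φ * ψ := by
  apply hx.mulAut_ext
  intro l
  have h1 := hφ.other r hpr.symm hqr.symm
  have h2 := hψ.other p hpq hpr
  by_cases hlp : l = p
  · subst hlp; simp [MulAut.mul_apply, hφ.left, hψ.left, h1, h2]
  by_cases hlq : l = q
  · subst hlq
    simp [MulAut.mul_apply, hφ.left, hψ.left, h1, h2, hφ.right, hψ.right]
  by_cases hlr : l = r
  · subst hlr
    simp [MulAut.mul_apply, hψ.left, h1, h2, hφ.right, hψ.right, mul_assoc]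
  simp [MulAut.mul_apply, hφ.other l hlp hlq, hψ.other l hlq hlr]

lemma IsArt.comm (hx : IsFreeCyc N x) {p q r t : ι} (hpr : p ≠ r) (hpt : p ≠ t) (hqr : q ≠ r)
    (hqt : q ≠ t) {φ ψ : MulAut W} (hφ : IsArt x p q φ) (hψ : IsArt x r t ψ) :
    φ * ψ = ψ * φ := by
  apply hx.mulAut_ext
  intro l
  have h1 := hφ.other r hpr.symm hqr.symm
  have h2 := hφ.other t hpt.symm hqt.symm
  have h3 := hψ.other p hpr hpt
  have h4 := hψ.other q hqr hqt
  by_cases hlp : l = p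
  · subst hlp; simp [MulAut.mul_apply, hφ.left, h3, h4]
  by_cases hlq : l = q
  · subst hlq; simp [MulAut.mul_apply, h3, h4, hφ.right]
  by_cases hlr : l = r
  · subst hlr; simp [MulAut.mul_apply, hψ.left, h1, h2]
  by_cases hlt : l = t
  · subst hlt; simp [MulAut.mul_apply, hψ.right, h1, h2]
  simp [MulAut.mul_apply, hφ.other l hlp hlq, hψ.other l hlr hlt]

/-- The square of an Artin generator is a twist: inverse conjugation by `x p * x q` on `x p, x q`. -/
lemma IsArt.sq_left {p q : ι} {φ : MulAut W} (hφ : IsArt x p q φ) :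
    φ (φ (x p)) = (x p * x q)⁻¹ * x p * (x p * x q) := by
  simp [hφ.left, hφ.right, mul_assoc]

lemma IsArt.sq_right {p q : ι} {φ : MulAut W} (hφ : IsArt x p q φ) :
    φ (φ (x q)) = (x p * x q)⁻¹ * x q * (x p * x q) := by
  simp [hφ.left, hφ.right, mul_assoc]

end Art

/-! ### Permutations, exponent sums and inclusions -/

lemma exists_perm (m : ℕ) : ∃ φ : Br m →* Equiv.Perm ℕ, ∀ i < m, φ (s m i) = Equiv.swap i (i + 1) :=
  exists_lift _ (fun i _ => by
    ext k; simp only [Equiv.Perm.mul_apply, Equiv.swap_apply_def]; split_ifs <;> omega)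
    (fun i j h _ => by
    ext k; simp only [Equiv.Perm.mul_apply, Equiv.swap_apply_def]; split_ifs <;> omega)

/-- The permutation of the strands `0, …, m` of a braid. -/
noncomputable def perm (m : ℕ) : Br m →* Equiv.Perm ℕ := (exists_perm m).choose

lemma perm_s {m i : ℕ} (h : i < m) : perm m (s m i) = Equiv.swap i (i + 1) :=
  (exists_perm m).choose_spec i h

lemma exists_expo (m : ℕ) : ∃ φ : Br m →* Multiplicative ℤ, ∀ i < m, φ (s m i) = .ofAdd 1 :=
  exists_lift _ (fun _ _ => rfl) (fun _ _ _ _ => rfl)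

/-- The exponent sum of a braid. -/
noncomputable def expo (m : ℕ) : Br m →* Multiplicative ℤ := (exists_expo m).choose

lemma expo_s {m i : ℕ} (h : i < m) : expo m (s m i) = .ofAdd 1 :=
  (exists_expo m).choose_spec i h

lemma exists_incl (m : ℕ) : ∃ φ : Br m →* Br (m + 1), ∀ i < m, φ (s m i) = s (m + 1) i :=
  exists_lift _ (fun i hi => s_braid (by omega)) (fun i j h _ => s_comm _ h)

/-- Adding a strand. -/
noncomputable def incl (m : ℕ) : Br m →* Br (m + 1) := (exists_incl m).choose

lemma incl_s {m i : ℕ} (h : i < m) : incl m (s m i) = s (m + 1) i :=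
  (exists_incl m).choose_spec i h

lemma perm_apply_of_lt {m : ℕ} (g : Br m) {k : ℕ} (h : m < k) : perm m g k = k :=
  le_of_s_mem (K := (MulAction.stabilizer (Equiv.Perm ℕ) k).comap (perm m)) (fun i hi => by
    simp only [Subgroup.mem_comap, MulAction.mem_stabilizer_iff, perm_s hi, Equiv.Perm.smul_def]
    exact Equiv.swap_apply_of_ne_of_ne (by omega) (by omega)) g

lemma perm_apply_le {m : ℕ} (g : Br m) {k : ℕ} (h : k ≤ m) : perm m g k ≤ m := by
  by_contra! h'
  have := perm_apply_of_lt g h'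
  have := (perm m g).injective this
  omega

lemma perm_incl {m : ℕ} (g : Br m) : perm (m + 1) (incl m g) = perm m g := by
  have : (perm (m + 1)).comp (incl m) = perm m := hom_ext fun i hi => by
    simp [incl_s hi, perm_s hi, perm_s (show i < m + 1 by omega)]
  exact DFunLike.congr_fun this g

lemma expo_incl {m : ℕ} (g : Br m) : expo (m + 1) (incl m g) = expo m g := by
  have : (expo (m + 1)).comp (incl m) = expo m := hom_ext fun i hi => by
    simp [incl_s hi, expo_s hi, expo_s (show i < m + 1 by omega)]
  exact DFunLike.congr_fun this g

/-! ### The Artin action -/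

/-- The free group on which `Br m` acts. -/
abbrev F (m : ℕ) : Type := FreeGroup (Fin (m + 1))

/-- The generators of `F m`, extended by `1` outside their range. -/
def x (m i : ℕ) : F m := if h : i < m + 1 then FreeGroup.of ⟨i, h⟩ else 1

lemma x_eq {m i : ℕ} (h : i < m + 1) : x m i = FreeGroup.of ⟨i, h⟩ := by simp [x, h]

lemma F_hom_ext {m : ℕ} {G : Type*} [Group G] {φ ψ : F m →* G}
    (h : ∀ i ≤ m, φ (x m i) = ψ (x m i)) : φ = ψ :=
  FreeGroup.ext_hom _ _ fun i => by
    have := h i (by omega)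
    rwa [x_eq i.2] at this

lemma exists_act (m : ℕ) : ∃ φ : Br m →* MulAut (F m), ∀ i (hi : i < m),
    IsArt (W := F m) FreeGroup.of ⟨i, by omega⟩ ⟨i + 1, by omega⟩ (φ (s m i)) := by
  have h : ∀ i, ∃ φ : MulAut (F m), ∀ hi : i < m,
      IsArt (W := F m) FreeGroup.of ⟨i, by omega⟩ ⟨i + 1, by omega⟩ φ := by
    intro i
    by_cases hi : i < m
    · obtain ⟨φ, hφ⟩ := (isFreeCyc_freeGroup (Fin (m + 1))).exists_isArt
        (p := ⟨i, by omega⟩) (q := ⟨i + 1, by omega⟩) (by simp)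
      exact ⟨φ, fun _ => hφ⟩
    · exact ⟨1, fun h => absurd h hi⟩
  choose f hf using h
  obtain ⟨φ, hφ⟩ := exists_lift (m := m) f
    (fun i hi => (hf i (by omega)).braid (isFreeCyc_freeGroup _) (by simp) (by simp) (by simp; omega)
      (hf (i + 1) hi))
    (fun i j h hj => (hf i (by omega)).comm (isFreeCyc_freeGroup _) (by simp; omega)
      (by simp; omega) (by simp; omega) (by simp; omega) (hf j hj))
  exact ⟨φ, fun i hi => by rw [hφ i hi]; exact hf i hi⟩

/-- The Artin action of the braid group on the free group. -/
noncomputable def act (m : ℕ) : Br m →* MulAut (F m) := (exists_act m).choose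

lemma act_isArt {m i : ℕ} (hi : i < m) :
    IsArt (W := F m) FreeGroup.of ⟨i, by omega⟩ ⟨i + 1, by omega⟩ (act m (s m i)) :=
  (exists_act m).choose_spec i hi

lemma act_left {m i : ℕ} (hi : i < m) : act m (s m i) (x m i) = x m (i + 1) := by
  rw [x_eq (by omega), x_eq (by omega)]; exact (act_isArt hi).left

lemma act_right {m i : ℕ} (hi : i < m) :
    act m (s m i) (x m (i + 1)) = (x m (i + 1))⁻¹ * x m i * x m (i + 1) := by
  rw [x_eq (by omega), x_eq (by omega)]; exact (act_isArt hi).right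

lemma act_other {m i l : ℕ} (hi : i < m) (h1 : l ≠ i) (h2 : l ≠ i + 1) :
    act m (s m i) (x m l) = x m l := by
  by_cases hl : l < m + 1
  · rw [x_eq (by omega)]
    exact (act_isArt hi).other _ (by simpa using h1) (by simpa using h2)
  · simp [x, hl]

end BraidCoHopf

namespace BraidCoHopf

/-! ### The stabiliser of the last strand -/

/-- An auxiliary form of `T`, indexed from the top. -/
def Taux (m : ℕ) : ℕ → Br (m + 1)
  | 0 => 1
  | d + 1 => (s (m + 1) (m - d))⁻¹ * Taux m d

/-- The braid `σ_k⁻¹ ⋯ σ_m⁻¹` moving the last strand to position `k`. -/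
def T (m k : ℕ) : Br (m + 1) := Taux m (m + 1 - k)

lemma T_top (m : ℕ) : T m (m + 1) = 1 := by simp [T, Taux]

lemma T_succ {m k : ℕ} (h : k ≤ m) : T m k = (s (m + 1) k)⁻¹ * T m (k + 1) := by
  have : m + 1 - k = (m + 1 - (k + 1)) + 1 := by omega
  rw [T, this, Taux, T]
  congr 3
  omega

lemma T_comm {m i k : ℕ} (h : i + 1 < k) (hk : k ≤ m + 1) :
    Commute (s (m + 1) i) (T m k) := by
  induction hk using Nat.decreasingInduction with
  | self => rw [T_top]; exact Commute.one_right _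
  | of_succ k hk ih =>
    rw [T_succ (by omega)]
    exact (s_comm' _ (Or.inl (by omega))).inv_right.mul_right (ih (by omega))

lemma inv_mul_inv_mul_of_braid {G : Type*} [Group G] {a b : G} (h : a * b * a = b * a * b) :
    a⁻¹ * b⁻¹ * a = b * a⁻¹ * b⁻¹ := by
  have : a * b * (a⁻¹ * b⁻¹ * a) * b * a = a * b * (b * a⁻¹ * b⁻¹) * b * a := by
    have h2 : a⁻¹ * b⁻¹ * (a * b * a) = b := by rw [h]; group
    calc a * b * (a⁻¹ * b⁻¹ * a) * b * a = a * b * (a⁻¹ * b⁻¹ * (a * b * a)) := by group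
      _ = a * b * (b * a⁻¹ * b⁻¹) * b * a := by rw [h2]; group
  exact mul_left_cancel (mul_right_cancel (mul_right_cancel this))

lemma T_shift {m i k : ℕ} (hi : i < m) (h : k ≤ i) :
    T m k * s (m + 1) i = s (m + 1) (i + 1) * T m k := by
  induction h using Nat.decreasingInduction with
  | self =>
    rw [T_succ (by omega), T_succ (by omega)]
    have h1 := T_comm (m := m) (i := i) (k := i + 1 + 1) (by omega) (by omega)
    have h2 := inv_mul_inv_mul_of_braid (s_braid (m := m + 1) (i := i) (by omega))
    rw [mul_assoc, mul_assoc, ← h1.eq, ← mul_assoc, ← mul_assoc, h2]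
    group
  | of_succ k hk ih =>
    have h1 : Commute (s (m + 1) k) (s (m + 1) (i + 1)) := s_comm' _ (by omega)
    rw [T_succ (by omega), mul_assoc, ih, ← mul_assoc, ← mul_assoc, h1.inv_left.eq]

lemma perm_T {m k : ℕ} (hk : k ≤ m + 1) : perm (m + 1) (T m k) (m + 1) = k := by
  induction hk using Nat.decreasingInduction with
  | self => simp [T_top]
  | of_succ k hk ih =>
    rw [T_succ (by omega), map_mul, Equiv.Perm.mul_apply, ih, map_inv, perm_s (by omega)]
    simp

/-- The pure braid in which the last strand encircles strand `i`. -/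
def X (m i : ℕ) : Br (m + 1) := (T m (i + 1))⁻¹ * s (m + 1) i ^ 2 * T m (i + 1)

lemma X_last (m : ℕ) : X m m = s (m + 1) m ^ 2 := by simp [X, T_top]

lemma conj_X_left {m i : ℕ} (hi : i < m) :
    s (m + 1) i * X m i * (s (m + 1) i)⁻¹ = X m (i + 1) := by
  have h1 := (T_comm (m := m) (i := i) (k := i + 1 + 1) (by omega) (by omega))
  have h2 := s_braid (m := m + 1) (i := i) (by omega)
  rw [X, X, T_succ (show i + 1 ≤ m by omega)]
  generalize T m (i + 1 + 1) = t at *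
  generalize s (m + 1) i = a at *
  generalize s (m + 1) (i + 1) = b at *
  have h3 : a * b * a ^ 2 * b⁻¹ * a⁻¹ = b ^ 2 := by
    rw [mul_inv_eq_iff_eq_mul, mul_inv_eq_iff_eq_mul]
    calc a * b * a ^ 2 = (b * a * b) * a := by rw [← h2]; simp only [pow_two, mul_assoc]
      _ = b * (a * b * a) := by simp only [mul_assoc]
      _ = b * (b * a * b) := by rw [h2]
      _ = _ := by simp only [pow_two, mul_assoc]
  calc a * ((b⁻¹ * t)⁻¹ * a ^ 2 * (b⁻¹ * t)) * a⁻¹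
      = (a * t⁻¹) * (b * a ^ 2 * b⁻¹) * (t * a⁻¹) := by group
    _ = t⁻¹ * (a * b * a ^ 2 * b⁻¹ * a⁻¹) * t := by
      rw [h1.inv_right.eq, ← h1.inv_left.eq]; group
    _ = _ := by rw [h3]

lemma conj_X_right {m i : ℕ} (hi : i < m) :
    s (m + 1) i * X m (i + 1) * (s (m + 1) i)⁻¹ = (X m (i + 1))⁻¹ * X m i * X m (i + 1) := by
  have h1 := (T_comm (m := m) (i := i) (k := i + 1 + 1) (by omega) (by omega))
  have h2 := s_braid (m := m + 1) (i := i) (by omega)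
  rw [X, X, T_succ (show i + 1 ≤ m by omega)]
  generalize T m (i + 1 + 1) = t at *
  generalize s (m + 1) i = a at *
  generalize s (m + 1) (i + 1) = b at *
  have h3 : b⁻¹ * a ^ 2 * b = a * b ^ 2 * a⁻¹ := by
    rw [eq_mul_inv_iff_mul_eq, mul_assoc, mul_assoc, inv_mul_eq_iff_eq_mul]
    calc a ^ 2 * (b * a) = a * (b * a * b) := by rw [← h2]; simp only [pow_two, mul_assoc]
      _ = (a * b * a) * b := by simp only [mul_assoc]
      _ = (b * a * b) * b := by rw [h2]
      _ = _ := by simp only [pow_two, mul_assoc]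
  calc a * (t⁻¹ * b ^ 2 * t) * a⁻¹
      = (a * t⁻¹) * (b ^ 2) * (t * a⁻¹) := by group
    _ = t⁻¹ * (a * b ^ 2 * a⁻¹) * t := by
      rw [h1.inv_right.eq, ← h1.inv_left.eq]; group
    _ = _ := by rw [← h3]; group

lemma conj_X_other {m i j : ℕ} (hi : i < m) (hj : j ≤ m) (h1 : j ≠ i) (h2 : j ≠ i + 1) :
    s (m + 1) i * X m j * (s (m + 1) i)⁻¹ = X m j := by
  rw [mul_inv_eq_iff_eq_mul, X]
  rcases lt_or_gt_of_ne h1 with h | h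
  · have h3 := T_shift (m := m) hi (k := j + 1) (by omega)
    have h4 : Commute (s (m + 1) j) (s (m + 1) (i + 1)) := s_comm' _ (by omega)
    have h5 : s (m + 1) i * (T m (j + 1))⁻¹ = (T m (j + 1))⁻¹ * s (m + 1) (i + 1) := by
      rw [mul_inv_eq_iff_eq_mul, mul_assoc, ← h3]; group
    rw [mul_assoc _ _ (s (m + 1) i), h3, ← mul_assoc, ← mul_assoc, h5, mul_assoc _ _ (_ ^ 2),
      (h4.pow_left 2).eq.symm]
    group
  · have h3 : Commute (s (m + 1) i) (T m (j + 1)) := T_comm (by omega) (by omega)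
    have h4 : Commute (s (m + 1) i) (s (m + 1) j) := s_comm' _ (by omega)
    exact ((h3.inv_right.mul_right (h4.pow_right 2)).mul_right h3).eq

/-- The free normal subgroup, as a homomorphism. -/
def jF (m : ℕ) : F m →* Br (m + 1) := FreeGroup.lift fun i => X m i

lemma jF_x {m i : ℕ} (h : i ≤ m) : jF m (x m i) = X m i := by
  rw [x_eq (by omega), jF, FreeGroup.lift_apply_of]

lemma jF_act {m : ℕ} (g : Br m) (w : F m) :
    jF m (act m g w) = incl m g * jF m w * (incl m g)⁻¹ := by
  have key : ∀ i < m, (jF m).comp (act m (s m i)).toMonoidHom =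
      (MulAut.conj (incl m (s m i))).toMonoidHom.comp (jF m) := by
    intro i hi
    refine F_hom_ext fun j hj => ?_
    simp only [MonoidHom.comp_apply, MulEquiv.coe_toMonoidHom, MulAut.conj_apply, incl_s hi]
    by_cases h1 : j = i
    · subst h1
      rw [act_left hi, jF_x hi, jF_x hj, conj_X_left hi]
    by_cases h2 : j = i + 1
    · subst h2
      rw [act_right hi, map_mul, map_mul, map_inv, jF_x hj, jF_x (by omega), conj_X_right hi]
    rw [act_other hi h1 h2, jF_x hj, conj_X_other hi hj h1 h2]
  let K : Subgroup (Br m) :=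
    { carrier := {g | ∀ w, jF m (act m g w) = incl m g * jF m w * (incl m g)⁻¹}
      one_mem' := by simp
      mul_mem' := fun {g h} hg hh w => by
        rw [map_mul, MulAut.mul_apply, hg, hh]; simp [mul_assoc]
      inv_mem' := fun {g} hg w => by
        have := hg (act m g⁻¹ w)
        rw [map_inv, MulAut.apply_inv_self] at this
        rw [this, map_inv, map_inv]; group }
  exact le_of_s_mem (K := K) (fun i hi w => DFunLike.congr_fun (key i hi) w) g w

/-- The stabiliser of the last strand as a semidirect product. -/
noncomputable def jj (m : ℕ) : F m ⋊[act m] Br m →* Br (m + 1) :=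
  SemidirectProduct.lift (jF m) (incl m) fun g => by
    ext w
    simp [jF_act]

lemma jj_inl {m : ℕ} (w : F m) : jj m (SemidirectProduct.inl w) = jF m w := by simp [jj]

lemma jj_inr {m : ℕ} (g : Br m) : jj m (SemidirectProduct.inr g) = incl m g := by simp [jj]

lemma jj_mk {m : ℕ} (w : F m) (g : Br m) : jj m ⟨w, g⟩ = jF m w * incl m g := rfl

lemma incl_perm_last {m : ℕ} (g : Br m) : perm (m + 1) (incl m g) (m + 1) = m + 1 := by
  rw [perm_incl, perm_apply_of_lt g (by omega)]

lemma perm_X {m i : ℕ} (h : i ≤ m) : perm (m + 1) (X m i) = 1 := by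
  have h2 : perm (m + 1) (s (m + 1) i ^ 2) = 1 := by
    rw [map_pow, perm_s (by omega), pow_two, Equiv.swap_mul_self]
  rw [X, map_mul, map_mul, h2, mul_one, ← map_mul, inv_mul_cancel, map_one]

lemma perm_jF {m : ℕ} (w : F m) : perm (m + 1) (jF m w) = 1 := by
  have : (perm (m + 1)).comp (jF m) = 1 := F_hom_ext fun i hi => by simp [jF_x hi, perm_X hi]
  exact DFunLike.congr_fun this w

lemma perm_jj {m : ℕ} (w : F m ⋊[act m] Br m) : perm (m + 1) (jj m w) = perm m w.right := by
  obtain ⟨w, g⟩ := w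
  rw [jj_mk, map_mul, perm_jF, one_mul, perm_incl]

open SemidirectProduct in
/-- The values on generators of the coset cocycle. -/
noncomputable def cosetVal (m i k : ℕ) : F m ⋊[act m] Br m :=
  if m + 1 < k then 1 else if i + 1 < k then inr (s m i) else if k = i + 1 then inl (x m i) else
    if k = i then 1 else inr (s m (i - 1))

section cosetVal

open SemidirectProduct

variable {m i k : ℕ}

lemma cosetVal_of_gt (h : m + 1 < k) : cosetVal m i k = 1 := by simp [cosetVal, h]

lemma cosetVal_of_lt (h : i + 1 < k) (h' : k ≤ m + 1) : cosetVal m i k = inr (s m i) := by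
  simp [cosetVal, h, not_lt.mpr h']

lemma cosetVal_succ (h' : i ≤ m) : cosetVal m i (i + 1) = inl (x m i) := by
  simp [cosetVal, h']

lemma cosetVal_self : cosetVal m i i = 1 := by
  simp [cosetVal]

lemma cosetVal_of_gt' (h : k < i) (h' : i ≤ m) : cosetVal m i k = inr (s m (i - 1)) := by
  have h1 : ¬ (m + 1 < k) := by omega
  have h2 : ¬ (i + 1 < k) := by omega
  have h3 : ¬ (k = i + 1) := by omega
  have h4 : ¬ (k = i) := by omega
  simp [cosetVal, h1, h2, h3, h4]

lemma inr_mul_inl_other {m i l : ℕ} (hi : i < m) (h1 : l ≠ i) (h2 : l ≠ i + 1) :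
    (inr (s m i) * inl (x m l) : F m ⋊[act m] Br m) = inl (x m l) * inr (s m i) := by
  ext <;> simp [act_other hi h1 h2]

lemma inr_mul_inl_left {m i : ℕ} (hi : i < m) :
    (inr (s m i) * inl (x m i) : F m ⋊[act m] Br m) = inl (x m (i + 1)) * inr (s m i) := by
  ext <;> simp [act_left hi]

lemma inr_mul_inl_right {m i : ℕ} (hi : i < m) :
    (inr (s m i) * (inl (x m i) * inl (x m (i + 1))) : F m ⋊[act m] Br m) =
      inl (x m i) * inl (x m (i + 1)) * inr (s m i) := by
  ext <;> simp [act_left hi, act_right hi, mul_assoc]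

lemma swap_apply_self' {i : ℕ} : Equiv.swap i (i + 1) i = i + 1 := Equiv.swap_apply_left _ _

lemma swap_apply_succ' {i : ℕ} : Equiv.swap i (i + 1) (i + 1) = i := Equiv.swap_apply_right _ _

lemma swap_apply_other {i k : ℕ} (h : k ≠ i) (h' : k ≠ i + 1) : Equiv.swap i (i + 1) k = k :=
  Equiv.swap_apply_of_ne_of_ne h h'

lemma exists_coset (m : ℕ) : ∃ c : Br (m + 1) → ℕ → F m ⋊[act m] Br m,
    (∀ g h k, c (g * h) k = c g (perm (m + 1) h k) * c h k) ∧
      ∀ i < m + 1, ∀ k, c (s (m + 1) i) k = cosetVal m i k := by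
  apply exists_cocycle (perm (m + 1)) (cosetVal m)
  · intro i hi k
    rw [perm_s (show i < m + 1 by omega), perm_s hi]
    rcases lt_trichotomy k i with h | rfl | h
    · have e1 := swap_apply_other (i := i) (k := k) (by omega) (by omega)
      have e2 := swap_apply_other (i := i + 1) (k := k) (by omega) (by omega)
      simp only [e1, e2]
      rw [cosetVal_of_gt' h (by omega), cosetVal_of_gt' (by omega) (by omega), ← map_mul, ← map_mul,
        ← map_mul, ← map_mul]
      have := s_braid (m := m) (i := i - 1) (by omega)
      rw [show i - 1 + 1 = i by omega] at this
      rw [Nat.add_sub_cancel, this]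
    · have e2 := swap_apply_other (i := k + 1) (k := k) (by omega) (by omega)
      simp only [e2, swap_apply_self']
      rw [cosetVal_self, cosetVal_self, cosetVal_of_gt' (i := k + 1) (k := k) (by omega) (by omega),
        cosetVal_of_lt (i := k) (k := k + 1 + 1) (by omega) (by omega)]
      simp
    rcases Nat.lt_or_ge i.succ k with h1 | h1
    swap
    · obtain rfl : k = i + 1 := by omega
      have e3 := swap_apply_other (i := i) (k := i + 1 + 1) (by omega) (by omega)
      have e4 := swap_apply_other (i := i + 1) (k := i) (by omega) (by omega)
      simp only [swap_apply_self', swap_apply_succ', e3, e4]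
      rw [cosetVal_self, cosetVal_self, cosetVal_of_gt' (i := i + 1) (k := i) (by omega) (by omega),
        cosetVal_of_lt (i := i) (k := i + 1 + 1) (by omega) (by omega), cosetVal_succ (by omega), cosetVal_succ (by omega),
        Nat.add_sub_cancel, mul_one, one_mul, inr_mul_inl_left (by omega)]
    rcases Nat.lt_or_ge (i + 2) k with h2 | h2
    swap
    · obtain rfl : k = i + 1 + 1 := by omega
      have e3 := swap_apply_other (i := i) (k := i + 1 + 1) (by omega) (by omega)
      have e4 := swap_apply_other (i := i + 1) (k := i) (by omega) (by omega)
      simp only [swap_apply_succ', e3]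
      rw [cosetVal_of_lt (i := i) (k := i + 1 + 1) (by omega) (by omega),
        cosetVal_of_gt' (i := i + 1) (k := i) (by omega) (by omega),
        cosetVal_succ (by omega), cosetVal_succ (by omega),
        Nat.add_sub_cancel, mul_assoc (inr _), inr_mul_inl_right (by omega)]
    have e1 := swap_apply_other (i := i) (k := k) (by omega) (by omega)
    have e2 := swap_apply_other (i := i + 1) (k := k) (by omega) (by omega)
    simp only [e1, e2]
    rcases Nat.lt_or_ge (m + 1) k with h3 | h3
    · simp [cosetVal_of_gt h3]
    · rw [cosetVal_of_lt (by omega) h3, cosetVal_of_lt (by omega) h3]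
      simp only [← map_mul, s_braid (m := m) (i := i) (by omega)]
  · intro i j hij hj k
    rw [perm_s (show i < m + 1 by omega), perm_s hj]
    rcases Nat.lt_or_ge (m + 1) k with h3 | h3
    · rw [swap_apply_other (i := i) (k := k) (by omega) (by omega),
        swap_apply_other (i := j) (k := k) (by omega) (by omega)]
      simp [cosetVal_of_gt h3]
    rcases lt_trichotomy k i with h | rfl | h
    · rw [swap_apply_other (i := i) (k := k) (by omega) (by omega),
        swap_apply_other (i := j) (k := k) (by omega) (by omega),
        cosetVal_of_gt' h (by omega), cosetVal_of_gt' (by omega) (by omega), ← map_mul, ← map_mul,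
        s_comm m (by omega)]
    · rw [swap_apply_self', swap_apply_other (i := j) (k := k) (by omega) (by omega),
        cosetVal_self, cosetVal_of_gt' (by omega) (by omega), cosetVal_of_gt' (by omega) (by omega)]
      simp
    rcases Nat.lt_or_ge (i + 1) k with h1 | h1
    swap
    · obtain rfl : k = i + 1 := by omega
      rw [swap_apply_succ', swap_apply_other (i := j) (k := i + 1) (by omega) (by omega),
        cosetVal_succ (by omega), cosetVal_of_gt' (by omega) (by omega),
        cosetVal_of_gt' (by omega) (by omega), inr_mul_inl_other (by omega) (by omega) (by omega)]
    rw [swap_apply_other (i := i) (k := k) (by omega) (by omega)]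
    rw [cosetVal_of_lt (i := i) (k := k) (by omega) h3]
    rcases lt_trichotomy k j with h | rfl | h
    · rw [swap_apply_other (i := j) (k := k) (by omega) (by omega),
        cosetVal_of_lt (i := i) (k := k) (by omega) h3,
        cosetVal_of_gt' (by omega) (by omega), ← map_mul, ← map_mul,
        s_comm m (by omega)]
    · rw [swap_apply_self', cosetVal_self, cosetVal_of_lt (by omega) (by omega)]
      simp
    rcases Nat.lt_or_ge (j + 1) k with h1 | h1
    swap
    · obtain rfl : k = j + 1 := by omega
      rw [swap_apply_succ',
        cosetVal_succ (by omega), cosetVal_of_lt (by omega) (by omega),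
        inr_mul_inl_other (by omega) (by omega) (by omega)]
    rw [swap_apply_other (i := j) (k := k) (by omega) (by omega),
      cosetVal_of_lt (i := i) (k := k) (by omega) h3, cosetVal_of_lt (by omega) h3,
      ← map_mul, ← map_mul, s_comm m (by omega)]

end cosetVal

lemma exists_coset_hom (m : ℕ) : ∃ c : Br (m + 1) → F m ⋊[act m] Br m,
    (∀ w, c (jj m w) = w) ∧ ∀ g, perm (m + 1) g (m + 1) = m + 1 → jj m (c g) = g := by
  obtain ⟨c, hc, hcs⟩ := exists_coset m
  have hone : ∀ k, c 1 k = 1 := fun k => by simpa using hc 1 1 k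
  have hinv : ∀ g k, c g⁻¹ (perm (m + 1) g k) = (c g k)⁻¹ := fun g k => by
    rw [eq_inv_iff_mul_eq_one, ← hc, inv_mul_cancel, hone]
  have hT : ∀ k ≤ m + 1, c (T m k) (m + 1) = 1 := by
    intro k hk
    induction hk using Nat.decreasingInduction with
    | self => simp [T_top, hone]
    | of_succ k hk ih =>
      have h1 := hinv (s (m + 1) k) k
      rw [perm_s (by omega), swap_apply_self'] at h1
      rw [T_succ (by omega), hc, ih, perm_T (by omega), mul_one, h1, hcs k (by omega),
        cosetVal_self, inv_one]
  have hX : ∀ k ≤ m, c (X m k) (m + 1) = SemidirectProduct.inl (x m k) := by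
    intro k hk
    have h1 := hinv (T m (k + 1)) (m + 1)
    rw [perm_T (by omega), hT _ (by omega)] at h1
    rw [X, hc, perm_T (by omega), hT _ (by omega), mul_one, hc, pow_two, map_mul, perm_s (by omega),
      Equiv.swap_mul_self, Equiv.Perm.one_apply, h1, hc, perm_s (by omega), swap_apply_succ',
      hcs k (by omega), hcs k (by omega), cosetVal_self, cosetVal_succ hk, inv_one]
    simp
  have hjj : ∀ w, perm (m + 1) (jj m w) (m + 1) = m + 1 := fun w => by
    rw [perm_jj, perm_apply_of_lt _ (by omega)]
  let θ : F m ⋊[act m] Br m →* F m ⋊[act m] Br m :=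
    { toFun := fun w => c (jj m w) (m + 1)
      map_one' := by rw [map_one, hone]
      map_mul' := fun a b => by rw [map_mul, hc, hjj] }
  have hθ : θ = MonoidHom.id _ := by
    apply SemidirectProduct.hom_ext
    · refine F_hom_ext fun i hi => ?_
      show c (jj m (SemidirectProduct.inl _)) _ = _
      rw [jj_inl, jF_x hi, hX i hi]; rfl
    · refine hom_ext fun i hi => ?_
      show c (jj m (SemidirectProduct.inr _)) _ = _
      rw [jj_inr, incl_s hi, hcs i (by omega), cosetVal_of_lt (by omega) (by omega)]; rfl
  refine ⟨fun g => c g (m + 1), fun w => DFunLike.congr_fun hθ w, ?_⟩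
  let K : Subgroup (Br (m + 1)) :=
    { carrier := {g | ∀ k ≤ m + 1, g * T m k = T m (perm (m + 1) g k) * jj m (c g k)}
      one_mem' := fun k hk => by simp [hone]
      mul_mem' := fun {g h} hg hh k hk => by
        rw [mul_assoc, hh k hk, ← mul_assoc, hg _ (perm_apply_le h hk), hc, map_mul, map_mul,
          mul_assoc, Equiv.Perm.mul_apply]
      inv_mem' := fun {g} hg k hk => by
        have h1 := hg (perm (m + 1) g⁻¹ k) (perm_apply_le _ hk)
        have h2 := hinv g (perm (m + 1) g⁻¹ k)
        have h3 : perm (m + 1) g (perm (m + 1) g⁻¹ k) = k := by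
          rw [← Equiv.Perm.mul_apply, ← map_mul, mul_inv_cancel, map_one]; rfl
        rw [h3] at h1 h2
        rw [h2, (jj m).map_inv, inv_mul_eq_iff_eq_mul, ← mul_assoc, h1, mul_inv_cancel_right] }
  have hK : ∀ g, g ∈ K := le_of_s_mem fun i hi k hk => by
    rw [hcs i hi, perm_s hi]
    rcases lt_trichotomy k i with h | rfl | h
    · rw [swap_apply_other (by omega) (by omega), cosetVal_of_gt' h (by omega), jj_inr,
        incl_s (by omega)]
      have := T_shift (m := m) (i := i - 1) (k := k) (by omega) (by omega)
      rw [show i - 1 + 1 = i by omega] at this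
      exact this.symm
    · rw [cosetVal_self, swap_apply_self', T_succ (by omega)]; simp
    rcases Nat.lt_or_ge (i + 1) k with h1 | h1
    swap
    · obtain rfl : k = i + 1 := by omega
      rw [cosetVal_succ (by omega), swap_apply_succ', jj_inl, jF_x (by omega), X,
        T_succ (show i ≤ m by omega)]
      group
    · rw [swap_apply_other (by omega) (by omega), cosetVal_of_lt h1 hk, jj_inr]
      rw [incl_s (by omega)]
      exact (T_comm h1 hk).eq
  intro g hg
  have := hK g (m + 1) le_rfl
  rw [hg, T_top, mul_one, one_mul] at this
  exact this.symm

lemma jj_injective (m : ℕ) : Function.Injective (jj m) := by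
  obtain ⟨c, h, -⟩ := exists_coset_hom m
  exact Function.LeftInverse.injective h

/-- The stabiliser of the last strand is the semidirect product. -/
lemma exists_jj_eq {m : ℕ} {g : Br (m + 1)} (h : perm (m + 1) g (m + 1) = m + 1) :
    ∃ w, jj m w = g := by
  obtain ⟨c, -, h'⟩ := exists_coset_hom m
  exact ⟨c g, h' g h⟩

lemma jF_injective (m : ℕ) : Function.Injective (jF m) := fun a b h =>
  SemidirectProduct.inl_injective (jj_injective m (by rwa [jj_inl, jj_inl]))

lemma exists_jF_mul_incl {m : ℕ} {g : Br (m + 1)} (h : perm (m + 1) g (m + 1) = m + 1) :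
    ∃ w b, g = jF m w * incl m b := by
  obtain ⟨⟨w, b⟩, rfl⟩ := exists_jj_eq h
  exact ⟨w, b, rfl⟩

lemma jF_mul_incl_inj {m : ℕ} {w w' : F m} {b b' : Br m}
    (h : jF m w * incl m b = jF m w' * incl m b') : w = w' ∧ b = b' := by
  rw [← jj_mk, ← jj_mk] at h
  have := jj_injective m h
  exact SemidirectProduct.ext_iff.mp this

end BraidCoHopf

namespace BraidCoHopf

/-! ### The Coxeter element -/

/-- The product `σ_0 ⋯ σ_{k-1}`. -/
def dl (m : ℕ) : ℕ → Br m
  | 0 => 1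
  | k + 1 => dl m k * s m k

/-- The Coxeter element `σ_0 ⋯ σ_{m-1}`. -/
def δ (m : ℕ) : Br m := dl m m

lemma dl_comm {m i k : ℕ} (h : k < i) : Commute (dl m k) (s m i) := by
  induction k with
  | zero => exact Commute.one_left _
  | succ k ih => exact (ih (by omega)).mul_left (s_comm' m (by omega))

lemma dl_shift {m i k : ℕ} (h : i + 1 < k) (hk : k ≤ m) :
    dl m k * s m i = s m (i + 1) * dl m k := by
  induction k with
  | zero => omega
  | succ k ih =>
    rcases Nat.lt_or_ge (i + 1) k with h1 | h1
    · have h2 : Commute (s m k) (s m i) := s_comm' m (by omega)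
      rw [dl, mul_assoc, h2.eq, ← mul_assoc, ih h1 (by omega), mul_assoc]
    · obtain rfl : k = i + 1 := by omega
      have h2 := dl_comm (m := m) (i := i + 1) (k := i) (by omega)
      have h3 := s_braid (m := m) (i := i) (by omega)
      rw [dl, dl]
      calc dl m i * s m i * s m (i + 1) * s m i
          = dl m i * (s m i * s m (i + 1) * s m i) := by simp only [mul_assoc]
        _ = (dl m i * s m (i + 1)) * s m i * s m (i + 1) := by rw [h3]; simp only [mul_assoc]
        _ = _ := by rw [h2.eq]; simp only [mul_assoc]

lemma δ_s {m i : ℕ} (h : i + 1 < m) : δ m * s m i = s m (i + 1) * δ m := dl_shift h le_rfl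

lemma δ_pow_s {m k : ℕ} (h : k < m) : δ m ^ k * s m 0 = s m k * δ m ^ k := by
  induction k with
  | zero => simp
  | succ k ih => rw [pow_succ', mul_assoc, ih (by omega), ← mul_assoc, δ_s h, mul_assoc]

lemma s_eq_conj {m k : ℕ} (h : k < m) : s m k = δ m ^ k * s m 0 * (δ m ^ k)⁻¹ := by
  rw [δ_pow_s h, mul_inv_cancel_right]

lemma s_zero_δ_dl {m k : ℕ} (h : k < m) : s m 0 * δ m * dl m k = dl m (k + 1) * δ m := by
  induction k with
  | zero => simp [dl]
  | succ k ih =>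
    rw [dl, ← mul_assoc, ih (by omega), mul_assoc, δ_s h, ← mul_assoc]; rfl

lemma δ_sq_s {m : ℕ} : δ (m + 1) ^ 2 * s (m + 1) m = s (m + 1) 0 * δ (m + 1) ^ 2 := by
  have h := s_zero_δ_dl (m := m + 1) (k := m) (by omega)
  have h1 : δ (m + 1) = dl (m + 1) m * s (m + 1) m := rfl
  calc δ (m + 1) ^ 2 * s (m + 1) m = dl (m + 1) (m + 1) * δ (m + 1) * s (m + 1) m := by
        rw [pow_two]; rfl
    _ = s (m + 1) 0 * δ (m + 1) * (dl (m + 1) m * s (m + 1) m) := by rw [← h, mul_assoc]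
    _ = _ := by rw [← h1, pow_two, mul_assoc]

lemma s_zero_mul_δ_pow {m k : ℕ} (h : k ≤ m) : (s m 0 * δ m) ^ k = dl m k * δ m ^ k := by
  induction k with
  | zero => simp [dl]
  | succ k ih =>
    rw [pow_succ, ih (by omega), mul_assoc, ← mul_assoc (_ ^ k), δ_pow_s h, dl, pow_succ]
    simp only [mul_assoc]

lemma s_zero_mul_δ_pow_self (m : ℕ) : (s m 0 * δ m) ^ m = δ m ^ (m + 1) := by
  rw [s_zero_mul_δ_pow le_rfl, pow_succ']; rfl

/-- A subgroup containing `δ` and `σ_0` is everything. -/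
lemma mem_of_δ_mem {m : ℕ} {K : Subgroup (Br m)} (h1 : δ m ∈ K) (h2 : s m 0 ∈ K) (g : Br m) :
    g ∈ K :=
  le_of_s_mem (fun i hi => by
    rw [s_eq_conj hi]
    exact K.mul_mem (K.mul_mem (K.pow_mem h1 _) h2) (K.inv_mem (K.pow_mem h1 _))) g

lemma δ_pow_mem_center (m : ℕ) : δ m ^ (m + 1) ∈ Subgroup.center (Br m) := by
  rw [Subgroup.mem_center_iff]
  have key : δ m ^ (m + 1) ∈ Subgroup.centralizer {s m 0, δ m} := by
    rw [Subgroup.mem_centralizer_iff]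
    rintro g (rfl | rfl)
    · cases m with
      | zero => simp [s_of_le]
      | succ m =>
        have h := δ_pow_s (m := m + 1) (k := m) (by omega)
        rw [show m + 1 + 1 = 2 + m by omega, pow_add, mul_assoc (_ ^ 2), h, ← mul_assoc, ← mul_assoc,
          δ_sq_s]
    · rw [← pow_succ, ← pow_succ']
  intro g
  suffices h : g ∈ Subgroup.centralizer {δ m ^ (m + 1)} from
    (Subgroup.mem_centralizer_iff.mp h _ rfl).symm
  refine mem_of_δ_mem ?_ ?_ g
  · rw [Subgroup.mem_centralizer_iff] at *
    rintro _ rfl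
    exact (key _ (by simp)).symm
  · rw [Subgroup.mem_centralizer_iff] at *
    rintro _ rfl
    exact (key _ (by simp)).symm

lemma expo_dl {m k : ℕ} (h : k ≤ m) : expo m (dl m k) = .ofAdd (k : ℤ) := by
  induction k with
  | zero => simp [dl]
  | succ k ih => rw [dl, map_mul, ih (by omega), expo_s (by omega), ← ofAdd_add]; simp

lemma expo_δ (m : ℕ) : expo m (δ m) = .ofAdd (m : ℤ) := expo_dl le_rfl

/-! ### The full twist and the center -/

/-- The product `x_0 ⋯ x_{k-1}`. -/
def xprod (m : ℕ) : ℕ → F m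
  | 0 => 1
  | k + 1 => xprod m k * x m k

lemma act_xprod_of_le {m i k : ℕ} (hi : i < m) (h : k ≤ i) :
    act m (s m i) (xprod m k) = xprod m k := by
  induction k with
  | zero => simp [xprod]
  | succ k ih => rw [xprod, map_mul, ih (by omega), act_other hi (by omega) (by omega)]

lemma act_xprod_of_lt {m i k : ℕ} (hi : i < m) (h : i + 1 < k) :
    act m (s m i) (xprod m k) = xprod m k := by
  induction k with
  | zero => omega
  | succ k ih =>
    rcases Nat.lt_or_ge (i + 1) k with h1 | h1
    · rw [xprod, map_mul, ih h1, act_other hi (by omega) (by omega)]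
    · obtain rfl : k = i + 1 := by omega
      rw [xprod, xprod, map_mul, map_mul, act_xprod_of_le hi le_rfl, act_left hi, act_right hi]
      group

/-- The braid in which the last strand encircles all others. -/
def D (m : ℕ) : Br (m + 1) := jF m (xprod m (m + 1))

lemma D_comm {m : ℕ} (g : Br m) : Commute (incl m g) (D m) := by
  suffices h : g ∈ (Subgroup.centralizer {D m}).comap (incl m) from
    (Subgroup.mem_centralizer_iff.mp h _ rfl).symm
  refine le_of_s_mem (fun i hi => ?_) g
  rw [Subgroup.mem_comap, Subgroup.mem_centralizer_iff]
  rintro _ rfl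
  have h := jF_act (s m i) (xprod m (m + 1))
  rw [act_xprod_of_lt hi (by omega)] at h
  conv_lhs => rw [D, h]
  rw [D]; group

lemma T_eq_incl {m k : ℕ} (h : k ≤ m + 1) :
    T (m + 1) k = incl (m + 1) (T m k) * (s (m + 2) (m + 1))⁻¹ := by
  induction h using Nat.decreasingInduction with
  | self => rw [T_succ le_rfl, T_top, T_top]; simp
  | of_succ k hk ih =>
    rw [T_succ (m := m + 1) (by omega), T_succ (m := m) (by omega), ih, map_mul, map_inv,
      incl_s (by omega), mul_assoc]

lemma X_eq_incl {m k : ℕ} (h : k ≤ m) :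
    X (m + 1) k = s (m + 2) (m + 1) * incl (m + 1) (X m k) * (s (m + 2) (m + 1))⁻¹ := by
  rw [X, X, T_eq_incl (by omega), map_mul, map_mul, map_inv, map_pow, incl_s (by omega)]
  group

lemma D_succ (m : ℕ) :
    D (m + 1) = s (m + 2) (m + 1) * incl (m + 1) (D m) * s (m + 2) (m + 1) := by
  have key : ∀ k ≤ m + 1, jF (m + 1) (xprod (m + 1) k) =
      s (m + 2) (m + 1) * incl (m + 1) (jF m (xprod m k)) * (s (m + 2) (m + 1))⁻¹ := by
    intro k hk
    induction k with
    | zero => simp [xprod]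
    | succ k ih =>
      rw [xprod, xprod, map_mul, map_mul, ih (by omega), jF_x (by omega), jF_x (by omega),
        X_eq_incl (by omega), map_mul]
      group
  rw [D, xprod, map_mul, key _ le_rfl, jF_x le_rfl, X_last, D]
  group

/-- The full twist. -/
noncomputable def zz : (m : ℕ) → Br m
  | 0 => 1
  | m + 1 => incl m (zz m) * D m

lemma zz_succ (m : ℕ) : zz (m + 1) = incl m (zz m) * D m := rfl

lemma zz_comm {m : ℕ} (g : Br m) : g * zz m = zz m * g := by
  induction m with
  | zero => simp [zz]
  | succ m ih =>
    suffices h : g ∈ Subgroup.centralizer {zz (m + 1)} from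
      (Subgroup.mem_centralizer_iff.mp h _ rfl).symm
    refine le_of_s_mem (fun i hi => ?_) g
    rw [Subgroup.mem_centralizer_iff]
    rintro _ rfl
    refine Commute.eq (Commute.symm ?_)
    rcases Nat.lt_or_ge i m with h | h
    · rw [← incl_s h, zz_succ]
      refine Commute.mul_right ?_ (D_comm _)
      rw [Commute, SemiconjBy, ← map_mul, ih, map_mul]
    · obtain rfl : i = m := by omega
      cases i with
      | zero => simp [zz, D, xprod, jF_x, X_last]
      | succ i =>
        rw [zz_succ, zz_succ, map_mul, mul_assoc]
        refine Commute.mul_right ?_ ?_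
        · have : Commute (s (i + 2) (i + 1)) (incl (i + 1) (incl i (zz i))) := by
            suffices h : zz i ∈ (Subgroup.centralizer {s (i + 2) (i + 1)}).comap
                ((incl (i + 1)).comp (incl i)) from Subgroup.mem_centralizer_iff.mp h _ rfl
            refine le_of_s_mem (fun j hj => ?_) _
            rw [Subgroup.mem_comap, Subgroup.mem_centralizer_iff, MonoidHom.comp_apply, incl_s hj,
              incl_s (by omega)]
            rintro _ rfl
            exact s_comm' _ (by omega)
          exact this
        · have h1 := (D_comm (D i)).eq
          rw [D_succ] at h1 ⊢
          have h2 := congrArg (· * s (i + 2) (i + 1)) h1.symm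
          simpa only [Commute, SemiconjBy, mul_assoc] using h2

lemma zz_mem_center (m : ℕ) : zz m ∈ Subgroup.center (Br m) :=
  Subgroup.mem_center_iff.mpr zz_comm

lemma perm_zz (m : ℕ) : perm m (zz m) = 1 := by
  induction m with
  | zero => simp [zz]
  | succ m ih => rw [zz_succ, map_mul, perm_incl, ih, D, perm_jF, one_mul]

lemma expo_X {m i : ℕ} (h : i ≤ m) : expo (m + 1) (X m i) = .ofAdd 2 := by
  rw [X, map_mul, map_mul, map_pow, expo_s (by omega), map_inv, mul_comm, mul_inv_cancel_left]; rfl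

lemma expo_D (m : ℕ) : expo (m + 1) (D m) = .ofAdd (2 * (m + 1) : ℤ) := by
  have key : ∀ k ≤ m + 1, expo (m + 1) (jF m (xprod m k)) = .ofAdd (2 * k : ℤ) := by
    intro k hk
    induction k with
    | zero => simp [xprod]
    | succ k ih =>
      rw [xprod, map_mul, map_mul, ih (by omega), jF_x (by omega), expo_X (by omega), ← ofAdd_add]
      congr 1
  rw [D, key _ le_rfl]; norm_num

lemma expo_zz (m : ℕ) : expo m (zz m) = .ofAdd (m * (m + 1) : ℤ) := by
  induction m with
  | zero => simp [zz]
  | succ m ih =>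
    rw [zz_succ, map_mul, expo_incl, ih, expo_D, ← ofAdd_add]
    congr 1; push_cast; ring

lemma mem_zpowers_zz {m : ℕ} {g : Br m} (h1 : perm m g = 1) (h2 : g ∈ Subgroup.center (Br m)) :
    g ∈ Subgroup.zpowers (zz m) := by
  induction m with
  | zero =>
    have : g ∈ (⊥ : Subgroup (Br 0)) := le_of_s_mem (fun i hi => by omega) g
    rw [Subgroup.mem_bot.mp this]; exact one_mem _
  | succ m ih =>
    obtain ⟨w, b, rfl⟩ := exists_jF_mul_incl (g := g) (by rw [h1]; rfl)
    rw [Subgroup.mem_center_iff] at h2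
    obtain ⟨k, hk⟩ := ih (g := b) (by simpa [perm_jF, perm_incl] using h1) (by
      rw [Subgroup.mem_center_iff]
      intro h
      have := h2 (incl m h)
      have e : incl m h * jF m w = jF m (act m h w) * incl m h := by
        rw [jF_act]; group
      rw [← mul_assoc, e, mul_assoc, mul_assoc, ← map_mul, ← map_mul] at this
      exact (jF_mul_incl_inj this).2)
    simp only at hk
    subst hk
    set y := w * (xprod m (m + 1))⁻¹ ^ k with hy
    have hyg : jF m y = jF m w * incl m (zz m ^ k) * (zz (m + 1))⁻¹ ^ k := by
      have : Commute (incl m (zz m)) (D m) := D_comm _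
      rw [hy, map_mul, map_zpow, map_inv, map_zpow, zz_succ, inv_zpow, inv_zpow, this.eq,
        this.symm.mul_zpow, mul_inv_rev, D]
      group
    clear_value y
    have hyc : ∀ u, u * y = y * u := by
      intro u
      apply jF_injective m
      have hz : ∀ g, g * (zz (m + 1))⁻¹ ^ k = (zz (m + 1))⁻¹ ^ k * g := fun g => by
        have : Commute g (zz (m + 1)) := zz_comm g
        exact (this.inv_right.zpow_right k).eq
      rw [(jF m).map_mul, (jF m).map_mul, hyg, ← mul_assoc, h2, mul_assoc, hz, ← mul_assoc]
    suffices h : jF m y ∈ Subgroup.zpowers (zz (m + 1)) by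
      rw [hyg] at h
      exact (Subgroup.mul_mem_cancel_right _
        (Subgroup.zpow_mem _ (Subgroup.inv_mem _ (Subgroup.mem_zpowers _)) _)).mp h
    have hx := isFreeCyc_freeGroup (Fin (m + 1))
    have h0 := hx.mem_zpowers_of_commute' (by simp) (i := 0) (hyc _).symm.symm
    rcases Nat.eq_zero_or_pos m with rfl | hm
    · obtain ⟨l, hl⟩ := h0
      refine ⟨l, ?_⟩
      simp only at hl ⊢
      rw [← hl, map_zpow]
      congr 1
      simp [zz, D, xprod, x_eq]
    · have h1 := hx.mem_zpowers_of_commute' (by simp) (i := ⟨1, by omega⟩) (hyc _)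
      have : y = 1 := hx.eq_one_of_mem_zpowers (by simp [Fin.ext_iff]) h0 h1
      rw [this, map_one]; exact one_mem _

/-- A permutation of the strands commuting with all adjacent transpositions is trivial. -/
lemma eq_one_of_commute_swap {m : ℕ} (hm : 2 ≤ m) {τ : Equiv.Perm ℕ} (h0 : ∀ k, m < k → τ k = k)
    (h : ∀ i < m, τ * Equiv.swap i (i + 1) = Equiv.swap i (i + 1) * τ) : τ = 1 := by
  have key : ∀ i < m, (τ i = i ∨ τ i = i + 1) ∧ (τ (i + 1) = i ∨ τ (i + 1) = i + 1) := by
    intro i hi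
    have h1 := DFunLike.congr_fun (h i hi) i
    have h2 := DFunLike.congr_fun (h i hi) (i + 1)
    simp only [Equiv.Perm.mul_apply, swap_apply_self', swap_apply_succ'] at h1 h2
    have h3 : τ i ≠ τ (i + 1) := fun e => by simpa using τ.injective e
    rw [Equiv.swap_apply_def] at h1 h2
    split_ifs at h1 h2 <;> omega
  ext k
  rw [Equiv.Perm.one_apply]
  rcases Nat.lt_or_ge m k with h1 | h1
  · exact h0 k h1
  rcases Nat.eq_zero_or_pos k with rfl | h2
  · have h3 := key 0 (by omega)
    have h4 := key 1 (by omega)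
    have h5 : τ 0 ≠ τ 1 := fun e => by simpa using τ.injective e
    simp only [zero_add] at h3
    omega
  · have h3 := key (k - 1) (by omega)
    rw [show k - 1 + 1 = k by omega] at h3
    rcases Nat.lt_or_ge k m with h4 | h4
    · have := key k h4; omega
    · obtain rfl : k = m := by omega
      have h4 := key (k - 2) (by omega)
      rw [show k - 2 + 1 = k - 1 by omega] at h4
      have h5 : τ k ≠ τ (k - 1) := fun e => by have := τ.injective e; omega
      omega

lemma perm_eq_one_of_mem_center {m : ℕ} (hm : 2 ≤ m) {g : Br m} (h : g ∈ Subgroup.center (Br m)) :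
    perm m g = 1 := by
  refine eq_one_of_commute_swap hm (fun k hk => perm_apply_of_lt g hk) fun i hi => ?_
  rw [← perm_s hi, ← map_mul, ← map_mul, Subgroup.mem_center_iff.mp h]

lemma center_eq {m : ℕ} (hm : 2 ≤ m) : Subgroup.center (Br m) = Subgroup.zpowers (zz m) :=
  le_antisymm (fun _ h => mem_zpowers_zz (perm_eq_one_of_mem_center hm h) h)
    (Subgroup.zpowers_le.mpr (zz_mem_center m))

lemma δ_pow_eq_zz {m : ℕ} (hm : 2 ≤ m) : δ m ^ (m + 1) = zz m := by
  have h := δ_pow_mem_center m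
  rw [center_eq hm] at h
  obtain ⟨k, hk⟩ := h
  simp only at hk
  have h1 := congrArg (expo m) hk
  rw [map_zpow, map_pow, expo_zz, expo_δ] at h1
  have h2 : k * ((m + 1) * m : ℤ) = (m + 1) * m := by
    simpa [mul_comm (m : ℤ)] using congrArg Multiplicative.toAdd h1
  have h3 : k = 1 := by
    have : ((m + 1) * m : ℤ) ≠ 0 := by positivity
    apply mul_right_cancel₀ this
    rw [h2, one_mul]
  rw [← hk, h3, zpow_one]

end BraidCoHopf

namespace BraidCoHopf

/-! ### Linking numbers -/

/-- Whether `{a, b} = {i, j}`, as an integer. -/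
def adj (i j a b : ℕ) : ℤ := if (a = i ∧ b = j) ∨ (a = j ∧ b = i) then 1 else 0

lemma adj_braid {i j k : ℕ} (ij : i ≠ j) (jk : j ≠ k) (ik : i ≠ k) (a b : ℕ) :
    adj i j (Equiv.swap j k (Equiv.swap i j a)) (Equiv.swap j k (Equiv.swap i j b)) +
      adj j k (Equiv.swap i j a) (Equiv.swap i j b) + adj i j a b =
    adj j k (Equiv.swap i j (Equiv.swap j k a)) (Equiv.swap i j (Equiv.swap j k b)) +
      adj i j (Equiv.swap j k a) (Equiv.swap j k b) + adj j k a b := by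
  have ha : a = i ∨ a = j ∨ a = k ∨ (a ≠ i ∧ a ≠ j ∧ a ≠ k) := by omega
  have hb : b = i ∨ b = j ∨ b = k ∨ (b ≠ i ∧ b ≠ j ∧ b ≠ k) := by omega
  rcases ha with ha | ha | ha | ⟨a1, a2, a3⟩ <;>
    rcases hb with hb | hb | hb | ⟨b1, b2, b3⟩ <;>
    simp [Equiv.swap_apply_def, adj, ij.symm, jk.symm, ik.symm, *]

lemma adj_swap {i j k l : ℕ} (ik : i ≠ k) (il : i ≠ l) (jk : j ≠ k) (jl : j ≠ l) (a b : ℕ) :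
    adj i j (Equiv.swap k l a) (Equiv.swap k l b) = adj i j a b := by
  have key : ∀ a, (Equiv.swap k l a = i ↔ a = i) ∧ (Equiv.swap k l a = j ↔ a = j) := by
    intro a
    rw [Equiv.swap_apply_def]
    split_ifs <;> omega
  simp only [adj, key]

lemma adj_comm (i j a b : ℕ) : adj i j a b = adj i j b a := by
  simp only [adj, and_comm, or_comm]

lemma exists_lk (m : ℕ) : ∃ c : Br m → ℕ → ℕ → ℤ,
    (∀ g h a b, c (g * h) a b = c g (perm m h a) (perm m h b) + c h a b) ∧
      ∀ i < m, ∀ a b, c (s m i) a b = adj i (i + 1) a b := by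
  let p : Br m →* Equiv.Perm (ℕ × ℕ) :=
    { toFun := fun g => (perm m g).prodCongr (perm m g)
      map_one' := by ext <;> simp
      map_mul' := fun g h => by ext <;> simp }
  have hp : ∀ g k, p g k = (perm m g k.1, perm m g k.2) := fun g k => rfl
  obtain ⟨c, h1, h2⟩ := exists_cocycle (m := m) (G := Multiplicative ℤ) p
    (fun i k => .ofAdd (adj i (i + 1) k.1 k.2)) (by
      rintro i hi ⟨a, b⟩
      simp only [hp, perm_s (show i < m by omega), perm_s hi, ← ofAdd_add]
      congr 1
      exact adj_braid (by omega) (by omega) (by omega) a b) (by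
      rintro i j hij hj ⟨a, b⟩
      simp only [hp, perm_s (show i < m by omega), perm_s hj, ← ofAdd_add]
      congr 1
      rw [adj_swap (by omega) (by omega) (by omega) (by omega),
        adj_swap (by omega) (by omega) (by omega) (by omega), add_comm])
  exact ⟨fun g a b => (c g (a, b)).toAdd, fun g h a b => by
    show (c (g * h) (a, b)).toAdd = _
    rw [h1]; rfl, fun i hi a b => by
    show (c (s m i) (a, b)).toAdd = _
    rw [h2 i hi]; rfl⟩

/-- The signed number of crossings between the strands starting at `a` and `b`. -/
noncomputable def lk (m : ℕ) : Br m → ℕ → ℕ → ℤ := (exists_lk m).choose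

section lk

variable {m : ℕ}

lemma lk_mul (g h : Br m) (a b : ℕ) :
    lk m (g * h) a b = lk m g (perm m h a) (perm m h b) + lk m h a b :=
  (exists_lk m).choose_spec.1 g h a b

lemma lk_s {i : ℕ} (hi : i < m) (a b : ℕ) : lk m (s m i) a b = adj i (i + 1) a b :=
  (exists_lk m).choose_spec.2 i hi a b

lemma lk_one (a b : ℕ) : lk m 1 a b = 0 := by simpa using lk_mul (m := m) 1 1 a b

lemma perm_inv_apply_self (g : Br m) (a : ℕ) : perm m g (perm m g⁻¹ a) = a := by
  rw [← Equiv.Perm.mul_apply, ← map_mul, mul_inv_cancel, map_one]; rfl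

lemma lk_inv (g : Br m) (a b : ℕ) :
    lk m g⁻¹ a b = - lk m g (perm m g⁻¹ a) (perm m g⁻¹ b) := by
  have := lk_mul g g⁻¹ a b
  rw [mul_inv_cancel, lk_one] at this
  omega

lemma lk_mul_pure (g : Br m) {h : Br m} (hh : perm m h = 1) (a b : ℕ) :
    lk m (g * h) a b = lk m g a b + lk m h a b := by
  rw [lk_mul, hh]; rfl

lemma lk_inv_pure {g : Br m} (hg : perm m g = 1) (a b : ℕ) : lk m g⁻¹ a b = - lk m g a b := by
  rw [lk_inv, map_inv, hg]; simp

lemma lk_conj (g : Br m) {h : Br m} (hh : perm m h = 1) (a b : ℕ) :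
    lk m (g * h * g⁻¹) a b = lk m h (perm m g⁻¹ a) (perm m g⁻¹ b) := by
  rw [lk_mul, lk_mul_pure _ hh, lk_inv]; ring

lemma lk_pow_pure {g : Br m} (hg : perm m g = 1) (k : ℕ) (a b : ℕ) :
    lk m (g ^ k) a b = k * lk m g a b := by
  induction k with
  | zero => simp [lk_one]
  | succ k ih => rw [pow_succ, lk_mul_pure _ hg, ih]; push_cast; ring

lemma lk_zpow_pure {g : Br m} (hg : perm m g = 1) (k : ℤ) (a b : ℕ) :
    lk m (g ^ k) a b = k * lk m g a b := by
  cases k with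
  | ofNat k => simpa using lk_pow_pure hg k a b
  | negSucc k =>
    rw [zpow_negSucc, lk_inv_pure (by rw [map_pow, hg, one_pow]), lk_pow_pure hg,
      Int.negSucc_eq]; push_cast; ring

lemma lk_comm (g : Br m) (a b : ℕ) : lk m g a b = lk m g b a := by
  let K : Subgroup (Br m) :=
    { carrier := {g | ∀ a b, lk m g a b = lk m g b a}
      one_mem' := fun a b => by rw [lk_one, lk_one]
      mul_mem' := fun {g h} hg hh a b => by rw [lk_mul, lk_mul, hg, hh]
      inv_mem' := fun {g} hg a b => by rw [lk_inv, lk_inv, hg] }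
  exact le_of_s_mem (K := K) (fun i hi a b => by rw [lk_s hi, lk_s hi, adj_comm]) g a b

lemma lk_self (g : Br m) (a : ℕ) : lk m g a a = 0 := by
  let K : Subgroup (Br m) :=
    { carrier := {g | ∀ a, lk m g a a = 0}
      one_mem' := fun a => lk_one a a
      mul_mem' := fun {g h} hg hh a => by rw [lk_mul, hg, hh, add_zero]
      inv_mem' := fun {g} hg a => by rw [lk_inv, hg, neg_zero] }
  exact le_of_s_mem (K := K) (fun i hi a => by rw [lk_s hi, adj, if_neg (by omega)]) g a

/-- The parity of the linking number tells whether two strands cross over. -/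
lemma even_lk_iff (g : Br m) {a b : ℕ} (hab : a ≠ b) :
    Even (lk m g a b) ↔ (a < b ↔ perm m g a < perm m g b) := by
  let K : Subgroup (Br m) :=
    { carrier := {g | ∀ a b, a ≠ b → (Even (lk m g a b) ↔ (a < b ↔ perm m g a < perm m g b))}
      one_mem' := fun a b _ => by simp [lk_one]
      mul_mem' := fun {g h} hg hh a b hab => by
        rw [lk_mul, Int.even_add, hg _ _ (fun e => hab ((perm m h).injective e)), hh a b hab,
          map_mul, Equiv.Perm.mul_apply, Equiv.Perm.mul_apply]
        tauto
      inv_mem' := fun {g} hg a b hab => by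
        rw [lk_inv, even_neg, hg _ _ (fun e => hab ((perm m g⁻¹).injective e)),
          perm_inv_apply_self, perm_inv_apply_self]
        tauto }
  refine le_of_s_mem (K := K) (fun i hi a b hab => ?_) g a b hab
  rw [lk_s hi, perm_s hi, adj, Equiv.swap_apply_def, Equiv.swap_apply_def]
  split_ifs <;> simp <;> omega

lemma lk_incl (g : Br m) (a b : ℕ) : lk (m + 1) (incl m g) a b = lk m g a b := by
  let K : Subgroup (Br m) :=
    { carrier := {g | ∀ a b, lk (m + 1) (incl m g) a b = lk m g a b}
      one_mem' := fun a b => by rw [map_one, lk_one, lk_one]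
      mul_mem' := fun {g h} hg hh a b => by rw [map_mul, lk_mul, lk_mul, hg, hh, perm_incl]
      inv_mem' := fun {g} hg a b => by rw [map_inv, lk_inv, lk_inv, hg, ← map_inv, perm_incl] }
  exact le_of_s_mem (K := K) (fun i hi a b => by rw [incl_s hi, lk_s hi, lk_s (by omega)]) g a b

lemma perm_s_sq (i : ℕ) : perm m (s m i ^ 2) = 1 := by
  by_cases h : i < m
  · rw [map_pow, perm_s h, pow_two, Equiv.swap_mul_self]
  · simp [s_of_le (not_lt.mp h)]

lemma lk_s_sq {i : ℕ} (hi : i < m) (a b : ℕ) : lk m (s m i ^ 2) a b = 2 * adj i (i + 1) a b := by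
  rw [pow_two, lk_mul, lk_s hi, lk_s hi, perm_s hi]
  have : adj i (i + 1) (Equiv.swap i (i + 1) a) (Equiv.swap i (i + 1) b) = adj i (i + 1) a b := by
    simp only [adj, Equiv.swap_apply_def]
    split_ifs <;> first | rfl | omega
  rw [this]; ring

lemma lk_X {j : ℕ} (hj : j ≤ m) (a b : ℕ) :
    lk (m + 1) (X m j) a b = 2 * adj j (m + 1) a b := by
  have h := lk_conj (T m (j + 1))⁻¹ (perm_s_sq (m := m + 1) j) a b
  have hT : perm (m + 1) (T m (j + 1)) (m + 1) = j + 1 := perm_T (by omega)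
  have hT' : perm (m + 1) (T m (j + 1)) j = j := by
    have : ∀ k ≤ m + 1, j < k → perm (m + 1) (T m k) j = j := by
      intro k hk
      induction hk using Nat.decreasingInduction with
      | self => intro _; simp [T_top]
      | of_succ k hk ih =>
        intro h
        rw [T_succ (by omega), map_mul, Equiv.Perm.mul_apply, ih (by omega), map_inv,
          perm_s (by omega), Equiv.swap_inv, swap_apply_other (by omega) (by omega)]
    exact this (j + 1) (by omega) (by omega)
  have h2 : ∀ a, (perm (m + 1) (T m (j + 1)) a = j ↔ a = j) ∧
      (perm (m + 1) (T m (j + 1)) a = j + 1 ↔ a = m + 1) := fun a =>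
    ⟨⟨fun e => (perm (m + 1) (T m (j + 1))).injective (by rw [e, hT']), fun e => by rw [e, hT']⟩,
      ⟨fun e => (perm (m + 1) (T m (j + 1))).injective (by rw [e, hT]), fun e => by rw [e, hT]⟩⟩
  rw [inv_inv, lk_s_sq (by omega)] at h
  rw [X, h]
  simp only [adj, h2]

lemma lk_jF_of_le (w : F m) {a b : ℕ} (ha : a ≤ m) (hb : b ≤ m) : lk (m + 1) (jF m w) a b = 0 := by
  let φ : F m →* Multiplicative ℤ :=
    { toFun := fun w => .ofAdd (lk (m + 1) (jF m w) a b)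
      map_one' := by rw [map_one, lk_one]; rfl
      map_mul' := fun u v => by rw [map_mul, lk_mul_pure _ (perm_jF v), ofAdd_add] }
  have : φ = 1 := F_hom_ext fun i hi => by
    show Multiplicative.ofAdd (lk (m + 1) (jF m (x m i)) a b) = 1
    rw [jF_x hi, lk_X hi, adj, if_neg (by omega)]; rfl
  exact DFunLike.congr_fun this w

lemma lk_xprod {k a : ℕ} (hk : k ≤ m + 1) (ha : a < k) :
    lk (m + 1) (jF m (xprod m k)) a (m + 1) = 2 := by
  have h0 : ∀ k ≤ a, lk (m + 1) (jF m (xprod m k)) a (m + 1) = 0 := by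
    intro k h
    induction k with
    | zero => rw [xprod, map_one, lk_one]
    | succ k ih =>
      rw [xprod, map_mul, lk_mul_pure _ (perm_jF _), ih (by omega), jF_x (by omega),
        lk_X (by omega), adj, if_neg (by omega)]; rfl
  induction k with
  | zero => omega
  | succ k ih =>
    rw [xprod, map_mul, lk_mul_pure _ (perm_jF _), jF_x (by omega), lk_X (by omega), adj]
    rcases Nat.lt_or_ge a k with h | h
    · rw [ih (by omega) h, if_neg (by omega)]; rfl
    · rw [h0 k h, if_pos (by omega)]; rfl

lemma lk_last (g : Br m) (a : ℕ) : lk m g a (m + 1) = 0 := by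
  let K : Subgroup (Br m) :=
    { carrier := {g | ∀ a, lk m g a (m + 1) = 0}
      one_mem' := fun a => lk_one a _
      mul_mem' := fun {g h} hg hh a => by
        rw [lk_mul, perm_apply_of_lt h (Nat.lt_succ_self m), hg, hh, add_zero]
      inv_mem' := fun {g} hg a => by
        rw [lk_inv, perm_apply_of_lt _ (Nat.lt_succ_self m), hg, neg_zero] }
  exact le_of_s_mem (K := K) (fun i hi a => by rw [lk_s hi, adj, if_neg (by omega)]) g a

lemma lk_zz {a b : ℕ} (ha : a ≤ m) (hb : b ≤ m) (hab : a ≠ b) : lk m (zz m) a b = 2 := by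
  induction m with
  | zero => omega
  | succ m ih =>
    have hD : perm (m + 1) (D m) = 1 := perm_jF _
    rw [zz_succ, lk_mul_pure _ hD, lk_incl]
    have h0 : ∀ a, lk m (zz m) a (m + 1) = 0 := lk_last _
    rcases Nat.lt_or_ge m a with h1 | h1
    · obtain rfl : a = m + 1 := by omega
      rw [lk_comm, lk_comm (D m), h0, D, lk_xprod le_rfl (by omega)]; rfl
    rcases Nat.lt_or_ge m b with h2 | h2
    · obtain rfl : b = m + 1 := by omega
      rw [h0, D, lk_xprod le_rfl (by omega)]; rfl
    rw [ih h1 h2, D, lk_jF_of_le _ h1 h2]; rfl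

end lk

/-! ### Torsion -/

/-- Pure braid groups are torsion free. -/
lemma eq_one_of_pow_eq_one {m : ℕ} {g : Br m} (hg : perm m g = 1) {k : ℕ} (hk : k ≠ 0)
    (h : g ^ k = 1) : g = 1 := by
  induction m with
  | zero =>
    have : g ∈ (⊥ : Subgroup (Br 0)) := le_of_s_mem (fun i hi => by omega) g
    exact Subgroup.mem_bot.mp this
  | succ m ih =>
    obtain ⟨w, rfl⟩ := exists_jj_eq (g := g) (by rw [hg]; rfl)
    have h1 : w ^ k = 1 := jj_injective m (by rw [map_pow, h, map_one])
    have h2 : w.right = 1 := by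
      refine ih (by rw [← perm_jj, hg]) ?_
      have := congrArg SemidirectProduct.rightHom h1
      rwa [map_pow, map_one] at this
    obtain ⟨w, b⟩ := w
    simp only at h2
    subst h2
    have h3 : (SemidirectProduct.inl w : F m ⋊[act m] Br m) ^ k = 1 := h1
    rw [← map_pow, ← map_one SemidirectProduct.inl] at h3
    have h4 : w ^ k = 1 := SemidirectProduct.inl_injective h3
    rw [pow_eq_one_iff_left hk] at h4
    subst h4
    exact map_one (jj m)

lemma mem_zpowers_of_pow {m : ℕ} (hm : 1 ≤ m) {u : Br m} (hu : perm m u = 1) {k : ℕ} (hk : k ≠ 0)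
    (h : u ^ k ∈ Subgroup.zpowers (zz m)) : u ∈ Subgroup.zpowers (zz m) := by
  obtain ⟨l, hl⟩ := h
  simp only at hl
  have h1 := congrArg (fun g => lk m g 0 1) hl
  simp only [lk_zpow_pure (perm_zz m), lk_pow_pure hu, lk_zz (Nat.zero_le m) hm zero_ne_one] at h1
  have h2 : Even (lk m u 0 1) := (even_lk_iff u zero_ne_one).mpr (by rw [hu]; simp)
  obtain ⟨q, hq⟩ := h2
  have hc : Commute u (zz m ^ (-q)) := (show Commute u (zz m) from zz_comm u).zpow_right _
  have h3 : u * zz m ^ (-q) = 1 := by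
    refine eq_one_of_pow_eq_one (by rw [map_mul, map_zpow, perm_zz, hu]; simp) hk ?_
    rw [hc.mul_pow, ← hl, ← zpow_natCast, ← zpow_mul, ← zpow_add]
    have : l + -q * k = 0 := by
      have : (2:ℤ) * (l + -q * k) = 0 := by rw [hq] at h1; linarith
      omega
    rw [this, zpow_zero]
  exact ⟨q, by simp only; rw [zpow_neg, mul_inv_eq_one] at h3; exact h3.symm⟩

end BraidCoHopf

namespace BraidCoHopf

/-! ### From `m + 1` strands to `m + 2` strands -/

section step

variable {m : ℕ}

lemma exists_jj_lift {G : Type*} [Group G] (f : G →* Br (m + 1))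
    (hf : ∀ g, perm (m + 1) (f g) (m + 1) = m + 1) :
    ∃ f' : G →* F m ⋊[act m] Br m, ∀ g, jj m (f' g) = f g := by
  choose f' hf' using fun g => exists_jj_eq (hf g)
  exact ⟨MonoidHom.mk' f' fun a b => jj_injective m (by simp only [map_mul, hf']), hf'⟩

/-- The linking number with the last strand. -/
noncomputable def lkF (m i : ℕ) : F m →* Multiplicative ℤ :=
  MonoidHom.mk' (fun w => .ofAdd (lk (m + 1) (jF m w) i (m + 1))) fun a b => by
    rw [map_mul, lk_mul_pure _ (perm_jF b), ofAdd_add]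

lemma lkF_apply (i : ℕ) (w : F m) : lkF m i w = .ofAdd (lk (m + 1) (jF m w) i (m + 1)) := rfl

lemma lkF_x {i j : ℕ} (hi : i ≤ m) (hj : j ≤ m) : lkF m i (x m j) = .ofAdd (if i = j then 2 else 0) := by
  rw [lkF_apply, jF_x hj, lk_X hj, adj]
  congr 1
  have : i ≠ m + 1 := by omega
  by_cases h : i = j <;> simp [h, this]

lemma eq_one_of_commute_xprod {y : F m} (h : y * xprod m (m + 1) = xprod m (m + 1) * y)
    (h0 : lk (m + 1) (jF m y) 0 (m + 1) = 0) : y = 1 := by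
  obtain ⟨r, p, q, rfl, hq⟩ := exists_zpow_of_commute h
  have h1 : q * lk (m + 1) (jF m r) 0 (m + 1) = 2 := by
    rw [← lk_zpow_pure (perm_jF r), ← map_zpow, ← hq, lk_xprod le_rfl (by omega)]
  rw [map_zpow, lk_zpow_pure (perm_jF r)] at h0
  rcases mul_eq_zero.mp h0 with h2 | h2
  · rw [h2, zpow_zero]
  · rw [h2] at h1; omega

lemma mul_jF_mul_incl (y y' : F m) (b b' : Br m) :
    jF m y * incl m b * (jF m y' * incl m b') = jF m (y * act m b y') * incl m (b * b') := by
  rw [map_mul, map_mul, jF_act]; group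

/-- An unlinked pure braid commuting with all braids on the first strands is trivial. -/
lemma eq_one_of_commute_incl (hm : 2 ≤ m) {b : Br (m + 1)} (hb : perm (m + 1) b = 1)
    (hc : ∀ g, incl m g * b = b * incl m g)
    (hl : ∀ a c, a ≤ m + 1 → c ≤ m + 1 → lk (m + 1) b a c = 0) : b = 1 := by
  obtain ⟨y, b', rfl⟩ := exists_jF_mul_incl (g := b) (by rw [hb]; rfl)
  have hb' : perm m b' = 1 := by rw [← perm_incl, ← hb, map_mul, perm_jF, one_mul]
  have hcen : b' ∈ Subgroup.center (Br m) := by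
    rw [Subgroup.mem_center_iff]
    intro g
    have := hc g
    rw [← one_mul (incl m g), ← map_one (jF m), mul_jF_mul_incl, mul_jF_mul_incl] at this
    exact (jF_mul_incl_inj this).2
  obtain ⟨k, rfl⟩ := mem_zpowers_zz hb' hcen
  have h01 := hl 0 1 (by omega) (by omega)
  have hbp : perm (m + 1) (incl m (zz m ^ k)) = 1 := by rw [perm_incl]; exact hb'
  simp only [lk_mul_pure _ hbp, lk_jF_of_le y (Nat.zero_le m) (by omega : 1 ≤ m), lk_incl,
    lk_zpow_pure (perm_zz m), lk_zz (Nat.zero_le m) (by omega : 1 ≤ m) zero_ne_one] at h01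
  obtain rfl : k = 0 := by omega
  simp only [zpow_zero, map_one, mul_one] at hc hl ⊢
  have hD : jF m y * D m = D m * jF m y := by
    have h1 := zz_comm (jF m y)
    rw [zz_succ, ← mul_assoc, ← hc, mul_assoc, mul_assoc] at h1
    exact mul_left_cancel h1
  rw [D, ← map_mul, ← map_mul] at hD
  rw [eq_one_of_commute_xprod (jF_injective m hD) (hl _ _ (by omega) le_rfl), map_one]

lemma zz_succ_zpow (k : ℤ) :
    zz (m + 1) ^ k = jF m (xprod m (m + 1) ^ k) * incl m (zz m ^ k) := by
  rw [zz_succ, (D_comm (zz m)).mul_zpow, map_zpow, map_zpow, ((D_comm (zz m)).zpow_zpow k k).eq]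
  rfl

lemma F_center {u : F m} (hm : 1 ≤ m) (h : ∀ w, u * w = w * u) : u = 1 := by
  have hx := isFreeCyc_freeGroup (Fin (m + 1))
  exact hx.eq_one_of_mem_zpowers (i := ⟨0, by omega⟩) (j := ⟨1, by omega⟩)
    (by simp) (hx.mem_zpowers_of_commute' (by norm_num) (h _).symm)
    (hx.mem_zpowers_of_commute' (by norm_num) (h _).symm)

/-- The centralizer of the pure braid group. -/
lemma mem_zpowers_zz_of_commute_pure : ∀ {m : ℕ}, 1 ≤ m → ∀ {v : Br m}, perm m v = 1 →
    (∀ p, perm m p = 1 → v * p = p * v) → v ∈ Subgroup.zpowers (zz m)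
  | 0, h, _, _, _ => absurd h (by omega)
  | 1, _, v, hv, _ => by
    refine mem_zpowers_zz hv (Subgroup.mem_center_iff.mpr fun g => ?_)
    have h : ∀ g, g ∈ Subgroup.zpowers (s 1 0) := fun g => le_of_s_mem (fun i hi => by
      obtain rfl : i = 0 := by omega
      exact Subgroup.mem_zpowers _) g
    obtain ⟨a, rfl⟩ := h v
    obtain ⟨b, rfl⟩ := h g
    exact zpow_mul_comm _ _ _
  | m + 2, _, v, hv, h => by
    obtain ⟨y, b, rfl⟩ := exists_jF_mul_incl (g := v) (by rw [hv]; rfl)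
    have hb : perm (m + 1) b = 1 := by rw [← perm_incl, ← hv, map_mul, perm_jF, one_mul]
    obtain ⟨k, rfl⟩ := mem_zpowers_zz_of_commute_pure (by omega) hb fun p hp => by
      have := h (incl _ p) (by rw [perm_incl, hp])
      rw [← one_mul (incl (m + 1) p), ← map_one (jF (m + 1)), mul_jF_mul_incl,
        mul_jF_mul_incl] at this
      exact (jF_mul_incl_inj this).2
    have hk : jF (m + 1) y * incl (m + 1) (zz (m + 1) ^ k) =
        jF (m + 1) (y * (xprod (m + 1) (m + 2) ^ k)⁻¹) * zz (m + 2) ^ k := by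
      rw [zz_succ_zpow (m := m + 1), map_mul, map_inv]; group
    simp only [hk] at h ⊢
    rw [F_center (u := y * (xprod (m + 1) (m + 2) ^ k)⁻¹) (by omega) fun w => ?_, map_one, one_mul]
    · exact Subgroup.zpow_mem _ (Subgroup.mem_zpowers _) _
    · have h1 := h (jF _ w) (perm_jF w)
      have h2 : zz (m + 2) ^ k * jF (m + 1) w = jF (m + 1) w * zz (m + 2) ^ k :=
        Commute.zpow_left (zz_comm (jF (m + 1) w)).symm k
      rw [mul_assoc, h2, ← mul_assoc, ← mul_assoc] at h1
      exact jF_injective _ (by simpa only [map_mul] using mul_right_cancel h1)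

end step

end BraidCoHopf

namespace BraidCoHopf

section core

variable {m : ℕ}

lemma lk_map_s_zero_sq (hm : 3 ≤ m) (R : Br (m + 1) →* Br (m + 1))
    (hR : ∀ g, perm (m + 1) (R g) = perm (m + 1) g)
    (hi : ∀ g, ∃ w, R (incl m g) = jF m w * incl m g) {a b : ℕ} (ha : a ≤ m + 1) (hb : b ≤ m + 1) :
    lk (m + 1) (R (s (m + 1) 0 ^ 2)) a b = lk (m + 1) (s (m + 1) 0 ^ 2) a b := by
  set p := R (s (m + 1) 0 ^ 2) with hp
  have hpp : perm (m + 1) p = 1 := by rw [hp, hR, perm_s_sq]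
  have h1 : ∀ a b, a ≤ m → b ≤ m → lk (m + 1) p a b = lk (m + 1) (s (m + 1) 0 ^ 2) a b := by
    intro a b ha hb
    obtain ⟨w, hw⟩ := hi (s m 0 ^ 2)
    rw [map_pow, incl_s (by omega)] at hw
    rw [hp, hw, lk_mul_pure _ (perm_s_sq 0), lk_jF_of_le w ha hb, zero_add]
  have h2 : ∀ i, 2 ≤ i → i ≤ m → ∀ a b,
      lk (m + 1) p a b = lk (m + 1) p (Equiv.swap i (i + 1) a) (Equiv.swap i (i + 1) b) := by
    intro i h2 him a b
    have hc : R (s (m + 1) i) * p * (R (s (m + 1) i))⁻¹ = p := by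
      rw [hp, mul_inv_eq_iff_eq_mul, ← map_mul, ← map_mul,
        ((s_comm' (m + 1) (i := i) (j := 0) (by omega)).pow_right 2).eq]
    conv_lhs => rw [← hc, lk_conj _ hpp]
    rw [← map_inv, hR, map_inv, perm_s (by omega), Equiv.swap_inv]
  have h3 : ∀ a, a ≤ m → lk (m + 1) p a (m + 1) = lk (m + 1) (s (m + 1) 0 ^ 2) a (m + 1) := by
    have h4 : ∀ a < m, lk (m + 1) p a (m + 1) = lk (m + 1) (s (m + 1) 0 ^ 2) a (m + 1) := by
      intro a ha
      rw [h2 m (by omega) le_rfl, swap_apply_other (by omega) (by omega), swap_apply_succ',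
        h1 _ _ (by omega) le_rfl, lk_s_sq (by omega), lk_s_sq (by omega)]
      simp only [adj]
      rw [if_neg (by omega), if_neg (by omega)]
    intro a ha
    rcases ha.lt_or_eq with ha | rfl
    · exact h4 a ha
    · obtain ⟨k, rfl⟩ : ∃ k, a = k + 1 := ⟨a - 1, by omega⟩
      rw [h2 k (by omega) (by omega), swap_apply_other (k := k + 1 + 1) (by omega) (by omega),
        swap_apply_succ', h4 k (by omega), lk_s_sq (by omega), lk_s_sq (by omega)]
      simp only [adj]
      rw [if_neg (by omega), if_neg (by omega)]
  rcases ha.lt_or_eq with ha | rfl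
  · rcases hb.lt_or_eq with hb | rfl
    · exact h1 _ _ (by omega) (by omega)
    · exact h3 a (by omega)
  · rcases hb.lt_or_eq with hb | rfl
    · rw [lk_comm, h3 b (by omega), lk_comm]
    · rw [lk_self, lk_self]

lemma X_eq_conj {j : ℕ} (hj : j ≤ m) :
    ∃ t : Br m, X m m = incl m t * X m j * (incl m t)⁻¹ := by
  induction hj using Nat.decreasingInduction with
  | self => exact ⟨1, by simp⟩
  | of_succ k hk ih =>
    obtain ⟨t, ht⟩ := ih
    refine ⟨t * s m k, ?_⟩
    rw [ht, ← conj_X_left hk, map_mul, incl_s hk]; group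

lemma lk_map_X (hm : 3 ≤ m) (R : Br (m + 1) →* Br (m + 1))
    (hR : ∀ g, perm (m + 1) (R g) = perm (m + 1) g)
    (hi : ∀ g, ∃ w, R (incl m g) = jF m w * incl m g) {j : ℕ} (hj : j ≤ m)
    {a b : ℕ} (ha : a ≤ m + 1) (hb : b ≤ m + 1) :
    lk (m + 1) (R (X m j)) a b = lk (m + 1) (X m j) a b := by
  obtain ⟨t, ht⟩ := X_eq_conj hj
  obtain ⟨g, hg⟩ : ∃ g, X m j = g * s (m + 1) 0 ^ 2 * g⁻¹ := by
    refine ⟨(incl m t)⁻¹ * δ (m + 1) ^ m, ?_⟩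
    have h : X m j = (incl m t)⁻¹ * X m m * incl m t := by rw [ht]; group
    rw [h, X_last, s_eq_conj (by omega : m < m + 1), conj_pow]; group
  rw [hg, map_mul, map_mul, map_inv, lk_conj _ (by rw [hR, perm_s_sq]), lk_conj _ (perm_s_sq 0),
    ← map_inv, hR]
  exact lk_map_s_zero_sq hm R hR hi (perm_apply_le _ ha) (perm_apply_le _ hb)

lemma incl_s_commute_last {i : ℕ} (hi : i + 1 < m) :
    Commute (s (m + 1) i) (X m m) := by
  rw [X_last]
  exact (s_comm' (m + 1) (by omega)).pow_right 2

lemma exists_map_X_last (hm : 3 ≤ m) (R : Br (m + 1) →* Br (m + 1))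
    (hR : ∀ g, perm (m + 1) (R g) = perm (m + 1) g)
    (hi : ∀ g, ∃ w, R (incl m g) = jF m w * incl m g) : ∃ y, R (X m m) = jF m y := by
  have hp : perm (m + 1) (R (X m m)) = 1 := by rw [hR, perm_X le_rfl]
  obtain ⟨y, b, hyb⟩ := exists_jF_mul_incl (g := R (X m m)) (by rw [hp]; rfl)
  have hb : perm m b = 1 := by rw [← perm_incl, ← hp, hyb, map_mul, perm_jF, one_mul]
  refine ⟨y, ?_⟩
  suffices h : b = 1 by rw [hyb, h, map_one, mul_one]
  obtain ⟨k, rfl⟩ : ∃ k, m = k + 1 := ⟨m - 1, by omega⟩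
  refine eq_one_of_commute_incl (by omega) hb (fun g => ?_) fun a c ha hc => ?_
  · refine Subgroup.mem_centralizer_singleton_iff.mp (le_of_s_mem
      (K := (Subgroup.centralizer {b}).comap (incl k)) (fun i hik => ?_) g)
    rw [Subgroup.mem_comap, Subgroup.mem_centralizer_singleton_iff, incl_s hik]
    obtain ⟨w, hw⟩ := hi (s (k + 1) i)
    have h := congrArg R (incl_s_commute_last (m := k + 1) (i := i) (by omega)).eq
    rw [← incl_s (m := k + 1) (by omega), map_mul, map_mul, hw, hyb, mul_jF_mul_incl,
      mul_jF_mul_incl] at h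
    exact (jF_mul_incl_inj h).2
  · rw [← lk_incl, ← zero_add (lk _ _ _ _), ← lk_jF_of_le y ha hc,
      ← lk_mul_pure _ (by rw [perm_incl, hb]), ← hyb, lk_map_X hm R hR hi le_rfl (by omega)
        (by omega), lk_X le_rfl, adj, if_neg (by omega), lk_jF_of_le y ha hc]
    rfl

lemma exists_map_jF (hm : 3 ≤ m) (R : Br (m + 1) →* Br (m + 1))
    (hR : ∀ g, perm (m + 1) (R g) = perm (m + 1) g)
    (hi : ∀ g, ∃ w, R (incl m g) = jF m w * incl m g) :
    ∃ h : F m →* F m, ∀ w, R (jF m w) = jF m (h w) := by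
  obtain ⟨y, hy⟩ := exists_map_X_last hm R hR hi
  have hX : ∀ j, ∃ v, j ≤ m → R (X m j) = jF m v := by
    intro j
    by_cases hj : j ≤ m
    · obtain ⟨t, ht⟩ := X_eq_conj hj
      obtain ⟨w, hw⟩ := hi t⁻¹
      have h : X m j = incl m t⁻¹ * X m m * (incl m t⁻¹)⁻¹ := by rw [ht, map_inv]; group
      refine ⟨w * act m t⁻¹ y * w⁻¹, fun _ => ?_⟩
      rw [h, map_mul, map_mul, map_inv R, hw, hy, map_mul, map_mul, jF_act, map_inv (jF m)]; group
    · exact ⟨1, fun h => absurd h hj⟩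
  choose v hv using hX
  refine ⟨FreeGroup.lift fun i => v i, fun w => ?_⟩
  refine DFunLike.congr_fun (F_hom_ext (φ := R.comp (jF m))
    (ψ := (jF m).comp (FreeGroup.lift fun i : Fin (m + 1) => v i)) fun i hi => ?_) w
  rw [MonoidHom.comp_apply, MonoidHom.comp_apply, jF_x hi, hv i hi,
    x_eq (Nat.lt_succ_of_le hi), FreeGroup.lift_apply_of]

lemma map_act {R : Br (m + 1) →* Br (m + 1)} {h : F m →* F m}
    (hh : ∀ w, R (jF m w) = jF m (h w)) {g : Br m} {f : F m}
    (hf : R (incl m g) = jF m f * incl m g) (w : F m) :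
    h (act m g w) = f * act m g (h w) * f⁻¹ := by
  apply jF_injective
  rw [← hh, jF_act, map_mul, map_mul, map_inv, hf, hh, map_mul, map_mul, jF_act, map_inv]; group

lemma isConj_act {R : Br (m + 1) →* Br (m + 1)} {h : F m →* F m}
    (hh : ∀ w, R (jF m w) = jF m (h w)) (hi : ∀ g, ∃ w, R (incl m g) = jF m w * incl m g)
    (g : Br m) {w : F m} (hw : IsConj w (h w)) : IsConj (act m g w) (h (act m g w)) := by
  obtain ⟨f, hf⟩ := hi g
  obtain ⟨c, hc⟩ := isConj_iff.mp hw
  rw [map_act hh hf, ← hc]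
  exact isConj_iff.mpr ⟨f * act m g c, by simp only [map_mul, map_inv]; group⟩

lemma act_sq_left {i : ℕ} (hi : i < m) :
    act m (s m i ^ 2) (x m i) = (x m i * x m (i + 1))⁻¹ * x m i * (x m i * x m (i + 1)) := by
  have := (act_isArt hi).sq_left
  rwa [← x_eq, ← x_eq, ← MulAut.mul_apply, ← pow_two, ← map_pow] at this

lemma act_sq_right {i : ℕ} (hi : i < m) :
    act m (s m i ^ 2) (x m (i + 1)) =
      (x m i * x m (i + 1))⁻¹ * x m (i + 1) * (x m i * x m (i + 1)) := by
  have := (act_isArt hi).sq_right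
  rwa [← x_eq, ← x_eq, ← MulAut.mul_apply, ← pow_two, ← map_pow] at this

lemma act_sq_other {i l : ℕ} (hi : i < m) (h1 : l ≠ i) (h2 : l ≠ i + 1) :
    act m (s m i ^ 2) (x m l) = x m l := by
  rw [pow_two, map_mul, MulAut.mul_apply, act_other hi h1 h2, act_other hi h1 h2]

lemma isConj_map_x_one (hm : 3 ≤ m) {R : Br (m + 1) →* Br (m + 1)}
    (hR : ∀ g, perm (m + 1) (R g) = perm (m + 1) g)
    (hi : ∀ g, ∃ w, R (incl m g) = jF m w * incl m g) {h : F m →* F m}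
    (hh : ∀ w, R (jF m w) = jF m (h w)) : IsConj (x m 1) (h (x m 1)) := by
  have hlk : ∀ i ≤ m, lkF m i (h (x m 1)) = .ofAdd (if i = 1 then 2 else 0) := fun i him => by
    rw [lkF_apply, ← hh, jF_x (by omega), lk_map_X hm R hR hi (by omega) (by omega) le_rfl,
      ← jF_x (by omega), ← lkF_apply, lkF_x him (by omega)]
  have key : ∀ i (h2 : i < 2), ∃ u, u * h (x m 1) * u⁻¹ ∈
      blockSubgroup (FreeGroup.of : _ → F m)
        (fun l => decide (l = ⟨i, by omega⟩ ∨ l = ⟨i + 1, by omega⟩)) true := by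
    intro i h2
    obtain ⟨f, hf⟩ := hi (s m i ^ 2)
    have him : i < m := by omega
    have hα : h (x m i * x m (i + 1)) * f * act m (s m i ^ 2) (h (x m 1)) *
        (h (x m i * x m (i + 1)) * f)⁻¹ = h (x m 1) := by
      have h1 := map_act hh hf (x m 1)
      have h3 : act m (s m i ^ 2) (x m 1) =
          (x m i * x m (i + 1))⁻¹ * x m 1 * (x m i * x m (i + 1)) := by
        obtain rfl | rfl : i = 0 ∨ i = 1 := by omega
        · exact act_sq_right him
        · exact act_sq_left him
      rw [h3, map_mul, map_mul, map_inv] at h1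
      have h4 : ∀ a b : F m, a * f * b * (a * f)⁻¹ = a * (f * b * f⁻¹) * a⁻¹ :=
        fun a b => by group
      rw [h4, ← h1]
      simp only [mul_assoc, mul_inv_cancel, mul_inv_cancel_left, mul_one]
    refine (isFreeCyc_freeGroup (Fin (m + 1))).conj_mem_pair (i := ⟨i, by omega⟩)
      (i' := ⟨i + 1, by omega⟩) (by simp) (τ := (act m (s m i ^ 2)).toMonoidHom) ?_ ?_ ?_ hα
      (ψ := lkF m i * (lkF m (i + 1))⁻¹) ?_ ?_ ?_
    · rw [← x_eq, ← x_eq]; exact act_sq_left him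
    · rw [← x_eq, ← x_eq]; exact act_sq_right him
    · rintro ⟨l, hl⟩ h1 h2
      rw [← x_eq]
      exact act_sq_other him (fun h => h1 (Fin.ext h)) fun h => h2 (Fin.ext h)
    · rw [← x_eq, ← x_eq, MonoidHom.mul_apply, MonoidHom.inv_apply, map_mul, map_mul,
        lkF_x him.le him.le, lkF_x him.le him, lkF_x him him.le, lkF_x him him]
      simp
    · rintro ⟨l, hl⟩ h1 h2
      have h1' : i ≠ l := fun h => h1 (Fin.ext h.symm)
      have h2' : i + 1 ≠ l := fun h => h2 (Fin.ext h.symm)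
      rw [← x_eq, MonoidHom.mul_apply, MonoidHom.inv_apply,
        lkF_x him.le (by omega), lkF_x him (by omega)]
      simp [h1', h2']
    · rw [MonoidHom.mul_apply, MonoidHom.inv_apply, hlk _ him.le, hlk _ him]
      obtain rfl | rfl : i = 0 ∨ i = 1 := by omega
      all_goals decide
  obtain ⟨u, hu⟩ := key 0 (by omega)
  obtain ⟨v, hv⟩ := key 1 (by omega)
  obtain ⟨w, k, hw⟩ := (isFreeCyc_freeGroup (Fin (m + 1))).exists_conj_zpow (i := ⟨1, by omega⟩)
    (fun j h1 h2 => by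
      simp only [decide_eq_true_eq, Fin.ext_iff] at h1 h2 ⊢
      omega) hu hv
  rw [← x_eq] at hw
  have h1 := congrArg (lkF m 1) hw
  rw [conj_map_eq, hlk 1 (by omega), map_zpow, lkF_x (by omega) (by omega), if_pos rfl,
    ← ofAdd_zsmul, smul_eq_mul] at h1
  have h2 : (2 : ℤ) = k * 2 := h1
  obtain rfl : k = 1 := by omega
  rw [zpow_one] at hw
  exact (isConj_iff.mpr ⟨w, hw⟩).symm

lemma isConj_map_x (hm : 3 ≤ m) {R : Br (m + 1) →* Br (m + 1)}
    (hR : ∀ g, perm (m + 1) (R g) = perm (m + 1) g)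
    (hi : ∀ g, ∃ w, R (incl m g) = jF m w * incl m g) {h : F m →* F m}
    (hh : ∀ w, R (jF m w) = jF m (h w)) {j : ℕ} (hj : j ≤ m) : IsConj (x m j) (h (x m j)) := by
  have h1 := isConj_map_x_one hm hR hi hh
  rcases j with _ | j
  · have h2 := isConj_act hh hi (s m 0)⁻¹ h1
    have h3 : act m (s m 0) (x m 0) = x m 1 := act_left (by omega)
    rwa [← h3, map_inv, MulAut.inv_apply_self] at h2
  · induction j with
    | zero => exact h1
    | succ j ih =>
      have h2 := isConj_act hh hi (s m (j + 1)) (ih (by omega))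
      rwa [act_left (by omega)] at h2

lemma hasTwist_map {R : Br (m + 1) →* Br (m + 1)}
    (hi : ∀ g, ∃ w, R (incl m g) = jF m w * incl m g) {h : F m →* F m}
    (hh : ∀ w, R (jF m w) = jF m (h w)) {i : ℕ} (him : i < m) :
    HasTwist h (FreeGroup.of : Fin (m + 1) → F m) ⟨i, by omega⟩ ⟨i + 1, by omega⟩ := by
  obtain ⟨f, hf⟩ := hi (s m i ^ 2)
  set c := x m i * x m (i + 1)
  refine ⟨(MulAut.conj c).toMonoidHom.comp (act m (s m i ^ 2)).toMonoidHom, h c * f * c⁻¹,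
    ?_, ?_, ?_, fun w => ?_⟩
  · rw [← x_eq]
    show c * act m (s m i ^ 2) (x m i) * c⁻¹ = _
    rw [act_sq_left him]; simp only [c]; group
  · rw [← x_eq]
    show c * act m (s m i ^ 2) (x m (i + 1)) * c⁻¹ = _
    rw [act_sq_right him]; simp only [c]; group
  · rintro ⟨l, hl⟩ h1 h2
    rw [← x_eq, ← x_eq, ← x_eq]
    show c * act m (s m i ^ 2) (x m l) * c⁻¹ = _
    rw [act_sq_other him (fun h => h1 (Fin.ext h)) fun h => h2 (Fin.ext h)]
  · show h (c * act m (s m i ^ 2) w * c⁻¹) = _ * (c * act m (s m i ^ 2) (h w) * c⁻¹) * _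
    rw [map_mul, map_mul, map_inv, map_act hh hf]; group

theorem exists_conj_of_incl (hm : 3 ≤ m) {R : Br (m + 1) →* Br (m + 1)}
    (hR : ∀ g, perm (m + 1) (R g) = perm (m + 1) g)
    (hi : ∀ g, ∃ w, R (incl m g) = jF m w * incl m g) : ∃ u, ∀ g, R g = u * g * u⁻¹ := by
  obtain ⟨h, hh⟩ := exists_map_jF hm R hR hi
  obtain ⟨u, hu⟩ := (isFreeCyc_freeGroup (Fin (m + 1))).eq_conj (by norm_num) (by omega) (h := h)
    (fun ⟨j, hj⟩ => by rw [← x_eq]; exact isConj_map_x hm hR hi hh (by omega))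
    fun i him => hasTwist_map hi hh (by omega)
  let S : Br (m + 1) →* Br (m + 1) := (MulAut.conj (jF m u)⁻¹).toMonoidHom.comp R
  have hS : ∀ g, S g = (jF m u)⁻¹ * R g * jF m u := fun g => by
    show (jF m u)⁻¹ * R g * (jF m u)⁻¹⁻¹ = _
    rw [inv_inv]
  have hSF : ∀ w, S (jF m w) = jF m w := fun w => by
    rw [hS, hh, hu, map_mul, map_mul, map_inv]; group
  have hSi : ∀ g, S (incl m g) = incl m g := fun g => by
    obtain ⟨f, hf⟩ := hi g
    have h1 : S (incl m g) = jF m (u⁻¹ * f * act m g u) * incl m g := by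
      rw [hS, hf, map_mul, map_mul, jF_act, map_inv]; group
    have h2 := map_act (h := MonoidHom.id _) (R := S) hSF h1
    rw [h1, F_center (u := u⁻¹ * f * act m g u) (by omega) fun w => ?_, map_one, one_mul]
    have h3 := h2 ((act m g)⁻¹ w)
    simp only [MonoidHom.id_apply, MulAut.apply_inv_self] at h3
    exact (eq_mul_inv_iff_mul_eq.mp h3).symm
  have hSp : ∀ g, perm (m + 1) g (m + 1) = m + 1 → S g = g := fun g hg => by
    obtain ⟨w, b, rfl⟩ := exists_jF_mul_incl hg
    rw [map_mul, hSF, hSi]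
  have hperm : ∀ g, perm (m + 1) (S g) = perm (m + 1) g := fun g => by
    rw [hS, map_mul, map_mul, map_inv, hR, perm_jF]; simp
  set σ := s (m + 1) m with hσ
  have hv : σ⁻¹ * S σ ∈ Subgroup.zpowers (zz (m + 1)) := by
    refine mem_zpowers_zz_of_commute_pure (by omega) (by rw [map_mul, hperm, map_inv]; simp)
      fun p hp => ?_
    have h1 : S (σ * p * σ⁻¹) = σ * p * σ⁻¹ := hSp _ (by
      rw [map_mul, map_mul, hp, map_inv, mul_one, mul_inv_cancel]; rfl)
    rw [map_mul, map_mul, map_inv, hSp p (by rw [hp]; rfl), mul_inv_eq_iff_eq_mul] at h1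
    rw [mul_assoc, h1]; group
  obtain ⟨k, hk⟩ := hv
  have hk' : S σ = σ * zz (m + 1) ^ k := (eq_inv_mul_iff_mul_eq.mp hk).symm
  have he : expo (m + 1) (S σ) = expo (m + 1) σ := by
    have h1 : expo (m + 1) (S (δ (m + 1) ^ m * s (m + 1) 0 * (δ (m + 1) ^ m)⁻¹)) =
        expo (m + 1) (S (s (m + 1) 0)) :=
      conj_map_eq ((expo (m + 1)).comp S) (δ (m + 1) ^ m) (s (m + 1) 0)
    rw [← s_eq_conj (by omega), ← hσ, ← incl_s (by omega : 0 < m), hSi,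
      incl_s (by omega)] at h1
    rw [h1, hσ, expo_s (by omega), expo_s (by omega)]
  rw [hk', map_mul, mul_eq_left, map_zpow, expo_zz, ← ofAdd_zsmul, smul_eq_mul] at he
  have he' : k * (((m + 1 : ℕ) : ℤ) * ((m + 1 : ℕ) + 1)) = 0 := he
  have hk0 : k = 0 := by
    refine (mul_eq_zero.mp he').resolve_right ?_
    positivity
  rw [hk0, zpow_zero, mul_one] at hk'
  have hid : S = MonoidHom.id _ := hom_ext fun i him => by
    rcases Nat.lt_succ_iff_lt_or_eq.mp him with h1 | rfl
    · rw [← incl_s h1, hSi]; rfl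
    · exact hk'
  refine ⟨jF m u, fun g => ?_⟩
  have := DFunLike.congr_fun hid g
  rw [hS, MonoidHom.id_apply] at this
  calc R g = jF m u * ((jF m u)⁻¹ * R g * jF m u) * (jF m u)⁻¹ := by group
    _ = _ := by rw [this]

end core

end BraidCoHopf

namespace BraidCoHopf

variable {m : ℕ}

/-- An endomorphism that is inner up to transvections and inversion of the generators. -/
def IsStd (R : Br m →* Br m) : Prop :=
  ∃ (u : Br m) (k : ℤ), (∀ i < m, R (s m i) = u * s m i * u⁻¹ * zz m ^ k) ∨
    ∀ i < m, R (s m i) = u * (s m i)⁻¹ * u⁻¹ * zz m ^ k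

lemma exists_invert (m : ℕ) : ∃ φ : Br m →* Br m, ∀ i < m, φ (s m i) = (s m i)⁻¹ :=
  exists_lift (fun i => (s m i)⁻¹)
    (fun i h => by
      rw [← mul_inv_rev, ← mul_inv_rev, ← mul_inv_rev, ← mul_inv_rev, ← mul_assoc, ← mul_assoc,
        s_braid h])
    fun i j h _ => by rw [← mul_inv_rev, ← mul_inv_rev, s_comm m h]

/-- The automorphism inverting the generators. -/
noncomputable def invert (m : ℕ) : Br m →* Br m := (exists_invert m).choose

lemma invert_s {i : ℕ} (h : i < m) : invert m (s m i) = (s m i)⁻¹ :=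
  (exists_invert m).choose_spec i h

lemma perm_invert (g : Br m) : perm m (invert m g) = perm m g :=
  DFunLike.congr_fun (hom_ext (φ := (perm m).comp (invert m)) (ψ := perm m) fun i hi => by
    rw [MonoidHom.comp_apply, invert_s hi, map_inv, perm_s hi, Equiv.swap_inv]) g

lemma invert_incl (g : Br m) : invert (m + 1) (incl m g) = incl m (invert m g) :=
  DFunLike.congr_fun (hom_ext (φ := (invert (m + 1)).comp (incl m))
    (ψ := (incl m).comp (invert m)) fun i hi => by
    rw [MonoidHom.comp_apply, MonoidHom.comp_apply, incl_s hi, invert_s (by omega), invert_s hi,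
      map_inv, incl_s hi]) g

lemma zz_zpow_comm (g : Br m) (k : ℤ) : g * zz m ^ k = zz m ^ k * g :=
  Commute.zpow_right (zz_comm g) k

lemma IsStd.of_invert {R : Br m →* Br m} (h : IsStd (R.comp (invert m))) : IsStd R := by
  obtain ⟨u, k, h⟩ := h
  refine ⟨u, -k, h.symm.imp (fun h i hi => ?_) fun h i hi => ?_⟩
  all_goals
    have h1 := h i hi
    rw [MonoidHom.comp_apply, invert_s hi, map_inv, inv_eq_iff_eq_inv, zz_zpow_comm] at h1
    rw [h1]; group

/-- Multiplying an endomorphism by a power of the full twist. -/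
lemma exists_twist (R : Br m →* Br m) (k : ℤ) :
    ∃ R' : Br m →* Br m, ∀ i < m, R' (s m i) = R (s m i) * zz m ^ k := by
  have h2 : ∀ a b : Br m, a * zz m ^ k * (b * zz m ^ k) = a * b * (zz m ^ k * zz m ^ k) :=
    fun a b => by rw [mul_assoc a, ← mul_assoc _ b, ← zz_zpow_comm b]; group
  refine exists_lift (fun i => R (s m i) * zz m ^ k) (fun i h => ?_) fun i j h _ => ?_
  · have h3 : ∀ a b c : Br m, a * b * (zz m ^ k * zz m ^ k) * (c * zz m ^ k) =
        a * b * c * (zz m ^ k * zz m ^ k * zz m ^ k) := fun a b c => by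
      rw [← zpow_add, mul_assoc (a * b), ← mul_assoc _ c, ← zz_zpow_comm c]; group
    rw [h2, h2, h3, h3, ← map_mul, ← map_mul, s_braid h, map_mul, map_mul]
  · rw [h2, h2, ← map_mul, s_comm m h, map_mul]

lemma perm_eq_one_of_conj (hm : 2 ≤ m) {u : Br m}
    (h : ∀ i < m, perm m (u * s m i * u⁻¹) = Equiv.swap i (i + 1)) : perm m u = 1 :=
  eq_one_of_commute_swap hm (fun _ hk => perm_apply_of_lt u hk) fun i hi => by
    have := h i hi
    rwa [map_mul, map_mul, map_inv, perm_s hi, mul_inv_eq_iff_eq_mul] at this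

lemma isStd_succ_of_conj (hm : 3 ≤ m) {R : Br (m + 1) →* Br (m + 1)}
    (hR : ∀ g, perm (m + 1) (R g) = perm (m + 1) g) {R' : Br m →* Br m}
    (hi : ∀ g, ∃ w, R (incl m g) = jF m w * incl m (R' g))
    (hR' : ∀ g, perm m (R' g) = perm m g) {u : Br m} {k : ℤ}
    (h : ∀ i < m, R' (s m i) = u * s m i * u⁻¹ * zz m ^ k) : IsStd R := by
  have hu : perm m u = 1 := perm_eq_one_of_conj (by omega) fun i hi => by
    have := congrArg (perm m) (h i hi)
    rwa [hR', map_mul (perm m), map_zpow, perm_zz, one_zpow, mul_one, perm_s hi, eq_comm] at this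
  obtain ⟨S, hS⟩ := exists_twist ((MulAut.conj (incl m u)⁻¹).toMonoidHom.comp R) (-k)
  have hS' : ∀ i < m + 1, S (s (m + 1) i) =
      (incl m u)⁻¹ * R (s (m + 1) i) * incl m u * zz (m + 1) ^ (-k) := fun i hi => by
    rw [hS i hi]
    show (incl m u)⁻¹ * R (s (m + 1) i) * (incl m u)⁻¹⁻¹ * _ = _
    rw [inv_inv]
  have hSp : ∀ g, perm (m + 1) (S g) = perm (m + 1) g := by
    refine fun g => DFunLike.congr_fun (hom_ext (φ := (perm (m + 1)).comp S)
      (ψ := perm (m + 1)) fun i hi => ?_) g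
    rw [MonoidHom.comp_apply, hS' i hi, map_mul, map_mul, map_mul, map_inv, perm_incl, hu, hR,
      map_zpow, perm_zz]
    simp
  have hw : ∀ g : Br m, ∃ w, S (incl m g) = jF m w * incl m g := by
    obtain ⟨f, hf⟩ := exists_jj_lift (S.comp (incl m)) fun g => by
      rw [MonoidHom.comp_apply, hSp, incl_perm_last]
    have hr : ∀ g, (f g).right = g := fun g => DFunLike.congr_fun
      (hom_ext (φ := SemidirectProduct.rightHom.comp f) (ψ := MonoidHom.id (Br m)) fun i him => by
        obtain ⟨w, hw⟩ := hi (s m i)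
        have h1 : jF m (f (s m i)).left * incl m (f (s m i)).right = S (incl m (s m i)) :=
          hf (s m i)
        have h2 : ∀ b : Br m, incl m b = jF m 1 * incl m b := fun b => by rw [map_one, one_mul]
        rw [incl_s him, hS' i (by omega), ← incl_s him, hw, zz_succ_zpow, ← map_inv, h2 u⁻¹,
          h2 u, mul_jF_mul_incl, mul_jF_mul_incl, mul_jF_mul_incl, h i him] at h1
        show (f (s m i)).right = s m i
        rw [(jF_mul_incl_inj h1).2, mul_assoc u⁻¹, mul_assoc _ _ u, ← zz_zpow_comm]; group) g
    refine fun g => ⟨(f g).left, ?_⟩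
    have h1 : jF m (f g).left * incl m (f g).right = S (incl m g) := hf g
    rw [← h1, hr]
  obtain ⟨v, hv⟩ := exists_conj_of_incl hm hSp hw
  refine ⟨incl m u * v, k, Or.inl fun i hi => ?_⟩
  have h1 := hv (s (m + 1) i)
  rw [hS' i hi, zpow_neg, mul_inv_eq_iff_eq_mul] at h1
  have h2 : R (s (m + 1) i) = incl m u * ((incl m u)⁻¹ * R (s (m + 1) i) * incl m u) *
    (incl m u)⁻¹ := by group
  rw [h2, h1]
  simp only [mul_assoc, mul_inv_rev]
  rw [← zz_zpow_comm]

theorem isStd_succ (hm : 3 ≤ m)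
    (ih : ∀ R : Br m →* Br m, (∀ g, perm m (R g) = perm m g) → IsStd R)
    {R : Br (m + 1) →* Br (m + 1)} (hR : ∀ g, perm (m + 1) (R g) = perm (m + 1) g) : IsStd R := by
  obtain ⟨f, hf⟩ := exists_jj_lift (R.comp (incl m)) fun g => by
    rw [MonoidHom.comp_apply, hR, incl_perm_last]
  let R' : Br m →* Br m := SemidirectProduct.rightHom.comp f
  have hi : ∀ g, ∃ w, R (incl m g) = jF m w * incl m (R' g) := fun g => ⟨(f g).left, (hf g).symm⟩
  have hR' : ∀ g, perm m (R' g) = perm m g := fun g => by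
    have h1 : jj m (f g) = R (incl m g) := hf g
    rw [← perm_incl g, ← hR, ← h1, perm_jj]; rfl
  obtain ⟨u, k, h | h⟩ := ih R' hR'
  · exact isStd_succ_of_conj hm hR hi hR' h
  · refine IsStd.of_invert (isStd_succ_of_conj hm (R' := R'.comp (invert m)) (u := u) (k := -k)
      (fun g => ?_) (fun g => ?_) (fun g => ?_) fun i hi => ?_)
    · rw [MonoidHom.comp_apply, hR, perm_invert]
    · rw [MonoidHom.comp_apply, invert_incl]; exact hi _
    · rw [MonoidHom.comp_apply, hR', perm_invert]
    · rw [MonoidHom.comp_apply, invert_s hi, map_inv, h i hi, zz_zpow_comm]; group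

end BraidCoHopf

namespace BraidCoHopf

/-! ### Computations in symmetric groups of degree at most six -/

/-- Six points. -/
inductive Pt | a | b | c | d | e | f

namespace Pt

/-- The map with a given table of values. -/
noncomputable def tab (x₀ x₁ x₂ x₃ x₄ x₅ x : Pt) : Pt := Pt.rec x₀ x₁ x₂ x₃ x₄ x₅ x

/-- Equality test. -/
noncomputable def eqb (x y : Pt) : Bool :=
  Pt.rec (tab' true false false false false false y) (tab' false true false false false false y)
    (tab' false false true false false false y) (tab' false false false true false false y)
    (tab' false false false false true false y) (tab' false false false false false true y) x
where
  /-- The Boolean function with a given table of values. -/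
  tab' (x₀ x₁ x₂ x₃ x₄ x₅ : Bool) (x : Pt) : Bool := Pt.rec x₀ x₁ x₂ x₃ x₄ x₅ x

lemma eqb_iff {x y : Pt} : eqb x y = true ↔ x = y := by
  cases x <;> cases y <;> simp [eqb, eqb.tab']

/-- Universal quantification. -/
def all (φ : Pt → Bool) : Bool := φ a && (φ b && (φ c && (φ d && (φ e && φ f))))

lemma all_iff {φ : Pt → Bool} : all φ = true ↔ ∀ x, φ x = true := by
  constructor
  · intro h x
    simp only [all, Bool.and_eq_true] at h
    cases x <;> tauto
  · intro h
    simp [all, h]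

/-- Equality test for maps. -/
noncomputable def eqf (p q : Pt → Pt) : Bool := all fun x => eqb (p x) (q x)

lemma eqf_iff {p q : Pt → Pt} : eqf p q = true ↔ p = q := by
  simp [eqf, all_iff, eqb_iff, funext_iff]

/-- Case distinction on the value of a point before using it. -/
noncomputable def force₁ (x : Pt) (k : Pt → Bool) : Bool :=
  Pt.rec (k a) (k b) (k c) (k d) (k e) (k f) x

lemma force₁_eq (x : Pt) (k : Pt → Bool) : force₁ x k = k x := by cases x <;> rfl

/-- Tabulation of a map before using it. -/
noncomputable def force (p : Pt → Pt) (k : (Pt → Pt) → Bool) : Bool :=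
  force₁ (p a) fun x₀ => force₁ (p b) fun x₁ => force₁ (p c) fun x₂ => force₁ (p d) fun x₃ =>
    force₁ (p e) fun x₄ => force₁ (p f) fun x₅ => k (tab x₀ x₁ x₂ x₃ x₄ x₅)

lemma tab_eq (p : Pt → Pt) : tab (p a) (p b) (p c) (p d) (p e) (p f) = p := by
  funext x; cases x <;> rfl

lemma force_eq (p : Pt → Pt) (k : (Pt → Pt) → Bool) : force p k = k p := by
  simp only [force, force₁_eq, tab_eq]

/-- Inversion by search. -/
noncomputable def inv (p : Pt → Pt) (x : Pt) : Pt :=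
  cond (eqb (p a) x) a (cond (eqb (p b) x) b (cond (eqb (p c) x) c (cond (eqb (p d) x) d
    (cond (eqb (p e) x) e f))))

lemma inv_eq (p : Equiv.Perm Pt) : inv p = p.symm := by
  funext x
  obtain ⟨y, rfl⟩ := p.surjective x
  rw [Equiv.symm_apply_apply]
  have h : ∀ z, eqb (p z) (p y) = eqb z y := fun z => by
    rw [Bool.eq_iff_iff, eqb_iff, eqb_iff, p.injective.eq_iff]
  simp only [inv, h]
  cases y <;> rfl

/-- Universal quantification over the permutations whose graph satisfies `r`. -/
noncomputable def allPerm (r : Pt → Pt → Bool) (φ : (Pt → Pt) → Bool) : Bool :=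
  all fun x₅ => !(r f x₅) ||
  all fun x₄ => !(r e x₄) || (eqb x₄ x₅ ||
  all fun x₃ => !(r d x₃) || (eqb x₃ x₅ || (eqb x₃ x₄ ||
  all fun x₂ => !(r c x₂) || (eqb x₂ x₅ || (eqb x₂ x₄ || (eqb x₂ x₃ ||
  all fun x₁ => !(r b x₁) || (eqb x₁ x₅ || (eqb x₁ x₄ || (eqb x₁ x₃ || (eqb x₁ x₂ ||
  all fun x₀ => !(r a x₀) || (eqb x₀ x₅ || (eqb x₀ x₄ || (eqb x₀ x₃ || (eqb x₀ x₂ || (eqb x₀ x₁ ||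
    φ (tab x₀ x₁ x₂ x₃ x₄ x₅))))))))))))))))

lemma of_allPerm {r : Pt → Pt → Bool} {φ : (Pt → Pt) → Bool} (h : allPerm r φ = true)
    (p : Equiv.Perm Pt) (hp : ∀ x, r x (p x) = true) : φ p = true := by
  simp only [allPerm, all_iff, Bool.or_eq_true, Bool.not_eq_true', eqb_iff] at h
  have h1 := h (p f)
  simp only [hp, Bool.true_eq_false, false_or] at h1
  have h2 := h1 (p e)
  simp only [hp, Bool.true_eq_false, false_or, p.injective.eq_iff, reduceCtorEq] at h2
  have h3 := h2 (p d)
  simp only [hp, Bool.true_eq_false, false_or, p.injective.eq_iff, reduceCtorEq] at h3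
  have h4 := h3 (p c)
  simp only [hp, Bool.true_eq_false, false_or, p.injective.eq_iff, reduceCtorEq] at h4
  have h5 := h4 (p b)
  simp only [hp, Bool.true_eq_false, false_or, p.injective.eq_iff, reduceCtorEq] at h5
  have h6 := h5 (p a)
  simp only [hp, Bool.true_eq_false, false_or, p.injective.eq_iff, reduceCtorEq] at h6
  rwa [tab_eq] at h6

/-- Test of the braid relation. -/
noncomputable def braidb (p q : Pt → Pt) : Bool :=
  eqf (fun x => p (q (p x))) (fun x => q (p (q x)))

/-- Test of commutation. -/
noncomputable def commb (p q : Pt → Pt) : Bool := eqf (fun x => p (q x)) (fun x => q (p x))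

lemma braidb_iff {p q : Equiv.Perm Pt} : braidb p q = true ↔ p * q * p = q * p * q := by
  rw [braidb, eqf_iff, Equiv.ext_iff, funext_iff]; rfl

lemma commb_iff {p q : Equiv.Perm Pt} : commb p q = true ↔ p * q = q * p := by
  rw [commb, eqf_iff, Equiv.ext_iff, funext_iff]; rfl

lemma eqf_iff' {p q : Equiv.Perm Pt} : eqf p q = true ↔ p = q := by
  rw [eqf_iff, DFunLike.coe_fn_eq]

lemma check₅ : (allPerm (fun x y => (!(eqb f x) || eqb f y) && (!(eqb a x) || eqb b y)) fun t =>
    force (inv t) fun t' =>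
    allPerm (fun x y => !(eqb f x) || eqb f y) fun s =>
    force (fun x => t (s (t' x))) fun s₁ => eqf s s₁ || (!(braidb s s₁) ||
    force (fun x => t (s₁ (t' x))) fun s₂ => !(commb s s₂) ||
    force (fun x => t (s₂ (t' x))) fun s₃ => !(commb s s₃) ||
    force (fun x => t (s₃ (t' x))) fun s₄ => !(commb s s₄))) = true := by
  decide +kernel

lemma check₄ : (allPerm (fun x y => (!(eqb f x) || eqb f y) && (!(eqb e x) || eqb e y)) fun t =>
    force (inv t) fun t' =>
    allPerm (fun x y => (!(eqb f x) || eqb f y) && (!(eqb e x) || eqb e y)) fun s =>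
    force (fun x => t (s (t' x))) fun s₁ => eqf s s₁ || (!(braidb s s₁) ||
    force (fun x => t (s₁ (t' x))) fun s₂ => !(commb s s₂) ||
    force (fun x => t (s₂ (t' x))) fun s₃ => !(commb s s₃))) = true := by
  decide +kernel

/-- The permutation with table `p` moves at most two points. -/
noncomputable def swapb (p : Pt → Pt) : Bool :=
  !(all fun x => all fun y => eqb x y || !(all fun z => eqb z x || (eqb z y || eqb (p z) z)))

/-- Test that the conjugates of `s` by powers of `t` satisfy the braid relations of `σ₀, σ₁, …`
the relation `q (s * t)` and `s * t ≠ 1` only if `s` satisfies `c`. -/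
noncomputable def cyclicb (t t' : Pt → Pt) (r : Pt → Pt → Bool) (q c : (Pt → Pt) → Bool) : Bool :=
  allPerm r fun s => force (fun x => t (s (t' x))) fun s₁ => eqf s s₁ || (!(braidb s s₁) ||
    force (fun x => t (s₁ (t' x))) fun s₂ => !(commb s s₂) || (!(force (fun x => s (t x)) q) ||
    (force (fun x => s (t x)) fun p => eqf p fun x => x) || c s))

/-- Cyclic permutation of four points. -/
noncomputable def rot₄ : Pt → Pt := tab b c d a e f
/-- Cyclic permutation of five points. -/
noncomputable def rot₅ : Pt → Pt := tab b c d e a f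
/-- Cyclic permutation of six points. -/
noncomputable def rot₆ : Pt → Pt := tab b c d e f a

/-- The map `s` is conjugate to `p` by a power of `rot₄`. -/
noncomputable def any₄ (p s : Pt → Pt) : Bool :=
  force (fun x => rot₄ (p (tab d a b c e f x))) fun p₁ =>
  force (fun x => rot₄ (p₁ (tab d a b c e f x))) fun p₂ =>
  force (fun x => rot₄ (p₂ (tab d a b c e f x))) fun p₃ =>
  eqf s p || (eqf s p₁ || (eqf s p₂ || eqf s p₃))

lemma checkRot₄ : cyclicb rot₄ (tab d a b c e f)
    (fun x y => (!(eqb f x) || eqb f y) && (!(eqb e x) || eqb e y))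
    (fun p => eqf (fun x => p (p (p x))) fun x => x)
    (fun s => any₄ (tab b a c d e f) s || any₄ (tab d c a b e f) s) = true := by
  decide +kernel

lemma checkRot₅ : cyclicb rot₅ (tab e a b c d f) (fun x y => !(eqb f x) || eqb f y)
    (fun p => eqf (fun x => p (p (p (p x)))) fun x => x) swapb = true := by
  decide +kernel

lemma checkRot₆ : cyclicb rot₆ (tab f a b c d e) (fun _ _ => true)
    (fun p => eqf (fun x => p (p (p (p (p x))))) fun x => x) swapb = true := by
  decide +kernel

end Pt

end BraidCoHopf

namespace BraidCoHopf

/-! ### Actions of braid groups on few points -/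

section cyclic

variable {m : ℕ} {G : Type*} [Group G] (φ : Br m →* G)

lemma map_s_eq_conj {k : ℕ} (h : k < m) :
    φ (s m k) = φ (δ m) ^ k * φ (s m 0) * (φ (δ m) ^ k)⁻¹ := by
  rw [← map_pow, ← map_inv, ← map_mul, ← map_mul, ← s_eq_conj h]

lemma map_s_succ {k : ℕ} (h : k + 1 < m) :
    φ (s m (k + 1)) = φ (δ m) * φ (s m k) * (φ (δ m))⁻¹ := by
  rw [← map_mul, δ_s h, map_mul, mul_inv_cancel_right]

variable {φ}

lemma map_s_eq (h : φ (s m 0) = φ (s m 1)) {i : ℕ} (hi : i < m) : φ (s m i) = φ (s m 0) := by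
  induction i with
  | zero => rfl
  | succ i ih =>
    rw [map_s_succ φ hi, ih (by omega), ← map_s_succ φ (k := 0) (by omega)]
    exact h.symm

lemma map_s_zero_eq {i : ℕ} (hi : i + 1 < m) (h : φ (s m i) = φ (s m (i + 1))) :
    φ (s m 0) = φ (s m 1) := by
  induction i with
  | zero => exact h
  | succ i ih =>
    refine ih (by omega) ?_
    rw [map_s_succ φ (by omega), map_s_succ φ hi] at h
    simpa using h

lemma map_s_zero_eq_of_commute {i : ℕ} (hi : i + 1 < m)
    (h : φ (s m i) * φ (s m (i + 1)) = φ (s m (i + 1)) * φ (s m i)) :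
    φ (s m 0) = φ (s m 1) := by
  refine map_s_zero_eq hi ?_
  have := congrArg φ (s_braid hi)
  simp only [map_mul] at this
  rw [h] at this
  exact mul_left_cancel this

/-- The commutator subgroup of a braid group on at least five strands has no abelian quotients. -/
lemma map_s_zero_eq_of_ker {H : Type*} [Group H] (hm : 4 ≤ m) (χ : Br m →* H)
    (h : ∀ g k, χ g = 1 → χ k = 1 → φ g * φ k = φ k * φ g) (hχ : χ (s m 0) = χ (s m 1)) :
    φ (s m 0) = φ (s m 1) := by
  refine map_s_zero_eq (i := 2) (by omega) ?_
  have h1 := h (s m 0 * (s m 2)⁻¹) ((s m 0 ^ 2)⁻¹ * (s m 2 * s m 3))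
    (by rw [map_mul, map_inv, map_s_eq hχ (i := 2) (by omega), mul_inv_cancel])
    (by simp only [map_mul, map_inv, map_pow, map_s_eq hχ (i := 2) (by omega),
          map_s_eq hχ (i := 3) (by omega)]; group)
  have h2 : Commute (φ (s m 0)) (φ (s m 2)) := (s_comm' m (Or.inl le_rfl)).map φ
  have h3 : Commute (φ (s m 0)) (φ (s m 3)) := (s_comm' m (Or.inl (by omega))).map φ
  have h4 := congrArg φ (s_braid (m := m) (i := 2) (by omega))
  simp only [map_mul, map_inv, map_pow] at h1 h4
  generalize φ (s m 0) = A at *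
  generalize φ (s m 2) = B at *
  generalize φ (s m (2 + 1)) = C at *
  have e1 : A * B⁻¹ * ((A ^ 2)⁻¹ * (B * C)) = A⁻¹ * C := by
    rw [h2.inv_right.eq, mul_assoc, ← mul_assoc A, show A * (A ^ 2)⁻¹ = A⁻¹ by group, ← mul_assoc,
      ← h2.inv_inv.eq, mul_assoc, inv_mul_cancel_left]
  have e2 : (A ^ 2)⁻¹ * (B * C) * (A * B⁻¹) = A⁻¹ * (B * C * B⁻¹) := by
    rw [mul_assoc, ← mul_assoc (B * C), ← (h2.mul_right h3).eq, mul_assoc, ← mul_assoc,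
      show (A ^ 2)⁻¹ * A = A⁻¹ by group]
  rw [e1, e2] at h1
  have h5 := mul_left_cancel h1
  rw [eq_mul_inv_iff_mul_eq] at h5
  rw [h5] at h4
  exact mul_left_cancel h4

end cyclic

/-- The homomorphism shifting generators by two. -/
lemma exists_shift (m : ℕ) : ∃ κ : Br m →* Br (m + 2), ∀ i < m, κ (s m i) = s (m + 2) (i + 2) :=
  exists_lift (fun i => s (m + 2) (i + 2)) (fun i hi => s_braid (by omega))
    fun i j h hj => s_comm _ (by omega)

lemma commute_shift {m : ℕ} {κ : Br m →* Br (m + 2)} (hκ : ∀ i < m, κ (s m i) = s (m + 2) (i + 2))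
    (g : Br m) : Commute (s (m + 2) 0) (κ g) := by
  let K : Subgroup (Br m) := (Subgroup.centralizer {s (m + 2) 0}).comap κ
  have : g ∈ K := le_of_s_mem (fun i hi => by
    rw [Subgroup.mem_comap, hκ i hi, Subgroup.mem_centralizer_singleton_iff]
    exact (s_comm _ (by omega)).symm) g
  rw [Subgroup.mem_comap, Subgroup.mem_centralizer_singleton_iff] at this
  exact this.symm

section few

variable {Y : Type*} [Fintype Y]

private lemma exists_embedding {n : ℕ} (h : Fintype.card Y ≤ n) (p : Fin n ↪ Pt) :
    ∃ ι : Y ↪ Pt, ∀ y, ∃ i, ι y = p i := by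
  obtain ⟨j⟩ := Function.Embedding.nonempty_of_card_le (α := Y) (β := Fin n) (by simpa using h)
  exact ⟨j.trans p, fun y => ⟨j y, rfl⟩⟩

lemma exists_conj_apply {α : Type*} {a b f : α} (hab : a ≠ b) (hfa : f ≠ a) (hfb : f ≠ b)
    {t : Equiv.Perm α} (hf : t f = f) (ht : t ≠ 1) :
    ∃ π : Equiv.Perm α, π f = f ∧ (π * t * π⁻¹) a = b := by
  classical
  obtain ⟨y, hy⟩ : ∃ y, t y ≠ y := by
    by_contra! h
    exact ht (Equiv.ext h)
  have hyf : y ≠ f := fun h => hy (by rw [h, hf])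
  have hyf' : t y ≠ f := fun h => hyf (t.injective (h.trans hf.symm))
  have ha : Equiv.swap a y (t y) ≠ a := fun h =>
    hy ((Equiv.swap a y).injective (h.trans (Equiv.swap_apply_right a y).symm))
  have haf : Equiv.swap a y f = f := Equiv.swap_apply_of_ne_of_ne hfa hyf.symm
  have h1 : Equiv.swap (Equiv.swap a y (t y)) b a = a :=
    Equiv.swap_apply_of_ne_of_ne ha.symm hab
  refine ⟨Equiv.swap (Equiv.swap a y (t y)) b * Equiv.swap a y, ?_, ?_⟩
  · rw [Equiv.Perm.mul_apply, haf]
    refine Equiv.swap_apply_of_ne_of_ne (fun h => hyf' ?_) hfb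
    rw [← haf] at h
    exact ((Equiv.swap a y).injective h).symm
  · have h2 : (Equiv.swap (Equiv.swap a y (t y)) b * Equiv.swap a y)⁻¹ a = y := by
      rw [Equiv.Perm.inv_eq_iff_eq, Equiv.Perm.mul_apply, Equiv.swap_apply_right, h1]
    rw [Equiv.Perm.mul_apply, h2, Equiv.Perm.mul_apply, Equiv.Perm.mul_apply,
      Equiv.swap_apply_left]

open Pt in
lemma map_s_zero_eq_of_card_five (φ : Br 5 →* Equiv.Perm Y) (h : Fintype.card Y ≤ 5) :
    φ (s 5 0) = φ (s 5 1) := by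
  obtain ⟨ι, hι⟩ := exists_embedding h ⟨![a, b, c, d, e], by
    intro i j; fin_cases i <;> fin_cases j <;> simp⟩
  have hf : f ∉ Set.range ι := by
    rintro ⟨y, hy⟩
    obtain ⟨i, hi⟩ := hι y
    rw [hy] at hi
    fin_cases i <;> cases hi
  let Ψ := (Equiv.Perm.viaEmbeddingHom ι).comp φ
  have hΨ : ∀ g, Ψ g f = f := fun g => Equiv.Perm.viaEmbedding_apply_of_notMem _ _ _ hf
  refine Equiv.Perm.viaEmbeddingHom_injective ι (show Ψ (s 5 0) = Ψ (s 5 1) from ?_)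
  by_cases hδ : Ψ (δ 5) = 1
  · rw [← zero_add 1, map_s_succ Ψ (show 0 + 1 < 5 by omega), hδ]
    group
  obtain ⟨π, hπf, hπ⟩ := exists_conj_apply (a := a) (b := b) (by simp) (by simp) (by simp)
    (hΨ (δ 5)) hδ
  let Φ := (MulAut.conj π).toMonoidHom.comp Ψ
  have hΦ : ∀ g, Φ g f = f := fun g => by
    show π (Ψ g (π⁻¹ f)) = f
    rw [Equiv.Perm.inv_eq_iff_eq.2 hπf.symm, hΨ, hπf]
  have hr : ∀ g x, (!(eqb f x) || eqb f (Φ g x)) = true := by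
    intro g x
    cases x <;> first | rfl | (rw [hΦ]; rfl)
  have hr' : ∀ x, ((!(eqb f x) || eqb f (Φ (δ 5) x)) && (!(eqb a x) || eqb b (Φ (δ 5) x))) = true := by
    intro x
    rw [hr, Bool.true_and]
    cases x <;> first | rfl | (rw [show Φ (δ 5) a = b from hπ]; rfl)
  have h1 := of_allPerm check₅ (Φ (δ 5)) hr'
  rw [force_eq, inv_eq] at h1
  have h2 := of_allPerm h1 (Φ (s 5 0)) (hr _)
  have e : ∀ k, k + 1 < 5 → (fun x => Φ (δ 5) (Φ (s 5 k) ((Φ (δ 5)).symm x))) =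
      Φ (s 5 (k + 1)) := fun k hk => by
    rw [map_s_succ Φ hk]; rfl
  rw [force_eq, e 0 (by omega), force_eq, e 1 (by omega), force_eq, e 2 (by omega), force_eq,
    e 3 (by omega)] at h2
  have hb : braidb (Φ (s 5 0)) (Φ (s 5 (0 + 1))) = true := by
    rw [braidb_iff, ← map_mul, ← map_mul, s_braid (by omega), map_mul, map_mul]
  have hc : ∀ k, 2 ≤ k → commb (Φ (s 5 0)) (Φ (s 5 k)) = true := fun k hk => by
    rw [commb_iff, ← map_mul, s_comm _ (by omega), map_mul]
  rw [hb, hc _ (by omega), hc _ (by omega), hc _ (by omega)] at h2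
  simp only [Bool.not_true, Bool.or_false, eqf_iff'] at h2
  exact (MulAut.conj π).injective h2

open Pt in
lemma map_s_zero_eq_of_card_four (φ : Br 4 →* Equiv.Perm Y) (h : Fintype.card Y ≤ 4) :
    φ (s 4 0) = φ (s 4 1) := by
  obtain ⟨ι, hι⟩ := exists_embedding h ⟨![a, b, c, d], by
    intro i j; fin_cases i <;> fin_cases j <;> simp⟩
  have hf : f ∉ Set.range ι := by
    rintro ⟨y, hy⟩
    obtain ⟨i, hi⟩ := hι y
    rw [hy] at hi
    fin_cases i <;> cases hi
  have he : e ∉ Set.range ι := by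
    rintro ⟨y, hy⟩
    obtain ⟨i, hi⟩ := hι y
    rw [hy] at hi
    fin_cases i <;> cases hi
  let Φ := (Equiv.Perm.viaEmbeddingHom ι).comp φ
  have hΦ : ∀ g, Φ g f = f := fun g => Equiv.Perm.viaEmbedding_apply_of_notMem _ _ _ hf
  have hΦ' : ∀ g, Φ g e = e := fun g => Equiv.Perm.viaEmbedding_apply_of_notMem _ _ _ he
  have hr : ∀ g x, ((!(eqb f x) || eqb f (Φ g x)) && (!(eqb e x) || eqb e (Φ g x))) = true := by
    intro g x
    cases x <;> first | rfl | (rw [hΦ]; rfl) | (rw [hΦ']; rfl)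
  have h1 := of_allPerm check₄ (Φ (δ 4)) (hr _)
  rw [force_eq, inv_eq] at h1
  have h2 := of_allPerm h1 (Φ (s 4 0)) (hr _)
  have e : ∀ k, k + 1 < 4 → (fun x => Φ (δ 4) (Φ (s 4 k) ((Φ (δ 4)).symm x))) =
      Φ (s 4 (k + 1)) := fun k hk => by
    rw [map_s_succ Φ hk]; rfl
  rw [force_eq, e 0 (by omega), force_eq, e 1 (by omega), force_eq, e 2 (by omega)] at h2
  have hb : braidb (Φ (s 4 0)) (Φ (s 4 (0 + 1))) = true := by
    rw [braidb_iff, ← map_mul, ← map_mul, s_braid (by omega), map_mul, map_mul]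
  have hc : ∀ k, 2 ≤ k → commb (Φ (s 4 0)) (Φ (s 4 k)) = true := fun k hk => by
    rw [commb_iff, ← map_mul, s_comm _ (by omega), map_mul]
  rw [hb, hc _ (by omega), hc _ (by omega)] at h2
  simp only [Bool.not_true, Bool.or_false, eqf_iff'] at h2
  exact Equiv.Perm.viaEmbeddingHom_injective ι h2

end few

end BraidCoHopf

namespace BraidCoHopf

section restrict

variable {H Y : Type*} [Group H]

/-- The action induced on an invariant subset. -/
def restrictHom (θ : H →* Equiv.Perm Y) (p : Y → Prop) (h : ∀ g y, p (θ g y) ↔ p y) :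
    H →* Equiv.Perm {y // p y} where
  toFun g := (θ g).subtypePerm fun y => h g y
  map_one' := by ext y; simp
  map_mul' g k := by
    ext y
    show θ (g * k) y = θ g (θ k y)
    rw [map_mul]; rfl

lemma restrictHom_apply (θ : H →* Equiv.Perm Y) (p : Y → Prop) (h : ∀ g y, p (θ g y) ↔ p y) (g : H)
    (y : {y // p y}) : (restrictHom θ p h g y : Y) = θ g y := rfl

/-- The action induced on the quotient by an invariant equivalence relation. -/
def quotientHom (θ : H →* Equiv.Perm Y) (r : Setoid Y) (h : ∀ g x y, r x y → r (θ g x) (θ g y)) :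
    H →* Equiv.Perm (Quotient r) :=
  letI : MulAction H (Quotient r) :=
    { smul := fun g => Quotient.map (θ g) (h g)
      one_smul := by
        rintro ⟨y⟩
        exact congrArg (Quotient.mk r) (by rw [map_one]; rfl)
      mul_smul := by
        rintro g k ⟨y⟩
        exact congrArg (Quotient.mk r) (by rw [map_mul]; rfl) }
  MulAction.toPermHom H (Quotient r)

lemma quotientHom_mk (θ : H →* Equiv.Perm Y) (r : Setoid Y)
    (h : ∀ g x y, r x y → r (θ g x) (θ g y)) (g : H) (y : Y) :
    quotientHom θ r h g (Quotient.mk r y) = Quotient.mk r (θ g y) := rfl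

end restrict

/-- If all noncyclic actions of `Br m` need more than `m` points, then in a noncyclic action of
`Br (m + 2)` on at most `m + 3` points the generators act as transpositions. -/
lemma isSwap_of_card {m : ℕ} (hm : 4 ≤ m)
    (ih : ∀ (Z : Type) [Fintype Z] (θ : Br m →* Equiv.Perm Z), Fintype.card Z ≤ m →
      θ (s m 0) = θ (s m 1))
    {Y : Type} [Fintype Y] [DecidableEq Y] (φ : Br (m + 2) →* Equiv.Perm Y)
    (hY : Fintype.card Y ≤ m + 3) :
    φ (s (m + 2) 0) = φ (s (m + 2) 1) ∨ (φ (s (m + 2) 0)).IsSwap ∧ m + 3 ≤ Fintype.card Y := by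
  obtain ⟨κ, hκ⟩ := exists_shift m
  set σ := φ (s (m + 2) 0) with hσ
  let θ := φ.comp κ
  have hθ : ∀ g, Commute σ (θ g) := fun g => (commute_shift hκ g).map φ
  have hθ' : ∀ g y, σ (θ g y) = θ g (σ y) := fun g y => by
    rw [← Equiv.Perm.mul_apply, (hθ g).eq]; rfl
  have hp : ∀ g y, σ (θ g y) = θ g y ↔ σ y = y := fun g y => by
    rw [hθ', (θ g).injective.eq_iff]
  have hn : ∀ g y, σ (θ g y) ≠ θ g y ↔ σ y ≠ y := fun g y => (hp g y).not
  have hcard : Fintype.card {y // σ y = y} + Fintype.card {y // σ y ≠ y} = Fintype.card Y := by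
    rw [← Fintype.card_sum]
    exact Fintype.card_congr (Equiv.sumCompl fun y => σ y = y)
  have hsupp : Fintype.card {y // σ y ≠ y} = σ.support.card :=
    Fintype.card_of_subtype _ fun y => Equiv.Perm.mem_support
  rcases Nat.lt_or_ge m (Fintype.card {y // σ y = y}) with hF | hF
  · by_cases h1 : σ = 1
    · left
      rw [map_s_succ φ (k := 0) (by omega), ← hσ, h1]; simp
    · have := Equiv.Perm.two_le_card_support_of_ne_one h1
      exact Or.inr ⟨Equiv.Perm.card_support_eq_two.mp (by omega), by omega⟩
  left
  let Z := {y // σ y ≠ y}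
  let ψ : Br m →* Equiv.Perm Z := restrictHom θ (fun y => σ y ≠ y) hn
  let r : Setoid Z :=
    { r := fun z w => σ.SameCycle z w
      iseqv := ⟨fun z => .refl _ _, fun h => h.symm, fun h h' => h.trans h'⟩ }
  have hr : ∀ g z w, r z w → r (ψ g z) (ψ g w) := by
    rintro g z w ⟨k, hk⟩
    refine ⟨k, ?_⟩
    rw [restrictHom_apply, restrictHom_apply, ← hk, ← Equiv.Perm.mul_apply,
      ((hθ g).zpow_left k).eq]
    rfl
  let _ : Fintype (Quotient r) := Fintype.ofFinite _
  have hQ : 2 * Fintype.card (Quotient r) ≤ Fintype.card Z := by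
    let i : Quotient r × Bool → Z := fun q =>
      if q.2 then ⟨σ q.1.out, fun h => q.1.out.2 (σ.injective h)⟩ else q.1.out
    have hi : ∀ q, Quotient.mk r (i q) = q.1 := by
      rintro ⟨q, b⟩
      cases b
      · exact Quotient.out_eq q
      · conv_rhs => rw [← Quotient.out_eq q]
        exact Quotient.sound ⟨-1, by simp [i]⟩
    have : Function.Injective i := by
      rintro ⟨q, b⟩ ⟨q', b'⟩ h
      obtain rfl : q = q' := (hi (q, b)).symm.trans ((congrArg _ h).trans (hi (q', b')))
      have h2 := q.out.2
      have h' := congrArg Subtype.val h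
      cases b <;> cases b' <;> simp [i] at h' ⊢
      · exact h2 h'.symm
      · exact h2 h'
    have := Fintype.card_le_of_injective i this
    simpa [mul_comm] using this
  have hZ : Fintype.card Z ≤ m + 3 := by
    have : Fintype.card Z = Fintype.card {y // σ y ≠ y} := rfl
    omega
  have hψ : ψ (s m 0) = ψ (s m 1) := by
    refine map_s_zero_eq_of_ker hm (quotientHom ψ r hr) (fun g k hg hk => ?_)
      (ih _ _ (by omega))
    have key : ∀ g, quotientHom ψ r hr g = 1 → ∀ z : Z, ∃ a : ℤ, θ g z = (σ ^ a) z := by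
      intro g hg z
      have := DFunLike.congr_fun hg (Quotient.mk r z)
      rw [quotientHom_mk] at this
      obtain ⟨a, ha⟩ := Quotient.exact this.symm
      exact ⟨a, ha.symm⟩
    ext z
    show θ g (θ k z) = θ k (θ g z)
    obtain ⟨a, ha⟩ := key g hg z
    obtain ⟨b, hb⟩ := key k hk z
    have hc : ∀ g (a : ℤ) y, θ g ((σ ^ a) y) = (σ ^ a) (θ g y) := fun g a y => by
      rw [← Equiv.Perm.mul_apply, ← ((hθ g).zpow_left a).eq]; rfl
    rw [hb, hc, ha, hc, hb, ← Equiv.Perm.mul_apply, ← Equiv.Perm.mul_apply, ← zpow_add,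
      ← zpow_add, add_comm]
  have hω := ih _ (restrictHom θ (fun y => σ y = y) hp) hF
  refine map_s_zero_eq (i := 2) (by omega) ?_
  rw [← hκ 0 (by omega), ← hκ 1 (by omega)]
  ext y
  by_cases hy : σ y = y
  · exact congrArg Subtype.val (DFunLike.congr_fun hω ⟨y, hy⟩)
  · exact congrArg Subtype.val (DFunLike.congr_fun hψ ⟨y, hy⟩)

/-- A noncyclic action of the braid group on `m + 1 ≥ 5` strands needs at least `m + 1` points. -/
theorem map_s_zero_eq_of_card {m : ℕ} (hm : 4 ≤ m) {Y : Type} [Fintype Y]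
    (φ : Br m →* Equiv.Perm Y) (hY : Fintype.card Y ≤ m) : φ (s m 0) = φ (s m 1) := by
  classical
  induction m using Nat.strong_induction_on generalizing Y with
  | _ m ih =>
    obtain rfl | rfl | h : m = 4 ∨ m = 5 ∨ 6 ≤ m := by omega
    · exact map_s_zero_eq_of_card_four φ hY
    · exact map_s_zero_eq_of_card_five φ hY
    · obtain ⟨m, rfl⟩ : ∃ k, m = k + 2 := ⟨m - 2, by omega⟩
      refine (isSwap_of_card (by omega) (fun Z _ θ hZ => ih m (by omega) (by omega) θ hZ) φ
        (by omega)).resolve_right fun h => by omega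

/-- The generators act by transpositions in a noncyclic action of the braid group on `m + 1 ≥ 7`
strands on `m + 1` points. -/
theorem isSwap_of_noncyclic {m : ℕ} (hm : 6 ≤ m) {Y : Type} [Fintype Y] [DecidableEq Y]
    (φ : Br m →* Equiv.Perm Y) (hY : Fintype.card Y = m + 1) (h : φ (s m 0) ≠ φ (s m 1)) :
    (φ (s m 0)).IsSwap := by
  obtain ⟨m, rfl⟩ : ∃ k, m = k + 2 := ⟨m - 2, by omega⟩
  exact ((isSwap_of_card (by omega) (fun Z _ θ hZ => map_s_zero_eq_of_card (by omega) θ hZ) φ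
    hY.le).resolve_left h).1

end BraidCoHopf

namespace BraidCoHopf

variable {m : ℕ}

/-! ### Permutations of the finite set of strands -/

/-- The permutation of the strands, as a permutation of `Fin (m + 1)`. -/
noncomputable def permF (m : ℕ) : Br m →* Equiv.Perm (Fin (m + 1)) :=
  (Fin.equivSubtype (n := m + 1)).symm.permCongrHom.toMonoidHom.comp
    (restrictHom (perm m) (fun k => k < m + 1) fun g k => by
      rcases Nat.lt_or_ge m k with h | h
      · rw [perm_apply_of_lt g h]
      · have := perm_apply_le g h
        constructor <;> intros <;> omega)

lemma permF_apply (g : Br m) (k : Fin (m + 1)) : (permF m g k : ℕ) = perm m g k := rfl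

lemma permF_eq_iff {g h : Br m} : permF m g = permF m h ↔ perm m g = perm m h := by
  constructor
  · intro H
    ext k
    rcases Nat.lt_or_ge m k with hk | hk
    · rw [perm_apply_of_lt g hk, perm_apply_of_lt h hk]
    · rw [← permF_apply g ⟨k, by omega⟩, ← permF_apply h ⟨k, by omega⟩, H]
  · intro H
    ext k
    rw [permF_apply, permF_apply, H]

lemma permF_eq_one_iff {g : Br m} : permF m g = 1 ↔ perm m g = 1 := by
  rw [← map_one (permF m), permF_eq_iff, map_one]

lemma permF_s (i : Fin m) : permF m (s m i) = Equiv.swap i.castSucc i.succ := by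
  ext k
  rw [permF_apply, perm_s i.2, Equiv.swap_apply_def, Equiv.swap_apply_def]
  simp only [Fin.ext_iff, Fin.val_castSucc, Fin.val_succ]
  split_ifs <;> rfl

lemma permF_surjective (m : ℕ) : Function.Surjective (permF m) := by
  rw [← MonoidHom.mrange_eq_top, eq_top_iff, ← Equiv.Perm.mclosure_swap_castSucc_succ,
    Submonoid.closure_le]
  rintro _ ⟨i, rfl⟩
  exact ⟨s m i, permF_s i⟩

lemma perm_δ {k : ℕ} (h : k < m) : perm m (δ m) k = k + 1 ∧ perm m (δ m) m = 0 := by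
  have key : ∀ l ≤ m, perm m (dl m l) l = 0 ∧ (∀ k < l, perm m (dl m l) k = k + 1) ∧
      ∀ k, l < k → perm m (dl m l) k = k := by
    intro l
    induction l with
    | zero => intro _; simp [dl]
    | succ l ih =>
      intro hl
      obtain ⟨h1, h2, h3⟩ := ih (by omega)
      have hd : dl m (l + 1) = dl m l * s m l := by simp [dl]
      rw [hd, map_mul, perm_s (by omega)]
      refine ⟨by simp [h1], fun k hk => ?_, fun k hk => ?_⟩
      · rcases Nat.lt_or_ge k l with h | h
        · rw [Equiv.Perm.mul_apply, Equiv.swap_apply_of_ne_of_ne (by omega) (by omega), h2 k h]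
        · obtain rfl : k = l := by omega
          rw [Equiv.Perm.mul_apply, Equiv.swap_apply_left, h3 _ (by omega)]
      · rw [Equiv.Perm.mul_apply, Equiv.swap_apply_of_ne_of_ne (by omega) (by omega),
          h3 k (by omega)]
  exact ⟨(key m le_rfl).2.1 k h, (key m le_rfl).1⟩

/-! ### The commutator subgroup -/

lemma eq_one_of_perfect_pure {H : Type} [Group H] (hH : commutator H = ⊤) (f : H →* Br m)
    (hf : ∀ g, perm m (f g) = 1) : f = 1 := by
  induction m with
  | zero =>
    ext g
    exact Subgroup.mem_bot.mp (le_of_s_mem (K := ⊥) (fun i hi => by omega) (f g))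
  | succ m ih =>
    have h1 : ∀ g, f g ∈ (jj m).range := fun g => exists_jj_eq (by rw [hf]; rfl)
    let f₁ : H →* F m ⋊[act m] Br m :=
      (MonoidHom.ofInjective (jj_injective m)).symm.toMonoidHom.comp (f.codRestrict _ h1)
    have hf₁ : ∀ g, jj m (f₁ g) = f g := fun g =>
      MonoidHom.apply_ofInjective_symm (jj_injective m) ⟨f g, h1 g⟩
    have hr := ih (SemidirectProduct.rightHom.comp f₁) fun g => by
      rw [← hf g, ← hf₁, perm_jj]; rfl
    have h2 : ∀ g, f g ∈ (jF m).range := fun g => by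
      have : (f₁ g).right = 1 := DFunLike.congr_fun hr g
      exact ⟨(f₁ g).left, by
        rw [← hf₁]
        conv_rhs => rw [← SemidirectProduct.inl_left_mul_inr_right (f₁ g)]
        rw [this, map_mul, jj_inl, map_one, map_one, mul_one]⟩
    let f₂ : H →* F m :=
      (MonoidHom.ofInjective (jF_injective m)).symm.toMonoidHom.comp (f.codRestrict _ h2)
    have hf₂ : ∀ g, jF m (f₂ g) = f g := fun g =>
      MonoidHom.apply_ofInjective_symm (jF_injective m) ⟨f g, h2 g⟩
    ext g
    rw [← hf₂, eq_one_of_perfect hH f₂]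
    simp

lemma map_s_eq_of_comm {A : Type*} [CommGroup A] (f : Br m →* A) {i : ℕ} (hi : i < m) :
    f (s m i) = f (s m 0) := by
  rw [map_s_eq_conj f hi, mul_comm, inv_mul_cancel_left]

open scoped commutatorElement in
lemma commutator_perfect (hm : 4 ≤ m) : commutator (commutator (Br m)) = ⊤ := by
  set N := ⁅commutator (Br m), commutator (Br m)⁆ with hN
  have h1 : QuotientGroup.mk' N (s m 0) = QuotientGroup.mk' N (s m 1) := by
    refine map_s_zero_eq_of_ker hm Abelianization.of (fun g k hg hk => ?_)
      (map_s_eq_of_comm _ (by omega)).symm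
    replace hg := (QuotientGroup.eq_one_iff g).mp hg
    replace hk := (QuotientGroup.eq_one_iff k).mp hk
    rw [← map_mul, ← map_mul, QuotientGroup.mk'_eq_mk']
    refine ⟨⁅k⁻¹, g⁻¹⁆, Subgroup.commutator_mem_commutator (inv_mem hk) (inv_mem hg), ?_⟩
    rw [commutatorElement_def]; group
  have h2 : ∀ g, QuotientGroup.mk' N g ∈ Subgroup.zpowers (QuotientGroup.mk' N (s m 0)) :=
    le_of_s_mem (K := (Subgroup.zpowers (QuotientGroup.mk' N (s m 0))).comap _) fun i hi => by
      rw [Subgroup.mem_comap, map_s_eq h1 hi]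
      exact Subgroup.mem_zpowers _
  have h3 : commutator (Br m) ≤ N := by
    rw [commutator_def, Subgroup.commutator_le]
    intro g _ k _
    rw [← QuotientGroup.ker_mk' N, MonoidHom.mem_ker, map_commutatorElement,
      commutatorElement_eq_one_iff_mul_comm]
    obtain ⟨a, ha⟩ := h2 g
    obtain ⟨b, hb⟩ := h2 k
    rw [← ha, ← hb]
    exact (Commute.refl _).zpow_zpow a b
  refine Subgroup.map_injective (commutator (Br m)).subtype_injective ?_
  rw [Subgroup.map_subtype_commutator, ← MonoidHom.range_eq_map, Subgroup.range_subtype]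
  exact le_antisymm (Subgroup.commutator_le_left _ _) h3

/-- An endomorphism reflecting the center has noncyclic image in the symmetric group. -/
lemma perm_map_ne (hm : 4 ≤ m) (R : Br m →* Br m)
    (hR : ∀ g, R g ∈ Subgroup.center (Br m) → g ∈ Subgroup.center (Br m)) :
    permF m (R (s m 0)) ≠ permF m (R (s m 1)) := by
  intro h
  have h1 := eq_one_of_perfect_pure (commutator_perfect hm) (R.comp (commutator (Br m)).subtype)
    (by
      rintro ⟨g, hg⟩
      rw [← permF_eq_one_iff]
      have h2 : ∀ g, permF m (R g) ∈ Subgroup.zpowers (permF m (R (s m 0))) :=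
        le_of_s_mem (K := (Subgroup.zpowers (permF m (R (s m 0)))).comap ((permF m).comp R))
          fun i hi => by
            rw [Subgroup.mem_comap, map_s_eq (φ := (permF m).comp R) h hi]
            exact Subgroup.mem_zpowers _
      have h3 : commutator (Br m) ≤ ((permF m).comp R).ker := by
        rw [commutator_def, Subgroup.commutator_le]
        intro g _ k _
        rw [MonoidHom.mem_ker, map_commutatorElement, commutatorElement_eq_one_iff_mul_comm]
        obtain ⟨a, ha⟩ := h2 g
        obtain ⟨b, hb⟩ := h2 k
        rw [MonoidHom.comp_apply, MonoidHom.comp_apply, ← ha, ← hb]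
        exact (Commute.refl _).zpow_zpow a b
      exact h3 hg)
  have h4 : s m 0 * (s m 1)⁻¹ ∈ commutator (Br m) := by
    rw [← QuotientGroup.eq_one_iff]
    show Abelianization.of _ = 1
    rw [map_mul, map_inv, map_s_eq_of_comm Abelianization.of (show 1 < m by omega), mul_inv_cancel]
  have h5 : R (s m 0 * (s m 1)⁻¹) = 1 := DFunLike.congr_fun h1 ⟨_, h4⟩
  have h6 := perm_eq_one_of_mem_center (by omega) (hR _ (by rw [h5]; exact one_mem _))
  rw [map_mul, map_inv, mul_inv_eq_one, perm_s (by omega), perm_s (by omega)] at h6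
  have := DFunLike.congr_fun h6 0
  rw [Equiv.swap_apply_left, Equiv.swap_apply_of_ne_of_ne (by omega) (by omega)] at this
  omega

end BraidCoHopf

namespace BraidCoHopf

variable {m : ℕ}

lemma permF_δ (m : ℕ) : permF m (δ m) = finRotate (m + 1) := by
  ext ⟨k, hk⟩
  rw [permF_apply]
  rcases Nat.lt_or_ge k m with h | h
  · rw [(perm_δ h).1, finRotate_of_lt h]
  · obtain rfl : k = m := by omega
    rw [finRotate_last']
    rcases Nat.eq_zero_or_pos k with rfl | h0
    · simp [δ, dl]
    · exact (perm_δ h0).2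

section cyclic

open Pt

variable {Y : Type} [DecidableEq Y]

lemma isSwap_of_swapb {ι : Y ↪ Pt} [Fintype Y] {p : Equiv.Perm Y} (hp : p ≠ 1)
    (h : swapb (Equiv.Perm.viaEmbeddingHom ι p) = true) : p.IsSwap := by
  classical
  simp only [swapb, Bool.not_eq_true', ← Bool.not_eq_true, all_iff, not_forall, Bool.or_eq_true,
    eqb_iff, not_or] at h
  obtain ⟨x, y, hxy, h⟩ := h
  rw [← Equiv.Perm.card_support_eq_two]
  refine le_antisymm ?_ (Equiv.Perm.two_le_card_support_of_ne_one hp)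
  have h3 : p.support.map ι ⊆ ({x, y} : Finset Pt) := by
    intro z hz
    obtain ⟨w, hw, rfl⟩ := Finset.mem_map.mp hz
    rw [Finset.mem_insert, Finset.mem_singleton]
    by_contra hc
    rw [not_or] at hc
    refine h ⟨ι w, hc.1, hc.2, ?_⟩
    rw [Equiv.Perm.viaEmbeddingHom_apply, Equiv.Perm.viaEmbedding_apply]
    exact fun h => Equiv.Perm.mem_support.mp hw (ι.injective h)
  rw [← Finset.card_map ι]
  exact (Finset.card_le_card h3).trans Finset.card_le_two

lemma of_cyclicb {t t' : Pt → Pt} {r : Pt → Pt → Bool} {q c : (Pt → Pt) → Bool}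
    (h : cyclicb t t' r q c = true) (hm : 3 ≤ m) (Φ : Br m →* Equiv.Perm Pt) (ht : Φ (δ m) = t)
    (ht' : ∀ x, t (t' x) = x) (hr : ∀ x, r x (Φ (s m 0) x) = true)
    (hne : Φ (s m 0) ≠ Φ (s m 1))
    (hq : q (Φ (s m 0 * δ m)) = true) (h1 : Φ (s m 0 * δ m) ≠ 1) : c (Φ (s m 0)) = true := by
  have ht'' : t' = ⇑(Φ (δ m)).symm := by
    funext x
    rw [Equiv.eq_symm_apply, ht, ht']
  have h2 := of_allPerm h (Φ (s m 0)) hr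
  rw [ht'', ← ht] at h2
  have e : ∀ k, k + 1 < m → (fun x => Φ (δ m) (Φ (s m k) ((Φ (δ m)).symm x))) =
      Φ (s m (k + 1)) := fun k hk => by
    rw [map_s_succ Φ hk]; rfl
  have e' : (fun x => Φ (s m 0) (Φ (δ m) x)) = Φ (s m 0 * δ m) := by
    rw [map_mul]; rfl
  have e1 : (fun x : Pt => x) = ⇑(1 : Equiv.Perm Pt) := rfl
  rw [force_eq, e 0 (by omega), force_eq, e 1 (by omega), force_eq, force_eq, e', e1] at h2
  have hb : braidb (Φ (s m 0)) (Φ (s m (0 + 1))) = true := by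
    rw [braidb_iff, ← map_mul, ← map_mul, s_braid (by omega), map_mul, map_mul]
  have hc : commb (Φ (s m 0)) (Φ (s m (1 + 1))) = true := by
    rw [commb_iff, ← map_mul, s_comm _ (by omega), map_mul]
  have h3 : eqf (Φ (s m 0)) (Φ (s m (0 + 1))) = false := by
    rw [← Bool.not_eq_true, eqf_iff']; exact hne
  have h4 : eqf (Φ (s m 0 * δ m)) (1 : Equiv.Perm Pt) = false := by
    rw [← Bool.not_eq_true, eqf_iff']; exact h1
  rw [hb, hc, h3, hq, h4] at h2
  simpa using h2

/-- Four points. -/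
def emb₄ : Fin 4 ↪ Pt := ⟨![a, b, c, d], by intro i j; fin_cases i <;> fin_cases j <;> simp⟩

/-- Five points. -/
def emb₅ : Fin 5 ↪ Pt := ⟨![a, b, c, d, e], by intro i j; fin_cases i <;> fin_cases j <;> simp⟩

/-- Six points. -/
def emb₆ : Fin 6 ↪ Pt := ⟨![a, b, c, d, e, f], by intro i j; fin_cases i <;> fin_cases j <;> simp⟩

lemma isSwap_five (φ : Br 4 →* Equiv.Perm (Fin 5)) (hδ : φ (δ 4) = permF 4 (δ 4))
    (h : φ (s 4 0 * δ 4) ^ 4 = 1) (h' : φ (s 4 0 * δ 4) ≠ 1) (hne : φ (s 4 0) ≠ φ (s 4 1)) :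
    (φ (s 4 0)).IsSwap := by
  have hinj := Equiv.Perm.viaEmbeddingHom_injective emb₅
  let Φ := (Equiv.Perm.viaEmbeddingHom emb₅).comp φ
  have hf : ∀ g, Φ g f = f := fun g => Equiv.Perm.viaEmbedding_apply_of_notMem _ _ _ (by
    rintro ⟨i, hi⟩; fin_cases i <;> cases hi)
  have ht : Φ (δ 4) = rot₅ := by
    have h1 : ∀ i, Φ (δ 4) (emb₅ i) = emb₅ (finRotate 5 i) := fun i => by
      rw [← permF_δ, ← hδ]; exact Equiv.Perm.viaEmbedding_apply _ _ _
    funext x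
    cases x
    exacts [h1 0, h1 1, h1 2, h1 3, h1 4, hf _]
  refine isSwap_of_swapb (ι := emb₅) ?_ (of_cyclicb checkRot₅ (by norm_num) Φ ht ?_ ?_ ?_ ?_ ?_)
  · rintro h0
    exact hne (by rw [map_s_succ φ (k := 0) (by omega), h0]; simp)
  · intro x; cases x <;> rfl
  · intro x
    cases x <;> first | rfl | (rw [hf]; rfl)
  · exact fun h0 => hne (hinj h0)
  · rw [eqf_iff]
    have := congrArg (Equiv.Perm.viaEmbeddingHom emb₅) h
    rw [map_pow, map_one] at this
    exact congrArg (fun p : Equiv.Perm Pt => (p : Pt → Pt)) this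
  · exact fun h0 => h' (hinj (by rw [map_one]; exact h0))

lemma isSwap_six (φ : Br 5 →* Equiv.Perm (Fin 6)) (hδ : φ (δ 5) = permF 5 (δ 5))
    (h : φ (s 5 0 * δ 5) ^ 5 = 1) (h' : φ (s 5 0 * δ 5) ≠ 1) (hne : φ (s 5 0) ≠ φ (s 5 1)) :
    (φ (s 5 0)).IsSwap := by
  have hinj := Equiv.Perm.viaEmbeddingHom_injective emb₆
  let Φ := (Equiv.Perm.viaEmbeddingHom emb₆).comp φ
  have ht : Φ (δ 5) = rot₆ := by
    have h1 : ∀ i, Φ (δ 5) (emb₆ i) = emb₆ (finRotate 6 i) := fun i => by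
      rw [← permF_δ, ← hδ]; exact Equiv.Perm.viaEmbedding_apply _ _ _
    funext x
    cases x
    exacts [h1 0, h1 1, h1 2, h1 3, h1 4, h1 5]
  refine isSwap_of_swapb (ι := emb₆) ?_ (of_cyclicb checkRot₆ (by norm_num) Φ ht ?_ ?_ ?_ ?_ ?_)
  · rintro h0
    exact hne (by rw [map_s_succ φ (k := 0) (by omega), h0]; simp)
  · intro x; cases x <;> rfl
  · intro x; rfl
  · exact fun h0 => hne (hinj h0)
  · rw [eqf_iff]
    have := congrArg (Equiv.Perm.viaEmbeddingHom emb₆) h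
    rw [map_pow, map_one] at this
    exact congrArg (fun p : Equiv.Perm Pt => (p : Pt → Pt)) this
  · exact fun h0 => h' (hinj (by rw [map_one]; exact h0))

lemma eq_conj_four (φ : Br 3 →* Equiv.Perm (Fin 4)) (hδ : φ (δ 3) = permF 3 (δ 3))
    (h : φ (s 3 0 * δ 3) ^ 3 = 1) (h' : φ (s 3 0 * δ 3) ≠ 1) (hne : φ (s 3 0) ≠ φ (s 3 1)) :
    ∃ k, φ (s 3 0) = permF 3 (δ 3 ^ k * s 3 0 * (δ 3 ^ k)⁻¹) ∨
      φ (s 3 0) = permF 3 (δ 3 ^ k * (δ 3 ^ 2 * s 3 0) * (δ 3 ^ k)⁻¹) := by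
  have hinj := Equiv.Perm.viaEmbeddingHom_injective emb₄
  let V := Equiv.Perm.viaEmbeddingHom emb₄
  let Φ := V.comp φ
  have hVe : ∀ g, V g e = e := fun g => Equiv.Perm.viaEmbedding_apply_of_notMem _ _ _ (by
    rintro ⟨i, hi⟩; fin_cases i <;> cases hi)
  have hVf : ∀ g, V g f = f := fun g => Equiv.Perm.viaEmbedding_apply_of_notMem _ _ _ (by
    rintro ⟨i, hi⟩; fin_cases i <;> cases hi)
  have hV : ∀ g i, V g (emb₄ i) = emb₄ (g i) := fun g i => Equiv.Perm.viaEmbedding_apply _ _ _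
  have ht : Φ (δ 3) = rot₄ := by
    have h1 : ∀ i, Φ (δ 3) (emb₄ i) = emb₄ (finRotate 4 i) := fun i => by
      rw [← permF_δ, ← hδ]; exact hV _ _
    funext x
    cases x
    exacts [h1 0, h1 1, h1 2, h1 3, hVe _, hVf _]
  have ht' : ∀ x, rot₄ (tab d a b c e f x) = x := by intro x; cases x <;> rfl
  have hs : permF 3 (s 3 0) = Equiv.swap 0 1 := permF_s (m := 3) 0
  have hA : ⇑(V (permF 3 (s 3 0))) = tab b a c d e f := by
    have h1 := hV (permF 3 (s 3 0))
    rw [hs] at h1 ⊢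
    funext x
    cases x
    exacts [h1 0, h1 1, h1 2, h1 3, hVe _, hVf _]
  have hB : ⇑(V (permF 3 (δ 3 ^ 2 * s 3 0))) = tab d c a b e f := by
    have h1 := hV (permF 3 (δ 3 ^ 2 * s 3 0))
    rw [map_mul, map_pow, hs, permF_δ] at h1 ⊢
    funext x
    cases x
    exacts [h1 0, h1 1, h1 2, h1 3, hVe _, hVf _]
  have key := of_cyclicb checkRot₄ le_rfl Φ ht ht' ?_ ?_ ?_ ?_
  · have ht'' : tab d a b c e f = ⇑(Φ (δ 3)).symm := by
      funext x
      rw [Equiv.eq_symm_apply, ht, ht']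
    have hany : ∀ w : Br 3, any₄ (V (permF 3 w)) (Φ (s 3 0)) = true →
        ∃ k, φ (s 3 0) = permF 3 (δ 3 ^ k * w * (δ 3 ^ k)⁻¹) := by
      intro w hw
      have e : ∀ w : Br 3, (fun x => Φ (δ 3) (V (permF 3 w) ((Φ (δ 3)).symm x))) =
          V (permF 3 (δ 3 * w * (δ 3)⁻¹)) := fun w => by
        rw [map_mul, map_mul, map_inv, map_mul, map_mul, map_inv, ← hδ]; rfl
      rw [any₄, ht'', ← ht, e, force_eq, e, force_eq, e, force_eq] at hw
      simp only [Bool.or_eq_true, eqf_iff'] at hw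
      rcases hw with hw | hw | hw | hw
      · exact ⟨0, by simpa using hinj hw⟩
      · exact ⟨1, by simpa using hinj hw⟩
      · exact ⟨2, (hinj hw).trans (congrArg _ (by simp [pow_succ, mul_assoc]))⟩
      · exact ⟨3, (hinj hw).trans (congrArg _ (by simp [pow_succ, mul_assoc]))⟩
    rw [Bool.or_eq_true, ← hA, ← hB] at key
    rcases key with key | key
    · exact (hany _ key).imp fun k hk => Or.inl hk
    · exact (hany _ key).imp fun k hk => Or.inr hk
  · intro x
    have h1 : Φ (s 3 0) e = e := hVe _
    have h2 : Φ (s 3 0) f = f := hVf _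
    cases x <;> first | rfl | (rw [h1]; rfl) | (rw [h2]; rfl)
  · exact fun h0 => hne (hinj h0)
  · rw [eqf_iff]
    have := congrArg (Equiv.Perm.viaEmbeddingHom emb₄) h
    rw [map_pow, map_one] at this
    exact congrArg (fun p : Equiv.Perm Pt => (p : Pt → Pt)) this
  · exact fun h0 => h' (hinj (by rw [map_one]; exact h0))

end cyclic

end BraidCoHopf

namespace BraidCoHopf

variable {m : ℕ}

/-! ### Chains of transpositions -/

section chain

variable {α : Type*} [DecidableEq α]

lemma swap_ne_of_commute {a b c d : α} (hab : a ≠ b) (hcd : c ≠ d)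
    (h : Commute (Equiv.swap a b) (Equiv.swap c d)) (hne : Equiv.swap a b ≠ Equiv.swap c d) :
    (c ≠ a ∧ c ≠ b) ∧ d ≠ a ∧ d ≠ b := by
  have key : ∀ {a b d : α}, a ≠ b → a ≠ d → Commute (Equiv.swap a b) (Equiv.swap a d) →
      b = d := by
    intro a b d hab had h
    by_contra hbd
    have := DFunLike.congr_fun h.eq b
    rw [Equiv.Perm.mul_apply, Equiv.Perm.mul_apply, Equiv.swap_apply_right,
      Equiv.swap_apply_of_ne_of_ne hab.symm hbd, Equiv.swap_apply_right, Equiv.swap_apply_left]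
      at this
    exact had this
  refine ⟨⟨?_, ?_⟩, ?_, ?_⟩ <;> rintro rfl
  · exact hne (by rw [key hab hcd h])
  · rw [Equiv.swap_comm a] at h hne
    exact hne (by rw [key hab.symm hcd h])
  · rw [Equiv.swap_comm c] at h hne
    exact hne (by rw [key hab hcd.symm h])
  · rw [Equiv.swap_comm a, Equiv.swap_comm c] at h hne
    exact hne (by rw [key hab.symm hcd.symm h])

lemma eq_or_eq_of_not_commute {a b c d : α} (hab : a ≠ b) (hcd : c ≠ d)
    (h : ¬ Commute (Equiv.swap a b) (Equiv.swap c d)) : (c = a ∨ c = b) ∨ d = a ∨ d = b := by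
  by_contra! hc
  refine h (Equiv.Perm.disjoint_swap_swap ?_).commute
  simp only [List.nodup_cons, List.mem_cons, List.not_mem_nil, or_false, not_or,
    List.nodup_nil, not_false_eq_true, and_true]
  exact ⟨⟨hab, hc.1.1.symm, hc.2.1.symm⟩, ⟨hc.1.2.symm, hc.2.2.symm⟩, hcd⟩

/-- Consecutively noncommuting and otherwise commuting distinct transpositions form a chain. -/
lemma exists_chain {p : ℕ → Equiv.Perm α} (hp : ∀ i < m, (p i).IsSwap)
    (hadj : ∀ i, i + 1 < m → ¬ Commute (p i) (p (i + 1)))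
    (hfar : ∀ i j, i + 2 ≤ j → j < m → Commute (p i) (p j) ∧ p i ≠ p j) {k : ℕ} (h2 : 2 ≤ k)
    (hk : k ≤ m) : ∃ v : ℕ → α, (∀ i < k, p i = Equiv.swap (v i) (v (i + 1))) ∧
      ∀ i j, i < j → j ≤ k → v i ≠ v j := by
  induction k, h2 using Nat.le_induction with
  | base =>
    obtain ⟨a, b, hab, h0⟩ := hp 0 (by omega)
    obtain ⟨c, d, hcd, h1⟩ := hp 1 (by omega)
    have hc := hadj 0 (by omega)
    obtain ⟨u, w, z, h0, h1, huw, hwz⟩ : ∃ u w z, p 0 = Equiv.swap u w ∧ p 1 = Equiv.swap w z ∧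
        u ≠ w ∧ w ≠ z := by
      have := eq_or_eq_of_not_commute hab hcd (by rw [← h0, ← h1]; exact hc)
      rcases this with (rfl | rfl) | rfl | rfl
      · exact ⟨b, c, d, by rw [h0, Equiv.swap_comm], h1, hab.symm, hcd⟩
      · exact ⟨a, c, d, h0, h1, hab, hcd⟩
      · exact ⟨b, d, c, by rw [h0, Equiv.swap_comm], by rw [h1, Equiv.swap_comm], hab.symm,
          hcd.symm⟩
      · exact ⟨a, d, c, h0, by rw [h1, Equiv.swap_comm], hab, hcd.symm⟩
    have huz : u ≠ z := by
      rintro rfl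
      refine hc ?_
      rw [h0, zero_add, h1, Equiv.swap_comm]
    refine ⟨fun i => if i = 0 then u else if i = 1 then w else z, fun i hi => ?_,
      fun i j hij hj => ?_⟩
    · obtain rfl | rfl : i = 0 ∨ i = 1 := by omega
      · simpa using h0
      · simpa using h1
    · obtain ⟨rfl, rfl⟩ | ⟨rfl, rfl⟩ | ⟨rfl, rfl⟩ : (i = 0 ∧ j = 1) ∨ (i = 0 ∧ j = 2) ∨
        (i = 1 ∧ j = 2) := by omega
      · simpa using huw
      · simpa using huz
      · simpa using hwz
  | succ k h2 ih =>
    obtain ⟨v, hv, hinj⟩ := ih (by omega)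
    obtain ⟨c, d, hcd, h1⟩ := hp k (by omega)
    have hfar' : ∀ i, i + 2 ≤ k → (c ≠ v i ∧ c ≠ v (i + 1)) ∧ d ≠ v i ∧ d ≠ v (i + 1) :=
      fun i hi => by
        obtain ⟨h3, h4⟩ := hfar i k hi (by omega)
        rw [hv i (by omega), h1] at h3 h4
        exact swap_ne_of_commute (hinj _ _ (by omega) (by omega)) hcd h3 h4
    have hc : c = v k ∨ d = v k := by
      obtain ⟨l, rfl⟩ : ∃ l, k = l + 2 := ⟨k - 2, by omega⟩
      have h3 := hadj (l + 1) (by omega)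
      rw [hv (l + 1) (by omega), h1] at h3
      have h4 := hfar' l (by omega)
      rcases eq_or_eq_of_not_commute (hinj _ _ (by omega) (by omega)) hcd h3 with
        (h | h) | h | h
      · exact absurd h h4.1.2
      · exact Or.inl h
      · exact absurd h h4.2.2
      · exact Or.inr h
    obtain ⟨w, h5, h6, h7⟩ : ∃ w, p k = Equiv.swap (v k) w ∧ v k ≠ w ∧
        ∀ i, i + 2 ≤ k → w ≠ v i ∧ w ≠ v (i + 1) := by
      rcases hc with rfl | rfl
      · exact ⟨d, h1, hcd, fun i hi => (hfar' i hi).2⟩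
      · exact ⟨c, by rw [h1, Equiv.swap_comm], hcd.symm, fun i hi => (hfar' i hi).1⟩
    refine ⟨fun i => if i ≤ k then v i else w, fun i hi => ?_, fun i j hij hj => ?_⟩
    · rcases Nat.lt_or_ge i k with h | h
      · simp only [if_pos h.le, if_pos (show i + 1 ≤ k from h)]
        exact hv i h
      · obtain rfl : i = k := by omega
        simpa using h5
    · simp only [if_pos (show i ≤ k by omega)]
      split_ifs with h
      · exact hinj i j hij h
      · rcases Nat.lt_or_ge i k with h8 | h8
        · rcases Nat.lt_or_ge (i + 1) k with h9 | h9
          · exact (h7 i (by omega)).1.symm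
          · obtain ⟨l, rfl⟩ : ∃ l, i = l + 1 := ⟨i - 1, by omega⟩
            exact (h7 l (by omega)).2.symm
        · obtain rfl : i = k := by omega
          exact h6

end chain

/-- A noncyclic action by transpositions is the standard one. -/
lemma exists_perm_of_isSwap (hm : 4 ≤ m) (φ : Br m →* Equiv.Perm (Fin (m + 1)))
    (h : (φ (s m 0)).IsSwap) (hne : φ (s m 0) ≠ φ (s m 1)) :
    ∃ τ, ∀ g, φ g = τ * permF m g * τ⁻¹ := by
  have hadj : ∀ i, i + 1 < m → ¬ Commute (φ (s m i)) (φ (s m (i + 1))) := fun i hi hc =>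
    hne (map_s_zero_eq_of_commute hi hc.eq)
  have hfar : ∀ i j, i + 2 ≤ j → j < m → Commute (φ (s m i)) (φ (s m j)) ∧
      φ (s m i) ≠ φ (s m j) := fun i j hij hj => by
    refine ⟨Commute.map (s_comm _ hij) φ, fun he => ?_⟩
    rcases Nat.lt_or_ge (i + 2) j with h1 | h1
    · exact hadj i (by omega) (by rw [he]; exact (Commute.map (s_comm _ (by omega)) φ).symm)
    · obtain rfl : j = i + 2 := by omega
      rcases Nat.lt_or_ge (i + 3) m with h2 | h2
      · exact hadj (i + 2) h2 (by rw [← he]; exact (Commute.map (s_comm _ (by omega)) φ))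
      · obtain ⟨l, rfl⟩ : ∃ l, i = l + 1 := ⟨i - 1, by omega⟩
        exact hadj l (by omega) (by rw [he]; exact (Commute.map (s_comm _ (by omega)) φ))
  have hswap : ∀ i < m, (φ (s m i)).IsSwap := fun i hi => by
    obtain ⟨a, b, hab, h⟩ := h
    rw [map_s_eq_conj φ hi, h, ← Equiv.swap_apply_apply]
    exact ⟨_, _, fun he => hab (Equiv.injective _ he), rfl⟩
  obtain ⟨v, hv, hinj⟩ := exists_chain (p := fun i => φ (s m i)) hswap hadj hfar
    (show 2 ≤ m by omega) le_rfl
  let τ : Equiv.Perm (Fin (m + 1)) := Equiv.ofBijective (fun i => v i)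
    (Finite.injective_iff_bijective.mp fun i j hij => by
      rcases lt_trichotomy (i : ℕ) j with hl | hl | hl
      · exact absurd hij (hinj _ _ hl (by omega))
      · exact Fin.ext hl
      · exact absurd hij.symm (hinj _ _ hl (by omega)))
  refine ⟨τ, fun g => ?_⟩
  have : φ = (MulAut.conj τ).toMonoidHom.comp (permF m) := hom_ext fun i hi => by
    rw [MonoidHom.comp_apply, permF_s ⟨i, hi⟩]
    refine (hv i hi).trans ?_
    exact Equiv.swap_apply_apply τ (Fin.castSucc ⟨i, hi⟩) (Fin.succ ⟨i, hi⟩)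
  rw [this]; rfl

/-- A permutation with a full orbit of size `m + 1` is conjugate to the standard rotation. -/
lemma exists_conj_permF_δ {t : Equiv.Perm (Fin (m + 1))} (ht : t ^ (m + 1) = 1) {p : Fin (m + 1)}
    (hp : ∀ k, 0 < k → k ≤ m → (t ^ k) p ≠ p) : ∃ τ, t = τ * permF m (δ m) * τ⁻¹ := by
  have hinj : ∀ i j, i < j → j ≤ m → (t ^ i) p ≠ (t ^ j) p := fun i j hij hj he => by
    refine hp (j - i) (by omega) (by omega) ((t ^ i).injective ?_)
    rw [← Equiv.Perm.mul_apply, ← pow_add, show i + (j - i) = j by omega, he]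
  let τ : Equiv.Perm (Fin (m + 1)) := Equiv.ofBijective (fun i => (t ^ (i : ℕ)) p)
    (Finite.injective_iff_bijective.mp fun i j hij => by
      rcases lt_trichotomy (i : ℕ) j with hl | hl | hl
      · exact absurd hij (hinj _ _ hl (by omega))
      · exact Fin.ext hl
      · exact absurd hij.symm (hinj _ _ hl (by omega)))
  refine ⟨τ, eq_mul_inv_of_mul_eq ?_⟩
  rw [permF_δ]
  ext1 ⟨i, hi⟩
  show t ((t ^ i) p) = (t ^ (finRotate (m + 1) ⟨i, hi⟩ : ℕ)) p
  rw [← Equiv.Perm.mul_apply, ← pow_succ']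
  rcases Nat.lt_or_ge i m with h | h
  · rw [finRotate_of_lt h]
  · obtain rfl : i = m := by omega
    rw [finRotate_last', ht]; rfl

end BraidCoHopf

namespace BraidCoHopf

variable {m : ℕ}

/-! ### Endomorphisms reflecting the center -/

lemma mem_center_of_pow (hm : 2 ≤ m) {u : Br m} (hu : perm m u = 1) {k : ℕ} (hk : k ≠ 0)
    (h : u ^ k ∈ Subgroup.center (Br m)) : u ∈ Subgroup.center (Br m) := by
  rw [center_eq hm] at h ⊢
  exact mem_zpowers_of_pow (by omega) hu hk h

section endo

variable (hm : 2 ≤ m) (R : Br m →* Br m)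
  (hR : ∀ g, R g ∈ Subgroup.center (Br m) ↔ g ∈ Subgroup.center (Br m))

include hm hR

lemma permF_map_ne_one {w : Br m} {k : ℕ} (hk : k ≠ 0) (hw : w ^ k ∈ Subgroup.center (Br m))
    (hne : perm m w ≠ 1) : permF m (R w) ≠ 1 := fun h => hne <|
  perm_eq_one_of_mem_center hm <| (hR w).mp <| mem_center_of_pow hm (permF_eq_one_iff.mp h) hk <| by
    rw [← map_pow]
    exact (hR _).mpr hw

lemma permF_map_eq_one {w : Br m} (hw : w ∈ Subgroup.center (Br m)) : permF m (R w) = 1 :=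
  permF_eq_one_iff.mpr (perm_eq_one_of_mem_center hm ((hR w).mpr hw))

lemma permF_map_δ_pow_ne_one {k : ℕ} (h0 : 0 < k) (hk : k ≤ m) : permF m (R (δ m)) ^ k ≠ 1 := by
  have h1 : ∀ k ≤ m, (perm m (δ m) ^ k) 0 = k := by
    intro k
    induction k with
    | zero => intro _; rfl
    | succ k ih =>
      intro hk
      rw [pow_succ', Equiv.Perm.mul_apply, ih (by omega), (perm_δ (by omega)).1]
  rw [← map_pow, ← map_pow]
  refine permF_map_ne_one hm R hR (k := m + 1) (by omega) ?_ fun h => ?_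
  · rw [← pow_mul, mul_comm, pow_mul]
    exact pow_mem (δ_pow_mem_center m) k
  · have := h1 k hk
    rw [← map_pow, h] at this
    simp at this
    omega

lemma permF_map_δ_pow : permF m (R (δ m)) ^ (m + 1) = 1 := by
  rw [← map_pow, ← map_pow]
  exact permF_map_eq_one hm R hR (δ_pow_mem_center m)

lemma permF_map_s_zero_mul_δ_pow : permF m (R (s m 0 * δ m)) ^ m = 1 := by
  rw [← map_pow, ← map_pow, s_zero_mul_δ_pow_self]
  exact permF_map_eq_one hm R hR (δ_pow_mem_center m)

lemma permF_map_s_zero_mul_δ_ne : permF m (R (s m 0 * δ m)) ≠ 1 := by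
  refine permF_map_ne_one hm R hR (k := m) (by omega) ?_ fun h => ?_
  · rw [s_zero_mul_δ_pow_self]; exact δ_pow_mem_center m
  · have := DFunLike.congr_fun h 1
    rw [map_mul, Equiv.Perm.mul_apply, (perm_δ (by omega)).1, perm_s (by omega),
      Equiv.swap_apply_of_ne_of_ne (by omega) (by omega)] at this
    simp at this

omit hR in
/-- A square root of a central braid whose permutation is a nontrivial involution fixes at most
one strand. -/
lemma eq_of_perm_fixed {u : Br m} (hu : u ^ 2 ∈ Subgroup.center (Br m)) {a c d : ℕ}
    (ha : perm m u a ≠ a) (hc : perm m u c = c) (hd : perm m u d = d) (hcm : c ≤ m) (hdm : d ≤ m) :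
    c = d := by
  by_contra hcd
  have hp := perm_eq_one_of_mem_center hm hu
  rw [center_eq hm] at hu
  obtain ⟨k, hk⟩ := hu
  simp only at hk
  have ham : a ≤ m := by
    by_contra! h
    exact ha (perm_apply_of_lt u h)
  have hL : ∀ a b, a ≤ m → b ≤ m → a ≠ b →
      lk m u (perm m u a) (perm m u b) + lk m u a b = k * 2 := fun a b ha hb hab => by
    rw [← lk_zz ha hb hab, ← lk_zpow_pure (perm_zz m), hk, pow_two, lk_mul]
  have h1 := hL _ _ ham (perm_apply_le u ham) (Ne.symm ha)
  have h2 := hL _ _ hcm hdm hcd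
  have h3 : perm m u (perm m u a) = a := by
    rw [← Equiv.Perm.mul_apply, ← map_mul, ← pow_two, hp]; rfl
  rw [h3, lk_comm] at h1
  rw [hc, hd] at h2
  have h4 := even_lk_iff u (Ne.symm ha)
  have h5 := even_lk_iff u hcd
  rw [h3] at h4
  rw [hc, hd] at h5
  have h6 : Even (lk m u c d) := h5.mpr Iff.rfl
  rw [show lk m u c d = lk m u a (perm m u a) by omega, h4] at h6
  rcases lt_or_gt_of_ne ha with h | h <;> omega

end endo

lemma pow_gcd_apply {α : Type*} {t : Equiv.Perm α} {p : α} {k n : ℕ} (hk : (t ^ k) p = p)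
    (hn : t ^ n = 1) : (t ^ (k.gcd n)) p = p := by
  rw [← Equiv.Perm.iterate_eq_pow]
  refine Function.IsPeriodicPt.gcd (f := t) ?_ ?_
  · rw [Function.IsPeriodicPt, Function.IsFixedPt, Equiv.Perm.iterate_eq_pow, hk]
  · rw [Function.IsPeriodicPt, Function.IsFixedPt, Equiv.Perm.iterate_eq_pow, hn]; rfl

lemma exists_apply_ne_of_ne_one {α : Type*} {t : Equiv.Perm α} (h : t ≠ 1) : ∃ p, t p ≠ p := by
  by_contra! hc
  exact h (Equiv.ext hc)

/-- In degree at most six, the image of `δ` acts as a full cycle. -/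
lemma exists_conj_map_δ (hm : m = 3 ∨ m = 4 ∨ m = 5) (R : Br m →* Br m)
    (hR : ∀ g, R g ∈ Subgroup.center (Br m) ↔ g ∈ Subgroup.center (Br m)) :
    ∃ τ, permF m (R (δ m)) = τ * permF m (δ m) * τ⁻¹ := by
  have hm' : 2 ≤ m := by omega
  have h1 := permF_map_δ_pow hm' R hR
  have h2 := fun k => permF_map_δ_pow_ne_one hm' R hR (k := k)
  obtain rfl | rfl | rfl := hm
  · obtain ⟨p, hp⟩ := exists_apply_ne_of_ne_one (h2 2 (by norm_num) (by norm_num))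
    refine exists_conj_permF_δ h1 (p := p) fun k h0 hk h => hp ?_
    have h := pow_gcd_apply h h1
    interval_cases k
    · rw [pow_two, Equiv.Perm.mul_apply]
      norm_num at h; rw [h, h]
    · exact h
    · rw [pow_two, Equiv.Perm.mul_apply]
      norm_num at h; rw [h, h]
  · obtain ⟨p, hp⟩ := exists_apply_ne_of_ne_one (h2 1 (by norm_num) (by norm_num))
    refine exists_conj_permF_δ h1 (p := p) fun k h0 hk h => hp ?_
    have h := pow_gcd_apply h h1
    interval_cases k <;> exact h
  · obtain ⟨p, hp⟩ := exists_apply_ne_of_ne_one (h2 2 (by norm_num) (by norm_num))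
    have h3 : ∀ p, (permF 5 (R (δ 5)) ^ 3) p ≠ p := by
      intro p hp
      have hu : R (δ 5 ^ 3) ^ 2 ∈ Subgroup.center (Br 5) := by
        rw [← map_pow, hR, ← pow_mul]
        exact δ_pow_mem_center 5
      obtain ⟨a, ha⟩ := exists_apply_ne_of_ne_one (h2 3 (by norm_num) (by norm_num))
      rw [← map_pow, ← map_pow] at hp ha
      have hfix : ∀ q, permF 5 (R (δ 5 ^ 3)) q = q → q = p := fun q hq =>
        Fin.ext (eq_of_perm_fixed hm' hu (a := a) (fun h => ha (Fin.ext h))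
          (congrArg Fin.val hq) (congrArg Fin.val hp) (by omega) (by omega))
      have hc := Equiv.Perm.card_fixedPoints_modEq (p := 2) (n := 1)
        (f := (⇑(permF 5 (R (δ 5 ^ 3))) : Fin 6 → Fin 6)) (by
          funext q
          have h5 : permF 5 (R (δ 5 ^ 3)) ^ 2 = 1 := by
            rw [← map_pow]
            exact permF_eq_one_iff.mpr (perm_eq_one_of_mem_center hm' hu)
          exact DFunLike.congr_fun h5 q)
      have hone : Fintype.card (Function.fixedPoints (⇑(permF 5 (R (δ 5 ^ 3))))) = 1 :=
        Fintype.card_eq_one_iff.mpr ⟨⟨p, hp⟩, fun q => Subtype.ext (hfix _ q.2)⟩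
      simp only [hone, Fintype.card_fin] at hc
      exact absurd hc (by decide)
    refine exists_conj_permF_δ h1 (p := p) fun k h0 hk h => ?_
    have h := pow_gcd_apply h h1
    have h6 : (permF 5 (R (δ 5)) ^ 1) p = p → (permF 5 (R (δ 5)) ^ 3) p = p := fun h => by
      rw [pow_one] at h
      rw [pow_succ, pow_two, Equiv.Perm.mul_apply, Equiv.Perm.mul_apply, h, h, h]
    interval_cases k
    · exact h3 p (h6 h)
    · exact hp h
    · exact h3 p h
    · exact hp h
    · exact h3 p (h6 h)

/-- The action on `m + 1 ≥ 5` strands of an endomorphism reflecting the center is standard. -/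
theorem exists_perm_map (hm : 4 ≤ m) (R : Br m →* Br m)
    (hR : ∀ g, R g ∈ Subgroup.center (Br m) ↔ g ∈ Subgroup.center (Br m)) :
    ∃ b : Br m, ∀ g, perm m (R g) = perm m (b * g * b⁻¹) := by
  have hne := perm_map_ne hm R fun g => (hR g).mp
  have hm' : 2 ≤ m := by omega
  have hswap : (permF m (R (s m 0))).IsSwap := by
    rcases Nat.lt_or_ge m 6 with h6 | h6
    · obtain ⟨τ, hτ⟩ := exists_conj_map_δ (by omega) R hR
      let φ : Br m →* Equiv.Perm (Fin (m + 1)) :=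
        (MulAut.conj τ⁻¹).toMonoidHom.comp ((permF m).comp R)
      have hφ : ∀ g, φ g = τ⁻¹ * permF m (R g) * τ := fun g => by
        show τ⁻¹ * permF m (R g) * τ⁻¹⁻¹ = _
        rw [inv_inv]
      have h1 : φ (δ m) = permF m (δ m) := by rw [hφ, hτ]; group
      have h2 : φ (s m 0 * δ m) ^ m = 1 := by
        show (MulAut.conj τ⁻¹).toMonoidHom _ ^ m = 1
        rw [← map_pow, MonoidHom.comp_apply, permF_map_s_zero_mul_δ_pow hm' R hR, map_one]
      have h3 : φ (s m 0 * δ m) ≠ 1 := fun h => permF_map_s_zero_mul_δ_ne hm' R hR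
        ((MulAut.conj τ⁻¹).injective (h.trans (map_one _).symm))
      have h4 : φ (s m 0) ≠ φ (s m 1) := fun h => hne ((MulAut.conj τ⁻¹).injective h)
      have h5 : (φ (s m 0)).IsSwap := by
        obtain rfl | rfl : m = 4 ∨ m = 5 := by omega
        · exact isSwap_five φ h1 h2 h3 h4
        · exact isSwap_six φ h1 h2 h3 h4
      obtain ⟨a, b, hab, h⟩ := h5
      refine ⟨τ a, τ b, fun he => hab (τ.injective he), ?_⟩
      rw [Equiv.swap_apply_apply, ← h, hφ]; group
    · exact isSwap_of_noncyclic h6 ((permF m).comp R) (Fintype.card_fin _) hne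
  obtain ⟨τ, hτ⟩ := exists_perm_of_isSwap hm ((permF m).comp R) hswap hne
  obtain ⟨b, rfl⟩ := permF_surjective m τ
  refine ⟨b, fun g => permF_eq_iff.mp ?_⟩
  rw [map_mul, map_mul, map_inv]
  exact hτ g

lemma pow_eq_one_of_fin_four (c : Equiv.Perm (Fin 4)) : c ^ 4 = 1 ∨ c ^ 6 = 1 := by
  revert c
  decide +kernel

/-- The action on four strands of an endomorphism reflecting the center is standard or is
the exceptional one. -/
theorem exists_perm_map_three (R : Br 3 →* Br 3)
    (hR : ∀ g, R g ∈ Subgroup.center (Br 3) ↔ g ∈ Subgroup.center (Br 3)) :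
    ∃ b : Br 3, perm 3 (R (δ 3)) = perm 3 (b * δ 3 * b⁻¹) ∧
      (perm 3 (R (s 3 0)) = perm 3 (b * s 3 0 * b⁻¹) ∨
        perm 3 (R (s 3 0)) = perm 3 (b * (δ 3 ^ 2 * s 3 0) * b⁻¹)) := by
  obtain ⟨τ, hτ⟩ := exists_conj_map_δ (by omega) R hR
  obtain ⟨b, rfl⟩ := permF_surjective 3 τ
  let φ : Br 3 →* Equiv.Perm (Fin 4) :=
    (permF 3).comp ((MulAut.conj b⁻¹).toMonoidHom.comp R)
  have hφ : ∀ g, φ g = permF 3 (b⁻¹ * R g * b) := fun g => by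
    show permF 3 (b⁻¹ * R g * b⁻¹⁻¹) = _
    rw [inv_inv]
  have hφ1 : ∀ g, permF 3 (R g) = 1 ↔ φ g = 1 := fun g => by
    rw [hφ, map_mul, map_mul, map_inv, mul_assoc, inv_mul_eq_one, right_eq_mul]
  have h1 : φ (δ 3) = permF 3 (δ 3) := by rw [hφ, map_mul, map_mul, hτ, map_inv]; group
  have h2 : φ (s 3 0 * δ 3) ^ 3 = 1 := by
    rw [← map_pow, ← hφ1, map_pow, map_pow]
    exact permF_map_s_zero_mul_δ_pow le_add_self R hR
  have h3 : φ (s 3 0 * δ 3) ≠ 1 := fun h =>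
    permF_map_s_zero_mul_δ_ne le_add_self R hR ((hφ1 _).mpr h)
  have h4 : φ (s 3 0) ≠ φ (s 3 1) := fun h => by
    have e : φ (δ 3) = φ (s 3 0) ^ 3 := by
      have : δ 3 = s 3 0 * s 3 1 * s 3 2 := by simp [δ, dl]
      rw [this, map_mul, map_mul, map_s_eq h (i := 1) (by omega), map_s_eq h (i := 2) (by omega)]
      rfl
    rcases pow_eq_one_of_fin_four (φ (s 3 0)) with h5 | h5
    · exact h3 (by rw [map_mul, e, ← pow_succ', h5])
    · refine permF_map_δ_pow_ne_one le_add_self R hR (k := 2) (by norm_num) (by norm_num) ?_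
      rw [← map_pow, ← map_pow, hφ1, map_pow, e, ← pow_mul, h5]
  obtain ⟨k, hk⟩ := eq_conj_four φ h1 h2 h3 h4
  have key : ∀ w w', φ w = permF 3 (δ 3 ^ k * w' * (δ 3 ^ k)⁻¹) →
      perm 3 (R w) = perm 3 (b * δ 3 ^ k * w' * (b * δ 3 ^ k)⁻¹) := fun w w' h => by
    rw [← permF_eq_iff]
    rw [hφ, map_mul, map_mul, map_inv, mul_assoc, inv_mul_eq_iff_eq_mul] at h
    rw [eq_mul_inv_of_mul_eq h]
    simp only [map_mul, map_inv, mul_inv_rev, mul_assoc]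
  exact ⟨b * δ 3 ^ k, key _ _ (by rw [h1]; group), hk.imp (key _ _) (key _ _)⟩

end BraidCoHopf

namespace BraidCoHopf

open Matrix

/-! ### The affine representation of the braid group on four strands -/

/-- The action of `SL(2, ℤ)` on `ℤ²`. -/
noncomputable def slAct : SpecialLinearGroup (Fin 2) ℤ →* MulAut (Multiplicative (Fin 2 → ℤ)) :=
  MonoidHom.mk' (fun A => AddEquiv.toMultiplicative (SpecialLinearGroup.toLin' A).toAddEquiv)
    fun A B => by
      rw [map_mul]; rfl

lemma slAct_apply (A : SpecialLinearGroup (Fin 2) ℤ) (v : Multiplicative (Fin 2 → ℤ)) :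
    (slAct A v).toAdd = (A : Matrix (Fin 2) (Fin 2) ℤ) *ᵥ v.toAdd := by
  show SpecialLinearGroup.toLin' A v.toAdd = _
  rw [SpecialLinearGroup.toLin'_apply, toLin'_apply]

/-- The affine group `ℤ² ⋊ SL(2, ℤ)`. -/
abbrev Aff : Type := Multiplicative (Fin 2 → ℤ) ⋊[slAct] SpecialLinearGroup (Fin 2) ℤ

/-- The affine map with linear part `A` and translation `v`. -/
def aff (v : Fin 2 → ℤ) (A : SpecialLinearGroup (Fin 2) ℤ) : Aff := ⟨.ofAdd v, A⟩

lemma aff_mul (v w : Fin 2 → ℤ) (A B : SpecialLinearGroup (Fin 2) ℤ) :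
    aff v A * aff w B = aff (v + (A : Matrix (Fin 2) (Fin 2) ℤ) *ᵥ w) (A * B) := by
  refine SemidirectProduct.ext ?_ rfl
  show Multiplicative.ofAdd v * slAct A (.ofAdd w) = _
  exact congrArg (fun u => Multiplicative.ofAdd (v + u)) (slAct_apply A (.ofAdd w))

/-- The matrix `[1, 1; 0, 1]`. -/
def matT : SpecialLinearGroup (Fin 2) ℤ := ⟨!![1, 1; 0, 1], by simp⟩

/-- The matrix `[1, 0; -1, 1]`. -/
def matU : SpecialLinearGroup (Fin 2) ℤ := ⟨!![1, 0; -1, 1], by simp⟩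

/-- The images of the generators in the affine group. -/
def affGen : ℕ → Aff
  | 0 => aff 0 matT
  | 1 => aff 0 matU
  | _ => aff ![-1, 0] matT

lemma exists_toAff : ∃ φ : Br 3 →* Aff, ∀ i < 3, φ (s 3 i) = affGen i := by
  refine exists_lift affGen (fun i h => ?_) fun i j h hj => ?_
  · obtain rfl | rfl : i = 0 ∨ i = 1 := by omega
    all_goals
      simp only [affGen, aff_mul]
      congr 1 <;> decide +kernel
  · obtain ⟨rfl, rfl⟩ : i = 0 ∧ j = 2 := by omega
    simp only [affGen, aff_mul]
    congr 1
    decide +kernel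

noncomputable def toAff : Br 3 →* Aff := exists_toAff.choose

lemma toAff_s {i : ℕ} (h : i < 3) : toAff (s 3 i) = affGen i := exists_toAff.choose_spec i h

/-- The linear part of the affine representation. -/
noncomputable def lin : Br 3 →* SpecialLinearGroup (Fin 2) ℤ := SemidirectProduct.rightHom.comp toAff

/-- The translation part of the affine representation. -/
noncomputable def tr (g : Br 3) : Fin 2 → ℤ := (toAff g).left.toAdd

lemma lin_zero : lin (s 3 0) = matT := congrArg SemidirectProduct.right (toAff_s (by norm_num))
lemma lin_one : lin (s 3 1) = matU := congrArg SemidirectProduct.right (toAff_s (by norm_num))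
lemma lin_two : lin (s 3 2) = matT := congrArg SemidirectProduct.right (toAff_s (by norm_num))
lemma tr_zero : tr (s 3 0) = 0 := congrArg SemidirectProduct.left (toAff_s (by norm_num))
lemma tr_one : tr (s 3 1) = 0 := congrArg SemidirectProduct.left (toAff_s (by norm_num))
lemma tr_two : tr (s 3 2) = ![-1, 0] := congrArg SemidirectProduct.left (toAff_s (by norm_num))

lemma toAff_eq (g : Br 3) : toAff g = aff (tr g) (lin g) := rfl

lemma tr_mul (g h : Br 3) : tr (g * h) = tr g + (lin g : Matrix (Fin 2) (Fin 2) ℤ) *ᵥ tr h := by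
  have := map_mul toAff g h
  rw [toAff_eq, toAff_eq g, toAff_eq h, aff_mul] at this
  exact congrArg SemidirectProduct.left this

lemma tr_mul_zero (g h : Br 3) :
    tr (g * h) 0 = tr g 0 + (lin g 0 0 * tr h 0 + lin g 0 1 * tr h 1) := by
  rw [tr_mul, Pi.add_apply, mulVec, dotProduct, Fin.sum_univ_two]

lemma tr_mul_one (g h : Br 3) :
    tr (g * h) 1 = tr g 1 + (lin g 1 0 * tr h 0 + lin g 1 1 * tr h 1) := by
  rw [tr_mul, Pi.add_apply, mulVec, dotProduct, Fin.sum_univ_two]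

lemma tr_id : tr 1 = 0 := by rw [tr, map_one]; rfl

lemma tr_mul_of_lin_eq_one {g : Br 3} (h : lin g = 1) (k : Br 3) : tr (g * k) = tr g + tr k := by
  rw [tr_mul, h]
  exact congrArg (tr g + ·) (one_mulVec (tr k))

lemma tr_inv_of_lin_eq_one {g : Br 3} (h : lin g = 1) : tr g⁻¹ = - tr g := by
  have := tr_mul_of_lin_eq_one h g⁻¹
  rw [mul_inv_cancel, tr_id] at this
  exact (neg_eq_of_add_eq_zero_right this.symm).symm

lemma lin_mulVec_tr_inv (g : Br 3) : (lin g : Matrix (Fin 2) (Fin 2) ℤ) *ᵥ tr g⁻¹ = - tr g := by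
  have := tr_mul g g⁻¹
  rw [mul_inv_cancel, tr_id] at this
  exact (neg_eq_of_add_eq_zero_right this.symm).symm

lemma tr_conj {g h : Br 3} (hh : lin h = 1) :
    tr (g * h * g⁻¹) = (lin g : Matrix (Fin 2) (Fin 2) ℤ) *ᵥ tr h := by
  rw [tr_mul, tr_mul, map_mul, hh, mul_one, lin_mulVec_tr_inv]; abel

/-- The points modulo two permuted by the affine representation. -/
def pt : ℕ → Fin 2 → ℤ
  | 0 => ![0, 1]
  | 1 => ![1, 1]
  | 2 => ![1, 0]
  | _ => 0

lemma dvd_mulVec {M : Matrix (Fin 2) (Fin 2) ℤ} {v : Fin 2 → ℤ} (h : ∀ i, (2 : ℤ) ∣ v i)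
    (i : Fin 2) : (2 : ℤ) ∣ (M *ᵥ v) i := by
  rw [mulVec, dotProduct]
  exact Finset.dvd_sum fun j _ => (h j).mul_left _

lemma pt_perm (g : Br 3) : ∀ k ≤ 3, ∀ i : Fin 2,
    (2 : ℤ) ∣ (tr g + (lin g : Matrix (Fin 2) (Fin 2) ℤ) *ᵥ pt k - pt (perm 3 g k)) i := by
  let K : Subgroup (Br 3) :=
    { carrier := {g | ∀ k ≤ 3, ∀ i : Fin 2, (2 : ℤ) ∣
        (tr g + (lin g : Matrix (Fin 2) (Fin 2) ℤ) *ᵥ pt k - pt (perm 3 g k)) i}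
      one_mem' := fun k _ i => by
        rw [tr_id, map_one, map_one]
        have : ((1 : SpecialLinearGroup (Fin 2) ℤ) : Matrix (Fin 2) (Fin 2) ℤ) *ᵥ pt k = pt k :=
          one_mulVec _
        rw [this]; simp
      mul_mem' := fun {g h} hg hh k hk i => by
        have h1 := hg (perm 3 h k) (perm_apply_le h hk) i
        have h2 := dvd_mulVec (M := (lin g : Matrix (Fin 2) (Fin 2) ℤ)) (hh k hk) i
        have h3 : ((lin (g * h) : SpecialLinearGroup (Fin 2) ℤ) : Matrix (Fin 2) (Fin 2) ℤ) =
          (lin g : Matrix (Fin 2) (Fin 2) ℤ) * (lin h : Matrix (Fin 2) (Fin 2) ℤ) := by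
          rw [map_mul]; rfl
        have := dvd_add h1 h2
        rw [← Pi.add_apply] at this
        refine (congrArg (fun w : Fin 2 → ℤ => (2 : ℤ) ∣ w i) ?_).mpr this
        rw [tr_mul, h3, map_mul, Equiv.Perm.mul_apply, mulVec_sub, mulVec_add, mulVec_mulVec]
        abel
      inv_mem' := fun {g} hg k hk i => by
        have hk' : perm 3 g⁻¹ k ≤ 3 := perm_apply_le g⁻¹ hk
        have h2 := dvd_mulVec (M := (lin g⁻¹ : Matrix (Fin 2) (Fin 2) ℤ)) (hg _ hk') i
        have h3 : (lin g⁻¹ : Matrix (Fin 2) (Fin 2) ℤ) * (lin g : Matrix (Fin 2) (Fin 2) ℤ) = 1 := by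
          have : lin g⁻¹ * lin g = 1 := by rw [← map_mul, inv_mul_cancel, map_one]
          exact congrArg Subtype.val this
        have h4 : perm 3 g (perm 3 g⁻¹ k) = k := by
          rw [← Equiv.Perm.mul_apply, ← map_mul, mul_inv_cancel, map_one, Equiv.Perm.one_apply]
        have h5 := lin_mulVec_tr_inv g⁻¹
        rw [inv_inv] at h5
        have := (dvd_neg).mpr h2
        rw [← Pi.neg_apply] at this
        refine (congrArg (fun w : Fin 2 → ℤ => (2 : ℤ) ∣ w i) ?_).mpr this
        rw [h4, mulVec_sub, mulVec_add, mulVec_mulVec, h3, one_mulVec, h5]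
        abel }
  refine le_of_s_mem (K := K) (fun i hi => ?_) g
  show ∀ k ≤ 3, ∀ j : Fin 2, (2 : ℤ) ∣
        (tr (s 3 i) + (lin (s 3 i) : Matrix (Fin 2) (Fin 2) ℤ) *ᵥ pt k - pt (perm 3 (s 3 i) k)) j
  intro k hk
  rw [perm_s hi]
  obtain rfl | rfl | rfl : i = 0 ∨ i = 1 ∨ i = 2 := by omega
  · rw [lin_zero, tr_zero]; interval_cases k <;> decide +kernel
  · rw [lin_one, tr_one]; interval_cases k <;> decide +kernel
  · rw [lin_two, tr_two]; interval_cases k <;> decide +kernel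

end BraidCoHopf

namespace BraidCoHopf

/-! ### The involutions of the braid group on four strands modulo its center -/

lemma δ_three_sq_s_zero : SemiconjBy (δ 3 ^ 2) (s 3 0) (s 3 2) := by
  rw [pow_two]
  exact (show SemiconjBy (δ 3) (s 3 1) (s 3 2) from δ_s (by norm_num)).mul_left
    (show SemiconjBy (δ 3) (s 3 0) (s 3 1) from δ_s (by norm_num))

lemma δ_three_sq_s_two : SemiconjBy (δ 3 ^ 2) (s 3 2) (s 3 0) := δ_sq_s (m := 2)

lemma δ_three : δ 3 = s 3 0 * s 3 1 * s 3 2 := by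
  simp [δ, dl]

/-- The involutions `p_0, p_1, p_2` (modulo the center). -/
def pp : Fin 3 → Br 3 := ![(s 3 0)⁻¹ * δ 3 ^ 2 * s 3 0, δ 3 ^ 2, s 3 1 * δ 3 ^ 2 * (s 3 1)⁻¹]

lemma pp_zero : pp 0 = (s 3 0)⁻¹ * δ 3 ^ 2 * s 3 0 := rfl
lemma pp_one : pp 1 = δ 3 ^ 2 := rfl
lemma pp_two : pp 2 = s 3 1 * δ 3 ^ 2 * (s 3 1)⁻¹ := rfl

lemma s_zero_pp_zero : SemiconjBy (s 3 0) (pp 0) (pp 1) := by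
  rw [SemiconjBy, pp_zero, pp_one]; group

lemma s_one_pp_one : SemiconjBy (s 3 1) (pp 1) (pp 2) := by
  rw [SemiconjBy, pp_two, pp_one]; group

lemma pp_one_mul_pp_zero_inv : pp 1 * (pp 0)⁻¹ = s 3 0 * (s 3 2)⁻¹ := by
  have h := (δ_three_sq_s_zero.inv_right).eq
  have hc : s 3 0 * (s 3 2)⁻¹ = (s 3 2)⁻¹ * s 3 0 := ((s_comm' 3 (by norm_num)).inv_right).eq
  rw [pp_zero, pp_one, hc, mul_inv_rev, mul_inv_rev, inv_inv, ← mul_assoc, ← mul_assoc, h]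
  group

lemma s_two_eq : s 3 2 = pp 0 * (pp 1)⁻¹ * s 3 0 := by
  have := congrArg (·⁻¹) pp_one_mul_pp_zero_inv
  simp only [mul_inv_rev, inv_inv] at this
  rw [this]; group

lemma s_zero_pp_one : SemiconjBy (s 3 0) (pp 1) (pp 1 * (pp 0)⁻¹ * pp 1) := by
  have h1 : SemiconjBy (s 3 0) (pp 1 * (pp 0)⁻¹) (pp 1 * (pp 0)⁻¹) := by
    rw [pp_one_mul_pp_zero_inv]
    exact (Commute.refl _).mul_right (s_comm' 3 (by norm_num)).inv_right
  have := h1.mul_right s_zero_pp_zero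
  rwa [inv_mul_cancel_right] at this

lemma s_one_pp_two : SemiconjBy (s 3 1) (pp 2) (pp 2 * (pp 1)⁻¹ * pp 2) := by
  have h0 : pp 2 * (pp 1)⁻¹ = s 3 1 * (δ 3 * s 3 2 * (δ 3)⁻¹)⁻¹ := by
    have h := (show SemiconjBy (δ 3) (s 3 1) (s 3 2) from δ_s (by norm_num)).inv_right.eq
    rw [pp_two, pp_one, mul_assoc, mul_assoc, mul_right_inj]
    calc _ = δ 3 * (δ 3 * (s 3 1)⁻¹) * (δ 3)⁻¹ * (δ 3)⁻¹ := by rw [pow_two]; group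
      _ = _ := by rw [h]; group
  have hc : Commute (s 3 1) (δ 3 * s 3 2 * (δ 3)⁻¹) := by
    have h1 : s 3 1 = δ 3 * s 3 0 * (δ 3)⁻¹ := by
      rw [show δ 3 * s 3 0 = s 3 1 * δ 3 from δ_s (by norm_num)]; group
    rw [h1]
    exact (Commute.conj_iff _).mpr (s_comm' 3 (by norm_num))
  have h1 : SemiconjBy (s 3 1) (pp 2 * (pp 1)⁻¹) (pp 2 * (pp 1)⁻¹) := by
    rw [h0]; exact (Commute.refl _).mul_right hc.inv_right
  have := h1.mul_right s_one_pp_one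
  rwa [inv_mul_cancel_right] at this

lemma s_conj_eq : s 3 0 * s 3 1 * (s 3 0)⁻¹ = (s 3 1)⁻¹ * s 3 0 * s 3 1 := by
  rw [mul_inv_eq_iff_eq_mul, mul_assoc, mul_assoc, eq_inv_mul_iff_mul_eq, ← mul_assoc, ← mul_assoc]
  exact (s_braid (by norm_num)).symm

lemma δ_three_sq_commute : Commute (s 3 0 * s 3 1 * (s 3 0)⁻¹) (δ 3 ^ 2) := by
  have h0 : SemiconjBy (δ 3) (s 3 0) (s 3 1) := δ_s (by norm_num)
  have h1 : SemiconjBy (δ 3) (s 3 1) (s 3 2) := δ_s (by norm_num)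
  have h2 : SemiconjBy (δ 3) (s 3 2) (δ 3 * s 3 2 * (δ 3)⁻¹) := by rw [SemiconjBy]; group
  have h3 := (h1.mul_right h2).mul_right h1.inv_right
  have h4 := (h0.mul_right h1).mul_right h0.inv_right
  have h5 : s 3 1 * s 3 2 * (s 3 1)⁻¹ = (s 3 2)⁻¹ * s 3 1 * s 3 2 := by
    rw [mul_inv_eq_iff_eq_mul, mul_assoc, mul_assoc, eq_inv_mul_iff_mul_eq, ← mul_assoc,
      ← mul_assoc]
    exact (s_braid (by norm_num)).symm
  have h6 : s 3 2 * (δ 3 * s 3 2 * (δ 3)⁻¹) * (s 3 2)⁻¹ = s 3 0 * s 3 1 * (s 3 0)⁻¹ := by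
    have hc : s 3 0 * s 3 2 = s 3 2 * s 3 0 := s_comm 3 (by norm_num)
    calc _ = (s 3 2 * s 3 0) * (s 3 1 * s 3 2 * (s 3 1)⁻¹) * (s 3 2 * s 3 0)⁻¹ := by
          rw [δ_three]
          group
      _ = _ := by
        rw [h5, ← hc]; group
  rw [h6] at h3
  have := (h3.mul_left h4)
  rw [← pow_two] at this
  exact this.symm

lemma s_zero_pp_two : Commute (s 3 0) (pp 2) := by
  have := δ_three_sq_commute
  rw [s_conj_eq] at this
  have := (Commute.conj_iff (s 3 1)).mpr this
  rw [← pp_two] at this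
  convert this using 1
  group

lemma s_one_pp_zero : Commute (s 3 1) (pp 0) := by
  have := (Commute.conj_iff (s 3 0)⁻¹).mpr δ_three_sq_commute
  rw [inv_inv, ← pp_zero] at this
  convert this using 1
  group

lemma pp_sq (i : Fin 3) : pp i ^ 2 = zz 3 := by
  have h : (δ 3 ^ 2) ^ 2 = zz 3 := by rw [← pow_mul]; exact δ_pow_eq_zz (by norm_num)
  fin_cases i
  · show ((s 3 0)⁻¹ * δ 3 ^ 2 * s 3 0) ^ 2 = _
    calc _ = (s 3 0)⁻¹ * (δ 3 ^ 2) ^ 2 * s 3 0 := by simp only [pow_two, mul_assoc, mul_inv_cancel_left]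
      _ = _ := by rw [h, zz_comm]; group
  · exact h
  · show (s 3 1 * δ 3 ^ 2 * (s 3 1)⁻¹) ^ 2 = _
    rw [conj_pow, h, zz_comm]; group

end BraidCoHopf

namespace BraidCoHopf

/-! ### Arithmetic of matrices with integer entries -/

lemma two_mul_two_commuting {a b c d a' b' c' d' p q s t : ℤ} (hb : ¬ (2 : ℤ) ∣ b)
    (hp : ¬ (2 : ℤ) ∣ p) (hq : (2 : ℤ) ∣ q) (hs : (2 : ℤ) ∣ s)
    (hΔ : p * t - q * s = 1)
    (c1 : b * c' = b' * c) (c2 : a * b' + b * d' = a' * b + b' * d)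
    (c3 : c * a' + d * c' = c' * a + d' * c)
    (e00 : p * a + q * c = a' * p + b' * s) (e01 : p * b + q * d = a' * q + b' * t)
    (e10 : s * a + t * c = c' * p + d' * s) (e11 : s * b + t * d = c' * q + d' * t)
    (f00 : p * a' + q * c' = a * p + b * s) (f01 : p * b' + q * d' = a * q + b * t)
    (hb' : ¬ (2 : ℤ) ∣ b') :
    a = a' ∧ b = b' ∧ c = c' ∧ d = d' := by
  have hb0 : b ≠ 0 := by rintro rfl; exact hb (dvd_zero 2)
  have hb0' : b' ≠ 0 := by rintro rfl; exact hb' (dvd_zero 2)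
  have htr : a + d = a' + d' := by
    linear_combination (-(a + d - a' - d')) * hΔ + t * e00 - s * e01 - q * e10 + p * e11
  have c2' : b * (a' - d') = b' * (a - d) := by linear_combination -c2
  have E0 : p * (a - d) + 2 * q * c = (a' - d') * p + 2 * b' * s := by
    linear_combination 2 * e00 - p * htr
  have E1 : 2 * p * b - q * (a - d) = (a' - d') * q + 2 * b' * t := by
    linear_combination 2 * e01 - q * htr
  have F0 : p * (a' - d') + 2 * q * c' = (a - d) * p + 2 * b * s := by
    linear_combination 2 * f00 + p * htr
  have F1 : 2 * p * b' - q * (a' - d') = (a - d) * q + 2 * b * t := by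
    linear_combination 2 * f01 + q * htr
  have G0 : (b' ^ 2 - b ^ 2) * ((a' - d') * p + 2 * b' * s) = 0 := by
    linear_combination -b' ^ 2 * E0 + b * b' * F0 + (- b' * p - b * p) * c2' - 2 * b' * q * c1
  have G1 : (b' ^ 2 - b ^ 2) * ((a' - d') * q + 2 * b' * t) = 0 := by
    linear_combination -b' ^ 2 * E1 + b * b' * F1 + (b' * q - b * q) * c2'
  have G : (b' ^ 2 - b ^ 2) * b' = 0 := by
    have : 2 * ((b' ^ 2 - b ^ 2) * b') = 0 := by
      linear_combination (-q) * G0 + p * G1 - 2 * ((b' ^ 2 - b ^ 2) * b') * hΔ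
    omega
  have hbb : (b' - b) * (b' + b) = 0 := by
    have := (mul_eq_zero.mp G).resolve_right hb0'
    linear_combination this
  rcases mul_eq_zero.mp hbb with h | h
  · obtain rfl : b' = b := by omega
    have hc : c' = c := mul_left_cancel₀ hb0 c1
    have hd : a' - d' = a - d := mul_left_cancel₀ hb0 c2'
    omega
  · obtain rfl : b' = -b := by omega
    have hd : a' - d' = -(a - d) := mul_left_cancel₀ hb0 (by linear_combination c2')
    obtain rfl : a' = d := by omega
    have hpt : b * (p + t) = 0 := by linear_combination e01
    have ht : t = -p := by have := (mul_eq_zero.mp hpt).resolve_left hb0; omega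
    obtain ⟨q', rfl⟩ := hq
    obtain ⟨s', rfl⟩ := hs
    obtain ⟨p', rfl⟩ : ∃ p', p = 2 * p' + 1 := ⟨p / 2, by omega⟩
    rw [ht] at hΔ
    exfalso
    have : 4 * (p' ^ 2 + p' + q' * s') = -2 := by linear_combination -hΔ
    omega

lemma exists_gcd_eq {x y z w : ℤ} (hD : x * w - y * z ≠ 0)
    (h1 : x * w - y * z ∣ x ^ 2) (h2 : x * w - y * z ∣ z ^ 2)
    (h3 : x * w - y * z ∣ y ^ 2) (h4 : x * w - y * z ∣ w ^ 2) :
    ∃ p x' y' z' w' : ℤ, x = p * x' ∧ y = p * y' ∧ z = p * z' ∧ w = p * w' ∧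
      (x' * w' - y' * z' = 1 ∨ x' * w' - y' * z' = -1) := by
  have k1 : x * w - y * z ∣ (Int.gcd x z : ℤ) ^ 2 := by
    have := Int.dvd_coe_gcd h1 h2
    rwa [Int.pow_gcd_pow, Nat.cast_pow] at this
  have k2 : x * w - y * z ∣ (Int.gcd y w : ℤ) ^ 2 := by
    have := Int.dvd_coe_gcd h3 h4
    rwa [Int.pow_gcd_pow, Nat.cast_pow] at this
  obtain ⟨x', hx⟩ := Int.gcd_dvd_left x z
  obtain ⟨z', hz⟩ := Int.gcd_dvd_right x z
  obtain ⟨y', hy⟩ := Int.gcd_dvd_left y w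
  obtain ⟨w', hw⟩ := Int.gcd_dvd_right y w
  set g := Int.gcd x z
  set g' := Int.gcd y w
  have hDe : x * w - y * z = (g : ℤ) * g' * (x' * w' - y' * z') := by
    rw [hx, hz, hy, hw]; ring
  have hg : g ≠ 0 := by rintro h; apply hD; rw [hDe, h]; simp
  have hg' : g' ≠ 0 := by rintro h; apply hD; rw [hDe, h]; simp
  rw [hDe, pow_two, mul_assoc] at k1
  rw [hDe, pow_two, mul_comm (g : ℤ), mul_assoc] at k2
  have k1 := Int.dvd_of_mul_dvd_mul_left (by exact_mod_cast hg) k1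
  have k2 := Int.dvd_of_mul_dvd_mul_left (by exact_mod_cast hg') k2
  have e : g = g' := Nat.dvd_antisymm
    (by exact_mod_cast (dvd_mul_right _ _).trans k2) (by exact_mod_cast (dvd_mul_right _ _).trans k1)
  rw [← e] at k1 hy hw
  refine ⟨g, x', y', z', w', hx, hy, hz, hw, ?_⟩
  have : (g : ℤ) * (x' * w' - y' * z') ∣ g * 1 := by rwa [mul_one]
  exact Int.isUnit_iff.mp (isUnit_of_dvd_one (Int.dvd_of_mul_dvd_mul_left (by exact_mod_cast hg) this))

end BraidCoHopf

namespace BraidCoHopf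

open Matrix SpecialLinearGroup

/-! ### Values of the affine representation -/

lemma sl_mul_apply (X Y : SpecialLinearGroup (Fin 2) ℤ) (i j : Fin 2) :
    (X * Y) i j = X i 0 * Y 0 j + X i 1 * Y 1 j := by
  have : (X * Y) i j = ((X : Matrix (Fin 2) (Fin 2) ℤ) * (Y : Matrix (Fin 2) (Fin 2) ℤ)) i j := rfl
  rw [this, Matrix.mul_apply, Fin.sum_univ_two]

lemma sl_det (X : SpecialLinearGroup (Fin 2) ℤ) : X 0 0 * X 1 1 - X 0 1 * X 1 0 = 1 := by
  have := X.2
  rwa [Matrix.det_fin_two] at this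

lemma sl_ext {X Y : SpecialLinearGroup (Fin 2) ℤ} (h00 : X 0 0 = Y 0 0) (h01 : X 0 1 = Y 0 1)
    (h10 : X 1 0 = Y 1 0) (h11 : X 1 1 = Y 1 1) : X = Y := by
  refine Subtype.ext (Matrix.ext fun i j => ?_)
  fin_cases i <;> fin_cases j <;> assumption

lemma lin_pp (i : Fin 3) : lin (pp i) = -1 := by
  have h : lin (pp 1) = -1 := by
    rw [pp_one, map_pow, δ_three, map_mul, map_mul, lin_zero, lin_one, lin_two]
    decide +kernel
  have hc (A : SpecialLinearGroup (Fin 2) ℤ) : A * -1 * A⁻¹ = -1 := by simp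
  fin_cases i
  · show lin (pp 0) = _
    rw [pp_zero, ← pp_one]
    have := hc (lin (s 3 0))⁻¹
    rwa [map_mul, map_mul, h, map_inv, ← inv_inv (lin (s 3 0)), inv_inv (lin (s 3 0))⁻¹]
  · exact h
  · show lin (pp 2) = _
    rw [pp_two, ← pp_one, map_mul, map_mul, h, map_inv, hc]

lemma lin_surjective : Function.Surjective lin := by
  rw [← MonoidHom.range_eq_top, eq_top_iff, ← SL2Z_generators, Subgroup.closure_le]
  rintro _ (rfl | rfl)
  · refine ⟨(s 3 0 * s 3 1 * s 3 0)⁻¹, ?_⟩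
    rw [map_inv, map_mul, map_mul, lin_zero, lin_one]
    decide +kernel
  · exact ⟨s 3 0, by rw [lin_zero]; decide +kernel⟩

lemma tr_pp (i : Fin 3) : tr (pp i) = pt i := by
  have hz (g : Br 3) : tr (g * s 3 0) = tr g := by rw [tr_mul, tr_zero, mulVec_zero, add_zero]
  have ho (g : Br 3) : tr (g * s 3 1) = tr g := by rw [tr_mul, tr_one, mulVec_zero, add_zero]
  have h : tr (pp 1) = pt 1 := by
    rw [pp_one, pow_two, δ_three, tr_mul, map_mul, map_mul, lin_zero, lin_one, lin_two, tr_mul,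
      tr_two, map_mul, lin_zero, lin_one, ho, tr_zero]
    decide +kernel
  fin_cases i
  · show tr (pp 0) = pt 0
    have := congrArg tr s_zero_pp_zero.eq
    rw [hz, h, tr_mul, tr_zero, lin_zero, zero_add] at this
    have h0 := congrFun this 0
    have h1 := congrFun this 1
    simp [matT, pt, mulVec, dotProduct, Fin.sum_univ_two] at h0 h1
    ext i
    fin_cases i
    · show tr (pp 0) 0 = 0
      omega
    · exact h1
  · exact h
  · show tr (pp 2) = pt 2
    have := congrArg tr s_one_pp_one.eq
    rw [ho, tr_mul, tr_one, lin_one, zero_add, h] at this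
    rw [← this]
    decide +kernel

/-- The first basic translation. -/
def ta : Br 3 := pp 1 * (pp 0)⁻¹

/-- The difference of the basic translations. -/
def td : Br 3 := pp 2 * (pp 0)⁻¹

lemma ta_eq : ta = s 3 0 * (s 3 2)⁻¹ := pp_one_mul_pp_zero_inv

lemma s_zero_ta : SemiconjBy (s 3 0) ta ta := by
  rw [ta_eq]
  exact (Commute.refl _).mul_right (s_comm' 3 (by norm_num)).inv_right

lemma s_one_ta : SemiconjBy (s 3 1) ta td := s_one_pp_one.mul_right s_one_pp_zero.inv_right

lemma s_zero_td : SemiconjBy (s 3 0) td (td * ta⁻¹) := by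
  have := SemiconjBy.mul_right (show SemiconjBy (s 3 0) (pp 2) (pp 2) from s_zero_pp_two)
    s_zero_pp_zero.inv_right
  rwa [show pp 2 * (pp 1)⁻¹ = td * ta⁻¹ by rw [td, ta]; group] at this

lemma s_one_td : SemiconjBy (s 3 1) td (td * ta⁻¹ * td) := by
  have := SemiconjBy.mul_right s_one_pp_two s_one_pp_zero.inv_right
  rwa [show pp 2 * (pp 1)⁻¹ * pp 2 * (pp 0)⁻¹ = td * ta⁻¹ * td by rw [td, ta]; group] at this

lemma lin_mul_pp_inv {R : Br 3 →* Br 3} (h : lin (R (s 3 2)) = lin (R (s 3 0))) :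
    lin (R ta) = 1 := by
  rw [ta_eq, map_mul, map_mul, map_inv, map_inv, h, mul_inv_cancel]

lemma s_two_eq' : s 3 2 = ta⁻¹ * s 3 0 := by rw [s_two_eq, ta]; group

end BraidCoHopf

namespace BraidCoHopf

open Matrix SpecialLinearGroup

/-! ### Normalizing an endomorphism by means of the affine representation -/

/-- Endomorphisms whose affine representation is the standard one modulo two. -/
structure IsAdm (R : Br 3 →* Br 3) : Prop where
  lin_s : ∀ i < 3, ∀ a b, (2 : ℤ) ∣ lin (R (s 3 i)) a b - lin (s 3 i) a b
  lin_pp : ∀ a b, (2 : ℤ) ∣ lin (R (pp 1)) a b - lin (pp 1) a b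
  tr_zero : (2 : ℤ) ∣ tr (R ta) 0 - 1
  tr_one : (2 : ℤ) ∣ tr (R ta) 1

variable {R : Br 3 →* Br 3}

lemma IsAdm.lin_two (hR : IsAdm R) : lin (R (s 3 2)) = lin (R (s 3 0)) := by
  have hc : lin (R (s 3 0)) * lin (R (s 3 2)) = lin (R (s 3 2)) * lin (R (s 3 0)) := by
    rw [← map_mul, ← map_mul, s_comm 3 (by norm_num), map_mul, map_mul]
  have he : lin (R (pp 1)) * lin (R (s 3 0)) = lin (R (s 3 2)) * lin (R (pp 1)) := by
    rw [← map_mul, ← map_mul, ← map_mul, ← map_mul, pp_one, δ_three_sq_s_zero.eq]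
  have hf : lin (R (pp 1)) * lin (R (s 3 2)) = lin (R (s 3 0)) * lin (R (pp 1)) := by
    rw [← map_mul, ← map_mul, ← map_mul, ← map_mul, pp_one, δ_three_sq_s_two.eq]
  have h0 := hR.lin_s 0 (by norm_num)
  have h2 := hR.lin_s 2 (by norm_num)
  have hp := hR.lin_pp
  rw [lin_zero] at h0
  rw [BraidCoHopf.lin_two] at h2
  rw [BraidCoHopf.lin_pp] at hp
  have c (i j : Fin 2) := congrArg (fun X : SpecialLinearGroup (Fin 2) ℤ => X i j) hc
  have e (i j : Fin 2) := congrArg (fun X : SpecialLinearGroup (Fin 2) ℤ => X i j) he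
  have f (i j : Fin 2) := congrArg (fun X : SpecialLinearGroup (Fin 2) ℤ => X i j) hf
  simp only [sl_mul_apply] at c e f
  have hb : ¬ (2 : ℤ) ∣ lin (R (s 3 0)) 0 1 := by
    have : (2 : ℤ) ∣ lin (R (s 3 0)) 0 1 - 1 := h0 0 1
    omega
  have hb' : ¬ (2 : ℤ) ∣ lin (R (s 3 2)) 0 1 := by
    have : (2 : ℤ) ∣ lin (R (s 3 2)) 0 1 - 1 := h2 0 1
    omega
  have hp0 : ¬ (2 : ℤ) ∣ lin (R (pp 1)) 0 0 := by
    have : (2 : ℤ) ∣ lin (R (pp 1)) 0 0 - -1 := hp 0 0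
    omega
  have hq : (2 : ℤ) ∣ lin (R (pp 1)) 0 1 := by
    have : (2 : ℤ) ∣ lin (R (pp 1)) 0 1 - -0 := hp 0 1
    omega
  have hs : (2 : ℤ) ∣ lin (R (pp 1)) 1 0 := by
    have : (2 : ℤ) ∣ lin (R (pp 1)) 1 0 - -0 := hp 1 0
    omega
  obtain ⟨k1, k2, k3, k4⟩ := two_mul_two_commuting hb hp0 hq hs (sl_det (lin (R (pp 1))))
    (a' := lin (R (s 3 2)) 0 0) (b' := lin (R (s 3 2)) 0 1) (c' := lin (R (s 3 2)) 1 0)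
    (d' := lin (R (s 3 2)) 1 1)
    (by linear_combination c 0 0) (c 0 1) (c 1 0) (e 0 0) (e 0 1) (e 1 0) (e 1 1) (f 0 0) (f 0 1)
    hb'
  exact (sl_ext k1 k2 k3 k4).symm

lemma exists_sl {x y z w : ℤ} (h : x * w - y * z = 1) :
    ∃ G : SpecialLinearGroup (Fin 2) ℤ, G 0 0 = x ∧ G 0 1 = y ∧ G 1 0 = z ∧ G 1 1 = w :=
  ⟨⟨!![x, y; z, w], by rw [Matrix.det_fin_two_of, h]⟩, rfl, rfl, rfl, rfl⟩

lemma matT_apply (i j : Fin 2) : matT i j = !![1, 1; 0, 1] i j := rfl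
lemma matU_apply (i j : Fin 2) : matU i j = !![1, 0; -1, 1] i j := rfl
lemma matT_inv_apply (i j : Fin 2) : matT⁻¹ i j = !![1, -1; 0, 1] i j := by
  fin_cases i <;> fin_cases j <;> rfl
lemma matU_inv_apply (i j : Fin 2) : matU⁻¹ i j = !![1, 0; 1, 1] i j := by
  fin_cases i <;> fin_cases j <;> rfl

lemma exists_intertwiner {A B : SpecialLinearGroup (Fin 2) ℤ} {x y z w : ℤ}
    (hxw : x * w - y * z ≠ 0)
    (a1 : A 0 0 * x + A 0 1 * z = x) (a2 : A 1 0 * x + A 1 1 * z = z)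
    (a3 : A 0 0 * y + A 0 1 * w = y + x) (a4 : A 1 0 * y + A 1 1 * w = w + z)
    (b1 : B 0 0 * x + B 0 1 * z = x - y) (b2 : B 1 0 * x + B 1 1 * z = z - w)
    (b3 : B 0 0 * y + B 0 1 * w = y) (b4 : B 1 0 * y + B 1 1 * w = w) :
    ∃ (G : SpecialLinearGroup (Fin 2) ℤ) (p : ℤ), x = p * G 0 0 ∧ z = p * G 1 0 ∧
      (A * G = G * matT ∧ B * G = G * matU ∨ A * G * matT = G ∧ B * G * matU = G) := by
  obtain ⟨p, x, y, z, w, rfl, rfl, rfl, rfl, h⟩ := exists_gcd_eq hxw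
    ⟨A 0 1, by linear_combination -x * a3 + y * a1⟩
    ⟨-A 1 0, by linear_combination w * a2 - z * a4⟩ ⟨B 0 1, by linear_combination y * b1 - x * b3⟩
    ⟨-B 1 0, by linear_combination w * b2 - z * b4⟩
  have hp : p ≠ 0 := by rintro rfl; exact hxw (by ring)
  replace a1 : A 0 0 * x + A 0 1 * z = x := mul_left_cancel₀ hp (by linear_combination a1)
  replace a2 : A 1 0 * x + A 1 1 * z = z := mul_left_cancel₀ hp (by linear_combination a2)
  replace a3 : A 0 0 * y + A 0 1 * w = y + x := mul_left_cancel₀ hp (by linear_combination a3)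
  replace a4 : A 1 0 * y + A 1 1 * w = w + z := mul_left_cancel₀ hp (by linear_combination a4)
  replace b1 : B 0 0 * x + B 0 1 * z = x - y := mul_left_cancel₀ hp (by linear_combination b1)
  replace b2 : B 1 0 * x + B 1 1 * z = z - w := mul_left_cancel₀ hp (by linear_combination b2)
  replace b3 : B 0 0 * y + B 0 1 * w = y := mul_left_cancel₀ hp (by linear_combination b3)
  replace b4 : B 1 0 * y + B 1 1 * w = w := mul_left_cancel₀ hp (by linear_combination b4)
  rcases h with h | h
  · obtain ⟨G, rfl, rfl, rfl, rfl⟩ := exists_sl h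
    refine ⟨G, p, rfl, rfl, Or.inl ⟨?_, ?_⟩⟩
    · apply sl_ext <;> rw [sl_mul_apply, sl_mul_apply, matT_apply, matT_apply] <;> simp [a1, a2, a3, a4] <;> ring
    · apply sl_ext <;> rw [sl_mul_apply, sl_mul_apply, matU_apply, matU_apply] <;> simp [b1, b2, b3, b4] <;> ring
  · obtain ⟨G, rfl, hy, rfl, hw⟩ := exists_sl (x := x) (y := -y) (z := z) (w := -w) (by linarith)
    refine ⟨G, p, rfl, rfl, Or.inr ⟨?_, ?_⟩⟩
    · rw [← eq_mul_inv_iff_mul_eq]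
      apply sl_ext <;> rw [sl_mul_apply, sl_mul_apply, matT_inv_apply, matT_inv_apply] <;> simp [hy, hw] <;> linarith
    · rw [← eq_mul_inv_iff_mul_eq]
      apply sl_ext <;> rw [sl_mul_apply, sl_mul_apply, matU_inv_apply, matU_inv_apply] <;> simp [hy, hw] <;> linarith

lemma mulVec_zero_apply (A : SpecialLinearGroup (Fin 2) ℤ) (v : Fin 2 → ℤ) (i : Fin 2) :
    ((A : Matrix (Fin 2) (Fin 2) ℤ) *ᵥ v) i = A i 0 * v 0 + A i 1 * v 1 := by
  rw [mulVec, dotProduct, Fin.sum_univ_two]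

lemma tr_semiconj {a x y : Br 3} (h : SemiconjBy a x y) (hx : lin x = 1) (i : Fin 2) :
    lin a i 0 * tr x 0 + lin a i 1 * tr x 1 = tr y i := by
  have := tr_conj (g := a) hx
  rw [h.eq, mul_inv_cancel_right] at this
  rw [this, mulVec_zero_apply]

lemma IsAdm.exists_lin_conj (hR : IsAdm R) : ∃ (β : Br 3) (p : ℤ), ¬ (2 : ℤ) ∣ p ∧
    tr (β * R ta * β⁻¹) = ![p, 0] ∧
    (lin (β * R (s 3 0) * β⁻¹) = matT ∧ lin (β * R (s 3 1) * β⁻¹) = matU ∨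
      lin (β * R (s 3 0) * β⁻¹) = matT⁻¹ ∧ lin (β * R (s 3 1) * β⁻¹) = matU⁻¹) := by
  have ha : lin (R ta) = 1 := lin_mul_pp_inv hR.lin_two
  have hd : lin (R td) = 1 := by
    have := (s_one_ta.map (lin.comp R)).eq
    rw [MonoidHom.comp_apply, MonoidHom.comp_apply, MonoidHom.comp_apply, ha, mul_one] at this
    exact (mul_eq_right.mp this.symm)
  have c0 := tr_semiconj (s_zero_ta.map R) ha
  have c1 := tr_semiconj (s_one_ta.map R) ha
  have d0 := tr_semiconj (s_zero_td.map R) hd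
  have d1 := tr_semiconj (s_one_td.map R) hd
  simp only [map_mul, map_inv, tr_mul_of_lin_eq_one hd, tr_inv_of_lin_eq_one ha, Pi.add_apply,
    tr_mul_of_lin_eq_one (show lin (R td * (R ta)⁻¹) = 1 by rw [map_mul, map_inv, ha, hd]; simp),
    Pi.neg_apply] at d0 d1
  have h0 := hR.tr_zero
  have h1 := hR.tr_one
  have e0 : (2 : ℤ) ∣ lin (R (s 3 1)) 0 0 - lin (s 3 1) 0 0 := hR.lin_s 1 (by norm_num) 0 0
  have e1 : (2 : ℤ) ∣ lin (R (s 3 1)) 1 0 - lin (s 3 1) 1 0 := hR.lin_s 1 (by norm_num) 1 0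
  rw [BraidCoHopf.lin_one] at e0 e1
  replace e0 : (2 : ℤ) ∣ lin (R (s 3 1)) 0 0 - 1 := e0
  replace e1 : (2 : ℤ) ∣ lin (R (s 3 1)) 1 0 - -1 := e1
  have hx : (2 : ℤ) ∣ tr (R td) 0 - 1 := by
    rw [← c1 0]
    obtain ⟨a, h0⟩ := h0
    obtain ⟨b, h1⟩ := h1
    obtain ⟨c, e0⟩ := e0
    exact ⟨c * tr (R ta) 0 + lin (R (s 3 1)) 0 1 * b + a, by
      linear_combination h0 + lin (R (s 3 1)) 0 1 * h1 + tr (R ta) 0 * e0⟩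
  have hy : (2 : ℤ) ∣ tr (R td) 1 - 1 := by
    rw [← c1 1]
    obtain ⟨a, h0⟩ := h0
    obtain ⟨b, h1⟩ := h1
    obtain ⟨c, e1⟩ := e1
    exact ⟨c * tr (R ta) 0 + lin (R (s 3 1)) 1 1 * b - a - 1, by
      linear_combination -h0 + lin (R (s 3 1)) 1 1 * h1 + tr (R ta) 0 * e1⟩
  have hne : tr (R ta) 0 * (tr (R ta) 1 - tr (R td) 1) -
      (tr (R ta) 0 - tr (R td) 0) * tr (R ta) 1 ≠ 0 := by
    obtain ⟨a, h0⟩ := h0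
    obtain ⟨b, h1⟩ := h1
    obtain ⟨c, hy⟩ := hy
    intro h
    have h2 : tr (R ta) 0 * (2 * b - (2 * c + 1)) - (tr (R ta) 0 - tr (R td) 0) * (2 * b) = 0 := by
      rw [h1] at h
      rw [← h, show tr (R td) 1 = 2 * c + 1 by omega]
    have h3 : 2 * (a * (2 * b - (2 * c + 1)) + b - c - (tr (R ta) 0 - tr (R td) 0) * b) = 1 := by
      linear_combination h2 - (2 * b - (2 * c + 1)) * h0
    omega
  obtain ⟨G, p, hp0, hp1, hG⟩ := exists_intertwiner (A := lin (R (s 3 0))) (B := lin (R (s 3 1))) hne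
    (c0 0) (c0 1) (by linear_combination c0 0 - d0 0) (by linear_combination c0 1 - d0 1)
    (by linear_combination c1 0) (by linear_combination c1 1)
    (by linear_combination c1 0 - d1 0) (by linear_combination c1 1 - d1 1)
  obtain ⟨β, hβ⟩ := lin_surjective G⁻¹
  refine ⟨β, p, ?_, ?_, hG.imp (fun h => ⟨?_, ?_⟩) fun h => ⟨?_, ?_⟩⟩
  · intro h
    have := (h.mul_right (G 0 0))
    rw [← hp0] at this
    omega
  · have hm : tr (R ta) = (G : Matrix (Fin 2) (Fin 2) ℤ) *ᵥ ![p, 0] := by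
      ext i
      rw [mulVec_zero_apply]
      fin_cases i
      · show tr (R ta) 0 = G 0 0 * p + G 0 1 * 0
        rw [hp0]; ring
      · show tr (R ta) 1 = G 1 0 * p + G 1 1 * 0
        rw [hp1]; ring
    have hGG : ((G⁻¹ : SpecialLinearGroup (Fin 2) ℤ) : Matrix (Fin 2) (Fin 2) ℤ) *
        (G : Matrix (Fin 2) (Fin 2) ℤ) = 1 := congrArg Subtype.val (inv_mul_cancel G)
    rw [tr_conj ha, hβ, hm, mulVec_mulVec, hGG, one_mulVec]
  · rw [map_mul, map_mul, map_inv, hβ, inv_inv, mul_assoc, h.1, inv_mul_cancel_left]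
  · rw [map_mul, map_mul, map_inv, hβ, inv_inv, mul_assoc, h.2, inv_mul_cancel_left]
  · rw [map_mul, map_mul, map_inv, hβ, inv_inv, mul_assoc, eq_mul_inv_of_mul_eq h.1,
      inv_mul_cancel_left]
  · rw [map_mul, map_mul, map_inv, hβ, inv_inv, mul_assoc, eq_mul_inv_of_mul_eq h.2,
      inv_mul_cancel_left]

end BraidCoHopf

namespace BraidCoHopf

open Matrix SpecialLinearGroup

lemma lin_ta : lin ta = 1 := by
  rw [ta, map_mul, map_inv, lin_pp, lin_pp, mul_inv_cancel]

lemma lin_td : lin td = 1 := by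
  rw [td, map_mul, map_inv, lin_pp, lin_pp, mul_inv_cancel]

lemma tr_ta : tr ta = ![1, 0] := by
  rw [ta_eq, tr_mul, tr_zero, lin_zero]
  have := lin_mulVec_tr_inv (s 3 2)
  rw [lin_two, tr_two] at this
  rw [this]
  decide +kernel

lemma tr_td : tr td = ![1, -1] := by
  have := tr_conj (g := s 3 1) lin_ta
  rw [s_one_ta.eq, mul_inv_cancel_right, lin_one, tr_ta] at this
  rw [this]
  decide +kernel

/-- Translations as a homomorphism on the kernel of the linear part. -/
lemma tr_zpow {g : Br 3} (hg : lin g = 1) (k : ℤ) : tr (g ^ k) = k • tr g := by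
  have hk (k : ℤ) : lin (g ^ k) = 1 := by rw [map_zpow, hg, _root_.one_zpow]
  induction k using Int.induction_on with
  | zero => rw [zpow_zero, tr_id, zero_smul]
  | succ n ih => rw [_root_.zpow_add_one, tr_mul_of_lin_eq_one (hk _), ih, add_smul, one_smul]
  | pred n ih =>
    rw [_root_.zpow_sub_one, tr_mul_of_lin_eq_one (hk _), tr_inv_of_lin_eq_one hg, ih, sub_smul, one_smul,
      sub_eq_add_neg]

lemma exists_tr_eq (v : Fin 2 → ℤ) : ∃ β, lin β = 1 ∧ tr β = v := by
  have h : lin (ta * td⁻¹) = 1 := by rw [map_mul, map_inv, lin_ta, lin_td]; simp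
  refine ⟨ta ^ v 0 * (ta * td⁻¹) ^ v 1, ?_, ?_⟩
  · rw [map_mul, map_zpow, map_zpow, lin_ta, h]; simp
  · rw [tr_mul_of_lin_eq_one (by rw [map_zpow, lin_ta, _root_.one_zpow]), tr_zpow lin_ta, tr_zpow h,
      tr_mul_of_lin_eq_one lin_ta, tr_inv_of_lin_eq_one lin_td, tr_ta, tr_td]
    ext i
    fin_cases i <;> simp

lemma affine_eq_of_s {R : Br 3 →* Br 3} {p : ℤ} (h : ∀ i < 3, lin (R (s 3 i)) = lin (s 3 i))
    (ht : ∀ i < 3, tr (R (s 3 i)) = p • tr (s 3 i)) (g : Br 3) :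
    lin (R g) = lin g ∧ tr (R g) = p • tr g := by
  have hl (g : Br 3) : lin (R g) = lin g := by
    have : lin.comp R = lin := hom_ext h
    exact DFunLike.congr_fun this g
  refine ⟨hl g, ?_⟩
  let K : Subgroup (Br 3) :=
    { carrier := {g | tr (R g) = p • tr g}
      one_mem' := by
        show tr (R 1) = p • tr 1
        rw [map_one, tr_id, smul_zero]
      mul_mem' := fun {a b} ha hb => by
        show tr (R (a * b)) = p • tr (a * b)
        rw [map_mul, tr_mul, tr_mul, hl, ha, hb, mulVec_smul, smul_add]
      inv_mem' := fun {a} ha => by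
        show tr (R a⁻¹) = p • tr a⁻¹
        have h1 (b : Br 3) : tr b⁻¹ = - ((lin b⁻¹ : SpecialLinearGroup (Fin 2) ℤ) :
            Matrix (Fin 2) (Fin 2) ℤ) *ᵥ tr b := by
          have := lin_mulVec_tr_inv b⁻¹
          rw [inv_inv] at this
          rw [neg_mulVec, this, neg_neg]
        rw [map_inv, h1, h1, ← map_inv, hl, show tr (R a) = p • tr a from ha, mulVec_smul] }
  exact le_of_s_mem (K := K) (fun i hi => ht i hi) g

lemma exists_tr_conj {R : Br 3 →* Br 3} {p : ℤ} (h0 : lin (R (s 3 0)) = matT)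
    (h1 : lin (R (s 3 1)) = matU) (h2 : lin (R (s 3 2)) = matT) (ht : tr (R ta) = ![p, 0]) :
    ∃ β, ∀ g, lin (β * R g * β⁻¹) = lin g ∧ tr (β * R g * β⁻¹) = p • tr g := by
  have hb : tr (R (s 3 0 * s 3 1 * s 3 0)) = tr (R (s 3 1 * s 3 0 * s 3 1)) :=
    congrArg (fun g => tr (R g)) (s_braid (by norm_num))
  have b0 := congrFun hb 0
  have b1 := congrFun hb 1
  simp only [map_mul, tr_mul_zero, tr_mul_one, h0, h1, sl_mul_apply, matT_apply, matU_apply]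
    at b0 b1
  simp at b0 b1
  obtain ⟨β, hβ, hv⟩ := exists_tr_eq ![-tr (R (s 3 1)) 1, tr (R (s 3 0)) 0]
  have hl (g : Br 3) : lin (β * R g * β⁻¹) = lin (R g) := by
    rw [map_mul, map_mul, map_inv, hβ]; simp
  have htr (g : Br 3) : tr (β * R g * β⁻¹) =
      tr β + (tr (R g) - (lin (R g) : Matrix (Fin 2) (Fin 2) ℤ) *ᵥ tr β) := by
    rw [mul_assoc, tr_mul_of_lin_eq_one hβ, tr_mul, tr_inv_of_lin_eq_one hβ, mulVec_neg,
      sub_eq_add_neg]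
  have ha : tr (β * R ta * β⁻¹) = ![p, 0] := by
    have : lin (R ta) = 1 := lin_mul_pp_inv (by rw [h2, h0])
    rw [tr_conj this, hβ, ← ht]
    exact one_mulVec _
  let R' : Br 3 →* Br 3 := (MulAut.conj β).toMonoidHom.comp R
  have hR' (g : Br 3) : R' g = β * R g * β⁻¹ := rfl
  have t0 : tr (R' (s 3 0)) = 0 := by
    rw [hR', htr, h0, hv]
    ext i
    rw [Pi.add_apply, Pi.sub_apply, mulVec_zero_apply, matT_apply, matT_apply]
    fin_cases i
    all_goals simp
    all_goals omega
  have t1 : tr (R' (s 3 1)) = 0 := by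
    rw [hR', htr, h1, hv]
    ext i
    rw [Pi.add_apply, Pi.sub_apply, mulVec_zero_apply, matU_apply, matU_apply]
    fin_cases i
    all_goals simp
    all_goals omega
  refine ⟨β, affine_eq_of_s (R := R') (fun i hi => ?_) fun i hi => ?_⟩
  · rw [hR', hl]
    obtain rfl | rfl | rfl : i = 0 ∨ i = 1 ∨ i = 2 := by omega
    · rw [h0, lin_zero]
    · rw [h1, lin_one]
    · rw [h2, lin_two]
  · obtain rfl | rfl | rfl : i = 0 ∨ i = 1 ∨ i = 2 := by omega
    · rw [t0, tr_zero, smul_zero]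
    · rw [t1, tr_one, smul_zero]
    · have hla : lin (R' ta) = 1 := by
        rw [hR', hl]; exact lin_mul_pp_inv (by rw [h2, h0])
      rw [s_two_eq', map_mul, map_inv, tr_mul_of_lin_eq_one (by rw [map_inv, hla, inv_one]), t0,
        tr_inv_of_lin_eq_one hla, hR', ha, tr_mul_of_lin_eq_one (by rw [map_inv, lin_ta, inv_one]),
        tr_inv_of_lin_eq_one lin_ta, tr_ta, tr_zero]
      ext i
      fin_cases i <;> simp

/-- An admissible endomorphism becomes compatible with the affine representation after composition
with an inner automorphism and possibly with the inversion automorphism. -/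
theorem IsAdm.exists_conj {R : Br 3 →* Br 3} (hR : IsAdm R) : ∃ (β : Br 3) (p : ℤ), ¬ (2 : ℤ) ∣ p ∧
    ((∀ g, lin (β * R g * β⁻¹) = lin g ∧ tr (β * R g * β⁻¹) = p • tr g) ∨
      ∀ g, lin (β * R (invert 3 g) * β⁻¹) = lin g ∧ tr (β * R (invert 3 g) * β⁻¹) = p • tr g) := by
  obtain ⟨β, p, hp, ht, h⟩ := hR.exists_lin_conj
  have hinv : invert 3 ta = ta⁻¹ := by
    rw [ta_eq, map_mul, map_inv, invert_s (by norm_num), invert_s (by norm_num), inv_inv,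
      _root_.mul_inv_rev, inv_inv]
    exact (s_comm' 3 (i := 0) (j := 2) (by norm_num)).inv_left.eq
  rcases h with ⟨h0, h1⟩ | ⟨h0, h1⟩
  · obtain ⟨γ, hγ⟩ := exists_tr_conj (R := (MulAut.conj β).toMonoidHom.comp R) h0 h1
      (by
        rw [← h0]
        show lin (β * R (s 3 2) * β⁻¹) = _
        rw [map_mul, map_mul, hR.lin_two, map_mul, map_mul]) ht
    refine ⟨γ * β, p, hp, Or.inl fun g => ?_⟩
    rw [show γ * β * R g * (γ * β)⁻¹ = γ * (β * R g * β⁻¹) * γ⁻¹ by group]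
    exact hγ g
  · have hi (i : ℕ) (hi : i < 3) : β * R (invert 3 (s 3 i)) * β⁻¹ = (β * R (s 3 i) * β⁻¹)⁻¹ := by
      rw [invert_s hi, map_inv]; group
    obtain ⟨γ, hγ⟩ := exists_tr_conj (R := ((MulAut.conj β).toMonoidHom.comp R).comp (invert 3))
      (p := -p) (show lin (β * R (invert 3 (s 3 0)) * β⁻¹) = _ by
        rw [hi 0 (by norm_num), map_inv, h0, inv_inv])
      (show lin (β * R (invert 3 (s 3 1)) * β⁻¹) = _ by
        rw [hi 1 (by norm_num), map_inv, h1, inv_inv])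
      (show lin (β * R (invert 3 (s 3 2)) * β⁻¹) = _ by
        rw [hi 2 (by norm_num), map_inv, map_mul, map_mul, hR.lin_two, ← map_mul, ← map_mul, h0,
          inv_inv])
      (show tr (β * R (invert 3 ta) * β⁻¹) = _ by
        rw [hinv, map_inv, show β * (R ta)⁻¹ * β⁻¹ = (β * R ta * β⁻¹)⁻¹ by group,
          tr_inv_of_lin_eq_one, ht]
        · ext i
          fin_cases i <;> simp
        · rw [map_mul, map_mul, lin_mul_pp_inv hR.lin_two, mul_one, ← map_mul, mul_inv_cancel,
            map_one])
    refine ⟨γ * β, -p, by omega, Or.inr fun g => ?_⟩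
    rw [show γ * β * R (invert 3 g) * (γ * β)⁻¹ = γ * (β * R (invert 3 g) * β⁻¹) * γ⁻¹ by group]
    exact hγ g

end BraidCoHopf

namespace BraidCoHopf

open Matrix.SpecialLinearGroup

/-! ### The kernel of the projective linear representation -/

/-- The subgroup generated by the elements `pp i`. -/
def Wt : Subgroup (Br 3) := Subgroup.closure (Set.range pp)

lemma pp_mem_Wt (i : Fin 3) : pp i ∈ Wt := Subgroup.subset_closure ⟨i, rfl⟩

lemma mem_normalizer_Wt {g : Br 3} (h : ∀ i, g * pp i * g⁻¹ ∈ Wt)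
    (h' : ∀ i, g⁻¹ * pp i * g ∈ Wt) : g ∈ Subgroup.normalizer (Wt : Set (Br 3)) := by
  have key (a : Br 3) (ha : ∀ i, a * pp i * a⁻¹ ∈ Wt) (w : Br 3) (hw : w ∈ Wt) :
      a * w * a⁻¹ ∈ Wt := by
    have : Wt ≤ Wt.comap (MulAut.conj a).toMonoidHom := by
      conv_lhs => rw [Wt]
      rw [Subgroup.closure_le]
      rintro _ ⟨i, rfl⟩
      exact ha i
    exact this hw
  refine Subgroup.mem_normalizer_iff.mpr fun w => ⟨key g h w, fun hw => ?_⟩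
  have := key g⁻¹ (fun i => by rw [inv_inv]; exact h' i) _ hw
  rwa [show g⁻¹ * (g * w * g⁻¹) * g⁻¹⁻¹ = w by group] at this

lemma eq_conj_of_semiconj {G : Type*} [Group G] {a x y : G} (h : SemiconjBy a x y) :
    a * x * a⁻¹ = y := by rw [h.eq, mul_inv_cancel_right]

lemma eq_conj_inv_of_semiconj {G : Type*} [Group G] {a x y : G} (h : SemiconjBy a x y) :
    a⁻¹ * y * a = x := by rw [mul_assoc, ← h.eq, inv_mul_cancel_left]

lemma s_zero_mem_normalizer : s 3 0 ∈ Subgroup.normalizer (Wt : Set (Br 3)) := by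
  refine mem_normalizer_Wt (fun i => ?_) fun i => ?_
  · fin_cases i
    · exact (eq_conj_of_semiconj s_zero_pp_zero).symm ▸ pp_mem_Wt 1
    · refine (eq_conj_of_semiconj s_zero_pp_one).symm ▸ ?_
      exact mul_mem (mul_mem (pp_mem_Wt 1) (inv_mem (pp_mem_Wt 0))) (pp_mem_Wt 1)
    · exact (eq_conj_of_semiconj (show SemiconjBy _ _ _ from s_zero_pp_two)).symm ▸ pp_mem_Wt 2
  · have h : SemiconjBy (s 3 0) (pp 0 * (pp 1)⁻¹ * pp 0) (pp 0) := by
      have := (s_zero_pp_zero.mul_right s_zero_pp_one.inv_right).mul_right s_zero_pp_zero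
      have e : pp 1 * (pp 1 * (pp 0)⁻¹ * pp 1)⁻¹ * pp 1 = pp 0 := by group
      rwa [e] at this
    fin_cases i
    · refine (eq_conj_inv_of_semiconj h).symm ▸ ?_
      exact mul_mem (mul_mem (pp_mem_Wt 0) (inv_mem (pp_mem_Wt 1))) (pp_mem_Wt 0)
    · exact (eq_conj_inv_of_semiconj s_zero_pp_zero).symm ▸ pp_mem_Wt 0
    · exact (eq_conj_inv_of_semiconj (show SemiconjBy _ _ _ from s_zero_pp_two)).symm ▸ pp_mem_Wt 2

lemma s_one_mem_normalizer : s 3 1 ∈ Subgroup.normalizer (Wt : Set (Br 3)) := by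
  refine mem_normalizer_Wt (fun i => ?_) fun i => ?_
  · fin_cases i
    · exact (eq_conj_of_semiconj (show SemiconjBy _ _ _ from s_one_pp_zero)).symm ▸ pp_mem_Wt 0
    · exact (eq_conj_of_semiconj s_one_pp_one).symm ▸ pp_mem_Wt 2
    · refine (eq_conj_of_semiconj s_one_pp_two).symm ▸ ?_
      exact mul_mem (mul_mem (pp_mem_Wt 2) (inv_mem (pp_mem_Wt 1))) (pp_mem_Wt 2)
  · have h : SemiconjBy (s 3 1) (pp 1 * (pp 2)⁻¹ * pp 1) (pp 1) := by
      have := (s_one_pp_one.mul_right s_one_pp_two.inv_right).mul_right s_one_pp_one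
      have e : pp 2 * (pp 2 * (pp 1)⁻¹ * pp 2)⁻¹ * pp 2 = pp 1 := by group
      rwa [e] at this
    fin_cases i
    · exact (eq_conj_inv_of_semiconj (show SemiconjBy _ _ _ from s_one_pp_zero)).symm ▸ pp_mem_Wt 0
    · refine (eq_conj_inv_of_semiconj h).symm ▸ ?_
      exact mul_mem (mul_mem (pp_mem_Wt 1) (inv_mem (pp_mem_Wt 2))) (pp_mem_Wt 1)
    · exact (eq_conj_inv_of_semiconj s_one_pp_one).symm ▸ pp_mem_Wt 1

instance Wt_normal : Wt.Normal := by
  rw [← Subgroup.normalizer_eq_top_iff, eq_top_iff]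
  refine fun g _ => le_of_s_mem (fun i hi => ?_) g
  obtain rfl | rfl | rfl : i = 0 ∨ i = 1 ∨ i = 2 := by omega
  · exact s_zero_mem_normalizer
  · exact s_one_mem_normalizer
  · rw [s_two_eq]
    exact mul_mem (Subgroup.le_normalizer (mul_mem (pp_mem_Wt 0) (inv_mem (pp_mem_Wt 1))))
      s_zero_mem_normalizer

lemma lin_of_mem_Wt {g : Br 3} (hg : g ∈ Wt) : lin g = 1 ∨ lin g = -1 := by
  have : Wt ≤ (Subgroup.zpowers (-1 : Matrix.SpecialLinearGroup (Fin 2) ℤ)).comap lin := by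
    rw [Wt, Subgroup.closure_le]
    rintro _ ⟨i, rfl⟩
    show lin (pp i) ∈ Subgroup.zpowers (-1 : Matrix.SpecialLinearGroup (Fin 2) ℤ)
    rw [lin_pp]
    exact Subgroup.mem_zpowers _
  obtain ⟨k, hk⟩ := this hg
  rw [← hk]
  exact (Int.even_or_odd k).imp (fun h => h.neg_one_zpow) fun h => h.neg_one_zpow

/-- The positive monoid generated by `σ_0` and `σ_1⁻¹`. -/
def posMonoid : Submonoid (Br 3) := Submonoid.closure {s 3 0, (s 3 1)⁻¹}

/-- The classes modulo `Wt` that have a normal form. -/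
def HasNormalForm (q : Br 3 ⧸ Wt) : Prop :=
  ∃ e f w : Br 3, (e = 1 ∨ e = s 3 0 * s 3 1 * s 3 0) ∧
    (f = 1 ∨ f = s 3 0 * s 3 1 ∨ f = (s 3 0 * s 3 1) ^ 2) ∧ w ∈ posMonoid ∧
    q = QuotientGroup.mk (e * w * f)

lemma mk_s_two : (QuotientGroup.mk (s 3 2) : Br 3 ⧸ Wt) = QuotientGroup.mk (s 3 0) := by
  rw [s_two_eq, QuotientGroup.mk_mul, (QuotientGroup.eq_one_iff _).mpr, one_mul]
  exact mul_mem (pp_mem_Wt 0) (inv_mem (pp_mem_Wt 1))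

lemma mk_sq : (QuotientGroup.mk (s 3 0 * s 3 1 * s 3 0) : Br 3 ⧸ Wt) ^ 2 = 1 := by
  have h1 : (QuotientGroup.mk (pp 1) : Br 3 ⧸ Wt) = 1 := (QuotientGroup.eq_one_iff _).mpr (pp_mem_Wt 1)
  rw [pp_one, δ_three, QuotientGroup.mk_pow, QuotientGroup.mk_mul, mk_s_two] at h1
  rwa [QuotientGroup.mk_mul]

lemma braid_three : (s 3 0 * s 3 1) ^ 3 = (s 3 0 * s 3 1 * s 3 0) ^ 2 := by
  have h := s_braid (m := 3) (i := 0) (by norm_num)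
  calc _ = (s 3 0 * s 3 1 * s 3 0) * (s 3 1 * s 3 0 * s 3 1) := by
        simp only [pow_succ, pow_zero, one_mul, mul_assoc]
    _ = _ := by rw [← h, pow_two]

lemma mk_cube : (QuotientGroup.mk (s 3 0 * s 3 1) : Br 3 ⧸ Wt) ^ 3 = 1 := by
  rw [← QuotientGroup.mk_pow, braid_three, QuotientGroup.mk_pow, mk_sq]

lemma y_sq_mul_x : (QuotientGroup.mk ((s 3 0 * s 3 1) ^ 2 * (s 3 0 * s 3 1 * s 3 0)) : Br 3 ⧸ Wt) =
    QuotientGroup.mk (s 3 0) := by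
  rw [show (s 3 0 * s 3 1) ^ 2 * (s 3 0 * s 3 1 * s 3 0) = (s 3 0 * s 3 1) ^ 3 * s 3 0 by
    rw [pow_succ _ 2]; simp only [mul_assoc], QuotientGroup.mk_mul, QuotientGroup.mk_pow, mk_cube,
    one_mul]

lemma y_mul_x : (QuotientGroup.mk ((s 3 0 * s 3 1) * (s 3 0 * s 3 1 * s 3 0)) : Br 3 ⧸ Wt) =
    QuotientGroup.mk (s 3 1)⁻¹ := by
  have h := s_braid (m := 3) (i := 0) (by norm_num)
  have : (s 3 0 * s 3 1) * (s 3 0 * s 3 1 * s 3 0) = (s 3 0 * s 3 1 * s 3 0) ^ 2 * (s 3 1)⁻¹ := by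
    rw [← braid_three, eq_mul_inv_iff_mul_eq]
    simp only [pow_succ, pow_zero, one_mul, mul_assoc]
  rw [this, QuotientGroup.mk_mul, QuotientGroup.mk_pow, mk_sq, one_mul]

lemma HasNormalForm.mul_y {q : Br 3 ⧸ Wt} (h : HasNormalForm q) :
    HasNormalForm (q * QuotientGroup.mk (s 3 0 * s 3 1)) := by
  obtain ⟨e, f, w, he, hf, hw, rfl⟩ := h
  obtain rfl | rfl | rfl := hf
  · exact ⟨e, _, w, he, Or.inr (Or.inl rfl), hw, by rw [mul_one, ← QuotientGroup.mk_mul]⟩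
  · exact ⟨e, _, w, he, Or.inr (Or.inr rfl), hw, by
      rw [← QuotientGroup.mk_mul, mul_assoc, ← pow_two]⟩
  · refine ⟨e, _, w, he, Or.inl rfl, hw, ?_⟩
    rw [← QuotientGroup.mk_mul, mul_assoc, ← pow_succ, QuotientGroup.mk_mul, QuotientGroup.mk_pow,
      mk_cube, ← QuotientGroup.mk_one, ← QuotientGroup.mk_mul]

lemma mk_s_zero_mul_x : (QuotientGroup.mk (s 3 0 * (s 3 0 * s 3 1 * s 3 0)) : Br 3 ⧸ Wt) =
    QuotientGroup.mk ((s 3 0 * s 3 1) ^ 2) := by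
  rw [QuotientGroup.mk_mul, ← y_sq_mul_x, QuotientGroup.mk_mul, mul_assoc, ← pow_two, mk_sq,
    mul_one]

lemma mk_s_one_inv_mul_x : (QuotientGroup.mk ((s 3 1)⁻¹ * (s 3 0 * s 3 1 * s 3 0)) : Br 3 ⧸ Wt) =
    QuotientGroup.mk (s 3 0 * s 3 1) := by
  rw [QuotientGroup.mk_mul, ← y_mul_x, QuotientGroup.mk_mul, mul_assoc, ← pow_two, mk_sq, mul_one]

lemma hasNormalForm_mul_x {e w : Br 3} (he : e = 1 ∨ e = s 3 0 * s 3 1 * s 3 0)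
    (hw : w ∈ posMonoid) :
    HasNormalForm (QuotientGroup.mk (e * w * (s 3 0 * s 3 1 * s 3 0))) := by
  induction hw using Submonoid.closure_induction_right with
  | one =>
    obtain rfl | rfl := he
    · exact ⟨_, 1, 1, Or.inr rfl, Or.inl rfl, one_mem _, by simp only [one_mul, mul_one]⟩
    · refine ⟨1, 1, 1, Or.inl rfl, Or.inl rfl, one_mem _, ?_⟩
      rw [mul_one, ← pow_two, QuotientGroup.mk_pow, mk_sq]
      simp
  | mul_right w hw y hy _ =>
    have hw : w ∈ posMonoid := hw
    obtain rfl | rfl := hy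
    · refine ⟨e, _, w, he, Or.inr (Or.inr rfl), hw, ?_⟩
      rw [← mul_assoc e, mul_assoc (e * w), QuotientGroup.mk_mul, mk_s_zero_mul_x,
        ← QuotientGroup.mk_mul]
    · refine ⟨e, _, w, he, Or.inr (Or.inl rfl), hw, ?_⟩
      rw [← mul_assoc e, mul_assoc (e * w), QuotientGroup.mk_mul, mk_s_one_inv_mul_x,
        ← QuotientGroup.mk_mul]

lemma HasNormalForm.mul_x {q : Br 3 ⧸ Wt} (h : HasNormalForm q) :
    HasNormalForm (q * QuotientGroup.mk (s 3 0 * s 3 1 * s 3 0)) := by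
  obtain ⟨e, f, w, he, hf, hw, rfl⟩ := h
  rw [← QuotientGroup.mk_mul]
  obtain rfl | rfl | rfl := hf
  · rw [mul_one]
    exact hasNormalForm_mul_x he hw
  · refine ⟨e, _, w * (s 3 1)⁻¹, he, Or.inl rfl, mul_mem hw (Submonoid.subset_closure (by simp)), ?_⟩
    rw [mul_assoc, QuotientGroup.mk_mul, y_mul_x, ← QuotientGroup.mk_mul, mul_one, mul_assoc]
  · refine ⟨e, _, w * s 3 0, he, Or.inl rfl, mul_mem hw (Submonoid.subset_closure (by simp)), ?_⟩
    rw [mul_assoc, QuotientGroup.mk_mul, y_sq_mul_x, ← QuotientGroup.mk_mul, mul_one, mul_assoc]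

lemma hasNormalForm (q : Br 3 ⧸ Wt) : HasNormalForm q := by
  let K : Subgroup (Br 3) :=
    { carrier := {g | ∀ q : Br 3 ⧸ Wt, HasNormalForm q ↔ HasNormalForm (q * QuotientGroup.mk g)}
      one_mem' := fun q => by rw [QuotientGroup.mk_one, mul_one]
      mul_mem' := fun {a b} ha hb q => by
        rw [QuotientGroup.mk_mul, ← mul_assoc, ← hb, ← ha]
      inv_mem' := fun {a} ha q => by
        rw [ha (q * QuotientGroup.mk a⁻¹), QuotientGroup.mk_inv, inv_mul_cancel_right] }
  have hx : s 3 0 * s 3 1 * s 3 0 ∈ K := fun q => by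
    refine ⟨fun h => h.mul_x, fun h => ?_⟩
    have := h.mul_x
    rwa [mul_assoc, ← pow_two, mk_sq, mul_one] at this
  have hy : s 3 0 * s 3 1 ∈ K := fun q => by
    refine ⟨fun h => h.mul_y, fun h => ?_⟩
    have := h.mul_y.mul_y
    rwa [mul_assoc, mul_assoc, ← pow_two, ← pow_succ', mk_cube, mul_one] at this
  have h0 : s 3 0 ∈ K := by
    have := mul_mem (inv_mem hy) hx
    rwa [inv_mul_cancel_left] at this
  have h1 : s 3 1 ∈ K := by
    have := mul_mem (inv_mem h0) hy
    rwa [inv_mul_cancel_left] at this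
  have h2 : s 3 2 ∈ K := fun q => by
    rw [mk_s_two]
    exact h0 q
  obtain ⟨g, rfl⟩ := QuotientGroup.mk_surjective q
  have hg : g ∈ K := by
    refine le_of_s_mem (fun i hi => ?_) g
    obtain rfl | rfl | rfl : i = 0 ∨ i = 1 ∨ i = 2 := by omega
    exacts [h0, h1, h2]
  have h := (hg 1).mp ⟨1, 1, 1, Or.inl rfl, Or.inl rfl, one_mem _, by simp⟩
  rwa [one_mul] at h

lemma lin_of_mem_posMonoid {w : Br 3} (hw : w ∈ posMonoid) :
    1 ≤ lin w 0 0 ∧ 1 ≤ lin w 1 1 ∧ 0 ≤ lin w 0 1 ∧ 0 ≤ lin w 1 0 ∧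
      (w = 1 ∨ 1 ≤ lin w 0 1 + lin w 1 0) := by
  induction hw using Submonoid.closure_induction_right with
  | one => rw [map_one]; simp
  | mul_right w hw y hy ih =>
    obtain ⟨h00, h11, h01, h10, -⟩ := ih
    have e0 : matT 0 0 = 1 ∧ matT 0 1 = 1 ∧ matT 1 0 = 0 ∧ matT 1 1 = 1 := by decide +kernel
    have e1 : matU⁻¹ 0 0 = 1 ∧ matU⁻¹ 0 1 = 0 ∧ matU⁻¹ 1 0 = 1 ∧ matU⁻¹ 1 1 = 1 := by
      decide +kernel
    simp only [map_mul, sl_mul_apply]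
    obtain rfl | rfl := hy
    · simp only [lin_zero, e0]
      refine ⟨by omega, by omega, by omega, by omega, Or.inr (by omega)⟩
    · simp only [map_inv, lin_one, e1]
      refine ⟨by omega, by omega, by omega, by omega, Or.inr (by omega)⟩

theorem mem_Wt_of_lin {g : Br 3} (hg : lin g = 1 ∨ lin g = -1) : g ∈ Wt := by
  obtain ⟨e, f, w, he, hf, hw, h⟩ := hasNormalForm (QuotientGroup.mk g)
  have h' := QuotientGroup.eq.mp h
  have hl := lin_of_mem_Wt h'
  have hq : lin (e * w * f) = 1 ∨ lin (e * w * f) = -1 := by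
    have : lin (e * w * f) = lin g * lin (g⁻¹ * (e * w * f)) := by rw [← map_mul, mul_inv_cancel_left]
    rw [this]
    obtain hg | hg := hg <;> obtain hl | hl := hl <;> rw [hg, hl] <;> simp
  have hq' : lin (e * w * f) 0 1 = 0 ∧ lin (e * w * f) 1 0 = 0 ∧
      lin (e * w * f) 0 0 = lin (e * w * f) 1 1 := by
    obtain h | h := hq <;> rw [h] <;> decide
  obtain ⟨h00, h11, h01, h10, hw1⟩ := lin_of_mem_posMonoid hw
  have ex : lin (s 3 0 * s 3 1 * s 3 0) = matT * matU * matT := by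
    rw [map_mul, map_mul, lin_zero, lin_one]
  have ey : lin (s 3 0 * s 3 1) = matT * matU := by rw [map_mul, lin_zero, lin_one]
  have ey2 : lin ((s 3 0 * s 3 1) ^ 2) = (matT * matU) ^ 2 := by rw [map_pow, ey]
  have x0 : (matT * matU * matT) 0 0 = 0 ∧ (matT * matU * matT) 0 1 = 1 ∧
    (matT * matU * matT) 1 0 = -1 ∧ (matT * matU * matT) 1 1 = 0 := by decide +kernel
  have y0 : (matT * matU) 0 0 = 0 ∧ (matT * matU) 0 1 = 1 ∧
    (matT * matU) 1 0 = -1 ∧ (matT * matU) 1 1 = 1 := by decide +kernel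
  have yy0 : ((matT * matU) ^ 2) 0 0 = -1 ∧ ((matT * matU) ^ 2) 0 1 = 1 ∧
    ((matT * matU) ^ 2) 1 0 = -1 ∧ ((matT * matU) ^ 2) 1 1 = 0 := by decide +kernel
  obtain rfl | rfl := he <;> obtain rfl | rfl | rfl := hf <;>
    simp only [map_mul lin (_ * w), map_mul lin _ w, map_mul lin w, ex, ey, ey2, one_mul, mul_one,
      sl_mul_apply _ (matT * matU), sl_mul_apply _ ((matT * matU) ^ 2),
      sl_mul_apply (matT * matU * matT), x0, y0, yy0] at hq'

  · obtain rfl | hw1 := hw1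
    · have := inv_mem h'
      simpa using this
    · omega
  all_goals omega

end BraidCoHopf

namespace BraidCoHopf

/-! ### The free product of three cyclic groups of order two -/

/-- The free product of three cyclic groups of order two. -/
abbrev W2 : Type := PresentedGroup (Set.range fun i : Fin 3 => FreeGroup.of i ^ 2)

/-- The standard involutions of `W2`. -/
def iv (i : Fin 3) : W2 := PresentedGroup.of i

lemma isFreeCyc_iv : IsFreeCyc 2 iv where
  closure_range := PresentedGroup.closure_range_of _
  pow i := by
    have : (PresentedGroup.mk (Set.range fun i : Fin 3 => FreeGroup.of i ^ 2) (FreeGroup.of i ^ 2)) = 1 :=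
      PresentedGroup.one_of_mem ⟨i, rfl⟩
    rwa [map_pow] at this
  lift {G} _ y hy := by
    refine ⟨PresentedGroup.toGroup (f := y) ?_, fun i => PresentedGroup.toGroup.of _⟩
    rintro _ ⟨i, rfl⟩
    simpa using hy i

lemma iv_mul_self (i : Fin 3) : iv i * iv i = 1 := by rw [← pow_two, isFreeCyc_iv.pow]

lemma iv_mul_iv_mul (i : Fin 3) (w : W2) : iv i * (iv i * w) = w := by
  rw [← mul_assoc, iv_mul_self, one_mul]

lemma iv_inv (i : Fin 3) : (iv i)⁻¹ = iv i := inv_eq_of_mul_eq_one_left (iv_mul_self i)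

lemma conj_injective : Function.Injective (MulAut.conj : W2 →* MulAut W2) := by
  refine (injective_iff_map_eq_one _).mpr fun w hw => ?_
  have h (i : Fin 3) : w ∈ Subgroup.zpowers (iv i) := by
    refine isFreeCyc_iv.mem_zpowers_of_commute' (by norm_num) ?_
    have := DFunLike.congr_fun hw (iv i)
    rw [MulAut.conj_apply, MulAut.one_apply, mul_inv_eq_iff_eq_mul] at this
    exact this.symm
  exact isFreeCyc_iv.eq_one_of_mem_zpowers (show (0 : Fin 3) ≠ 1 by decide) (h 0) (h 1)

lemma exists_act_iv : ∃ Ψ : Br 3 →* MulAut W2, IsArt iv 0 1 (Ψ (s 3 0)) ∧ IsArt iv 1 2 (Ψ (s 3 1)) ∧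
    Ψ (s 3 2) = MulAut.conj (iv 0 * iv 1) * Ψ (s 3 0) := by
  obtain ⟨A, hA⟩ := isFreeCyc_iv.exists_isArt (p := 0) (q := 1) (by decide)
  obtain ⟨B, hB⟩ := isFreeCyc_iv.exists_isArt (p := 1) (q := 2) (by decide)
  have A2 := hA.other 2 (by decide) (by decide)
  have B0 := hB.other 0 (by decide) (by decide)
  obtain ⟨Ψ, hΨ⟩ := exists_lift (m := 3)
    (fun i => if i = 0 then A else if i = 1 then B else MulAut.conj (iv 0 * iv 1) * A)
    (fun i h => by
      obtain rfl | rfl : i = 0 ∨ i = 1 := by omega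
      · exact hA.braid isFreeCyc_iv (by decide) (by decide) (by decide) hB
      · refine isFreeCyc_iv.mulAut_ext fun j => ?_
        fin_cases j <;>
          simp [hA.left, hA.right, A2, hB.left, hB.right, B0, mul_assoc, iv_mul_self,
            iv_mul_iv_mul, iv_inv])
    (fun i j h hj => by
      obtain ⟨rfl, rfl⟩ : i = 0 ∧ j = 2 := by omega
      refine isFreeCyc_iv.mulAut_ext fun j => ?_
      fin_cases j <;>
        simp [hA.left, hA.right, A2, mul_assoc, iv_mul_self, iv_mul_iv_mul, iv_inv])
  have h0 := hΨ 0 (by norm_num)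
  have h1 := hΨ 1 (by norm_num)
  have h2 := hΨ 2 (by norm_num)
  simp at h0 h1 h2
  exact ⟨Ψ, h0 ▸ hA, h1 ▸ hB, by rw [h2, h0, map_mul]⟩

/-- The action of the braid group on `W2`. -/
noncomputable def actIv : Br 3 →* MulAut W2 := exists_act_iv.choose

lemma actIv_zero : IsArt iv 0 1 (actIv (s 3 0)) := exists_act_iv.choose_spec.1
lemma actIv_one : IsArt iv 1 2 (actIv (s 3 1)) := exists_act_iv.choose_spec.2.1
lemma actIv_two : actIv (s 3 2) = MulAut.conj (iv 0 * iv 1) * actIv (s 3 0) :=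
  exists_act_iv.choose_spec.2.2

lemma mulAut_conj_apply' {G : Type*} [Group G] (φ : MulAut G) (g : G) :
    φ * MulAut.conj g * φ⁻¹ = MulAut.conj (φ g) := by
  ext w; simp

lemma actIv_pp (i : Fin 3) : actIv (pp i) = MulAut.conj (iv i) := by
  have A2 := actIv_zero.other 2 (by decide) (by decide)
  have B0 := actIv_one.other 0 (by decide) (by decide)
  have h1 : actIv (pp 1) = MulAut.conj (iv 1) := by
    refine isFreeCyc_iv.mulAut_ext fun j => ?_
    rw [pp_one, δ_three, map_pow, map_mul, map_mul, actIv_two, pow_two]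
    fin_cases j <;>
      simp [actIv_zero.left, actIv_zero.right, A2, actIv_one.left, actIv_one.right, B0, mul_assoc,
        iv_mul_self, iv_mul_iv_mul, iv_inv]
  fin_cases i
  · show actIv (pp 0) = MulAut.conj (iv 0)
    have h := congrArg actIv s_zero_pp_zero.eq
    rw [map_mul, map_mul, h1, ← actIv_zero.left, ← mulAut_conj_apply', inv_mul_cancel_right] at h
    exact mul_left_cancel h
  · exact h1
  · show actIv (pp 2) = MulAut.conj (iv 2)
    have h := congrArg actIv s_one_pp_one.eq
    rw [map_mul, map_mul, h1, ← mul_inv_eq_iff_eq_mul, mulAut_conj_apply', actIv_one.left] at h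
    exact h.symm

lemma exists_cls : ∃ c : Wt →* W2, ∀ g : Wt, MulAut.conj (c g) = actIv g := by
  have h : ∀ g : Wt, (actIv.comp Wt.subtype) g ∈ (MulAut.conj : W2 →* MulAut W2).range := by
    intro g
    have : Wt ≤ (MulAut.conj : W2 →* MulAut W2).range.comap actIv := by
      rw [Wt, Subgroup.closure_le]
      rintro _ ⟨i, rfl⟩
      exact ⟨iv i, (actIv_pp i).symm⟩
    exact this g.2
  refine ⟨(MonoidHom.ofInjective conj_injective).symm.toMonoidHom.comp
    ((actIv.comp Wt.subtype).codRestrict _ h), fun g => ?_⟩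
  have := (MonoidHom.ofInjective conj_injective).apply_symm_apply
    (((actIv.comp Wt.subtype).codRestrict _ h) g)
  exact congrArg Subtype.val this

/-- The class in `W2` of an element of `Wt`. -/
noncomputable def cls : Wt →* W2 := exists_cls.choose

lemma conj_cls (g : Wt) : MulAut.conj (cls g) = actIv g := exists_cls.choose_spec g

lemma cls_pp (i : Fin 3) : cls ⟨pp i, pp_mem_Wt i⟩ = iv i :=
  conj_injective ((conj_cls _).trans (actIv_pp i))

lemma cls_conj (k : Br 3) (g : Wt) : cls ⟨k * g * k⁻¹, Wt_normal.conj_mem g g.2 k⟩ = actIv k (cls g) := by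
  apply conj_injective
  rw [conj_cls, ← mulAut_conj_apply', conj_cls]
  simp

/-- A homomorphism on `Wt` is determined by its values on the elements `pp i`. -/
lemma hom_ext_Wt {G : Type*} [Group G] {φ ψ : Wt →* G}
    (h : ∀ i, φ ⟨pp i, pp_mem_Wt i⟩ = ψ ⟨pp i, pp_mem_Wt i⟩) : φ = ψ := by
  refine MonoidHom.eq_of_eqOn_dense (s := Wt.subtype ⁻¹' Set.range pp) ?_ ?_
  · rw [Wt]; exact Subgroup.closure_preimage_eq_top _
  · rintro ⟨_, hg⟩ ⟨i, rfl⟩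
    exact h i

lemma zz_mem_Wt : zz 3 ∈ Wt := pp_sq 1 ▸ pow_mem (pp_mem_Wt 1) 2

lemma cls_eq_one_iff (g : Wt) : cls g = 1 ↔ (g : Br 3) ∈ Subgroup.zpowers (zz 3) := by
  have hn : (Subgroup.zpowers (zz 3)).Normal := by
    rw [← center_eq (by norm_num)]; infer_instance
  obtain ⟨Φ, hΦ⟩ := isFreeCyc_iv.lift (G := Br 3 ⧸ Subgroup.zpowers (zz 3))
    (fun i => QuotientGroup.mk (pp i)) fun i => by
      rw [← QuotientGroup.mk_pow, pp_sq]
      exact (QuotientGroup.eq_one_iff _).mpr (Subgroup.mem_zpowers _)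
  have h : Φ.comp cls = (QuotientGroup.mk' _).comp Wt.subtype := hom_ext_Wt fun i => by
    rw [MonoidHom.comp_apply, cls_pp, hΦ]; rfl
  constructor
  · intro hg
    have := DFunLike.congr_fun h g
    rw [MonoidHom.comp_apply, hg, map_one] at this
    exact (QuotientGroup.eq_one_iff _).mp this.symm
  · rintro ⟨k, hk⟩
    have hz : cls ⟨zz 3, zz_mem_Wt⟩ = 1 := by
      have : (⟨zz 3, zz_mem_Wt⟩ : Wt) = ⟨pp 1, pp_mem_Wt 1⟩ ^ 2 := Subtype.ext (pp_sq 1).symm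
      rw [this, map_pow, cls_pp, isFreeCyc_iv.pow]
    have : g = ⟨zz 3, zz_mem_Wt⟩ ^ k := Subtype.ext hk.symm
    rw [this, map_zpow, hz, one_zpow]

lemma cls_surjective : Function.Surjective cls := by
  rw [← MonoidHom.range_eq_top, eq_top_iff, ← isFreeCyc_iv.closure_range, Subgroup.closure_le]
  rintro _ ⟨i, rfl⟩
  exact ⟨_, cls_pp i⟩

end BraidCoHopf

namespace BraidCoHopf

/-! ### The image of the full twist under a normalized endomorphism -/

/-- The inclusion of a free group of rank two as the even elements of `W2`. -/
def ev : FreeGroup (Fin 2) →* W2 := FreeGroup.lift ![iv 0 * iv 1, iv 2 * iv 1]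

lemma ev_of_zero : ev (.of 0) = iv 0 * iv 1 := by simp [ev]
lemma ev_of_one : ev (.of 1) = iv 2 * iv 1 := by simp [ev]

/-- The automorphism inverting the generators of the free group. -/
def freeInv : MulAut (FreeGroup (Fin 2)) :=
  let f : FreeGroup (Fin 2) →* FreeGroup (Fin 2) := FreeGroup.lift fun i => (FreeGroup.of i)⁻¹
  have h : f.comp f = MonoidHom.id _ := FreeGroup.ext_hom _ _ fun i => by simp [f]
  MonoidHom.toMulEquiv f f h h

lemma freeInv_of (i : Fin 2) : freeInv (.of i) = (.of i)⁻¹ := by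
  simp [freeInv]

lemma freeInv_mul_self : freeInv * freeInv = 1 := by
  refine (isFreeCyc_freeGroup (Fin 2)).mulAut_ext fun i => ?_
  simp [freeInv_of]

lemma ev_injective : Function.Injective ev := by
  let H := FreeGroup (Fin 2) ⋊[MonoidHom.id (MulAut (FreeGroup (Fin 2)))] MulAut (FreeGroup (Fin 2))
  have hsq (i : Fin 3) : ((⟨![.of 0, 1, .of 1] i, freeInv⟩ : H)) ^ 2 = 1 := by
    rw [pow_two]
    refine SemidirectProduct.ext ?_ freeInv_mul_self
    rw [SemidirectProduct.mul_left]
    fin_cases i <;> simp [freeInv_of]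
  obtain ⟨χ, hχ⟩ := isFreeCyc_iv.lift (G := H) _ hsq
  have h : χ.comp ev = SemidirectProduct.inl := by
    refine FreeGroup.ext_hom _ _ fun i => ?_
    rw [MonoidHom.comp_apply]
    fin_cases i
    · show χ (ev (.of 0)) = _
      rw [ev_of_zero, map_mul, hχ, hχ]
      refine SemidirectProduct.ext ?_ freeInv_mul_self
      rw [SemidirectProduct.mul_left]
      simp
      rfl
    · show χ (ev (.of 1)) = _
      rw [ev_of_one, map_mul, hχ, hχ]
      refine SemidirectProduct.ext ?_ freeInv_mul_self
      rw [SemidirectProduct.mul_left]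
      simp
      rfl
  have := (SemidirectProduct.inl_injective (φ := MonoidHom.id (MulAut (FreeGroup (Fin 2)))))
  rw [← h] at this
  exact Function.Injective.of_comp this

lemma exists_ev (w : W2) : ∃ f, w = ev f ∨ w = ev f * iv 1 := by
  have hw : w ∈ Subgroup.closure (Set.range iv) := by
    rw [isFreeCyc_iv.closure_range]; trivial
  have hi (i : Fin 3) : ∃ y, iv i * iv 1 = ev y := by
    fin_cases i
    exacts [⟨_, ev_of_zero.symm⟩, ⟨1, by rw [map_one]; exact iv_mul_self 1⟩, ⟨_, ev_of_one.symm⟩]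
  have key (w : W2) (i : Fin 3) (h : ∃ f, w = ev f ∨ w = ev f * iv 1) :
      ∃ f, w * iv i = ev f ∨ w * iv i = ev f * iv 1 := by
    obtain ⟨y, hy⟩ := hi i
    obtain ⟨f, rfl | rfl⟩ := h
    · refine ⟨f * y, Or.inr ?_⟩
      rw [map_mul, ← hy]; simp [mul_assoc, iv_mul_self]
    · refine ⟨f * y⁻¹, Or.inl ?_⟩
      rw [map_mul, map_inv, ← hy]; simp [mul_assoc, iv_inv]
  induction hw using Subgroup.closure_induction_right with
  | one => exact ⟨1, Or.inl (map_one _).symm⟩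
  | mul_right w _ y hy ih => obtain ⟨i, rfl⟩ := hy; exact key w i ih
  | mul_inv_cancel w _ y hy ih => obtain ⟨i, rfl⟩ := hy; rw [iv_inv]; exact key w i ih

/-- A lift of `ev` to the braid group. -/
noncomputable def evLift : FreeGroup (Fin 2) →* Wt :=
  FreeGroup.lift ![⟨pp 0, pp_mem_Wt 0⟩ * ⟨pp 1, pp_mem_Wt 1⟩⁻¹, ⟨pp 2, pp_mem_Wt 2⟩ * ⟨pp 1, pp_mem_Wt 1⟩⁻¹]

lemma cls_evLift (f : FreeGroup (Fin 2)) : cls (evLift f) = ev f := by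
  have : cls.comp evLift = ev := by
    refine FreeGroup.ext_hom _ _ fun i => ?_
    fin_cases i <;> simp [evLift, ev, cls_pp, iv_inv]
  exact DFunLike.congr_fun this f

lemma lin_evLift (f : FreeGroup (Fin 2)) : lin (evLift f) = 1 := by
  have : (lin.comp Wt.subtype).comp evLift = 1 := by
    refine FreeGroup.ext_hom _ _ fun i => ?_
    fin_cases i <;> simp [evLift, lin_pp]
  exact DFunLike.congr_fun this f

/-- The first coordinate of the translation of an even element. -/
noncomputable def evTr : FreeGroup (Fin 2) →* Multiplicative ℤ :=
  MonoidHom.mk' (fun f => .ofAdd (tr (evLift f) 0)) fun f g => by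
    rw [map_mul, Subgroup.coe_mul, tr_mul_of_lin_eq_one (lin_evLift f)]; rfl

lemma lin_zz : lin (zz 3) = 1 := by rw [← pp_sq 1, map_pow, lin_pp]; simp

lemma tr_zz : tr (zz 3) = 0 := by
  rw [← pp_sq 1, pow_two, tr_mul, tr_pp, lin_pp]
  decide +kernel

lemma tr_of_cls_eq {g h : Wt} (hh : cls g = cls h) : ∃ k : ℤ, (g : Br 3) = h * zz 3 ^ k := by
  have : cls (h⁻¹ * g) = 1 := by rw [map_mul, map_inv, hh, inv_mul_cancel]
  obtain ⟨k, hk⟩ := (cls_eq_one_iff _).mp this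
  exact ⟨k, by rw [show zz 3 ^ k = _ from hk]; simp⟩

lemma exists_ev_of_lin_eq_one {g : Wt} (hg : lin g = 1) :
    ∃ f, cls g = ev f ∧ evTr f = .ofAdd (tr g 0) := by
  obtain ⟨f, hf | hf⟩ := exists_ev (cls g)
  · refine ⟨f, hf, ?_⟩
    rw [← cls_evLift] at hf
    obtain ⟨k, hk⟩ := tr_of_cls_eq hf
    rw [hk, tr_mul_of_lin_eq_one (lin_evLift f), tr_zpow lin_zz, tr_zz, smul_zero, add_zero]
    rfl
  · exfalso
    rw [← cls_evLift, ← cls_pp, ← map_mul] at hf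
    obtain ⟨k, hk⟩ := tr_of_cls_eq hf
    rw [hk, Subgroup.coe_mul, map_mul, map_mul, lin_evLift, map_zpow, lin_zz, lin_pp] at hg
    simp at hg
    exact absurd hg (by decide +kernel)

/-- The normalization of an endomorphism by its affine representation. -/
structure IsNorm (R : Br 3 →* Br 3) (p : ℤ) : Prop where
  lin_eq : ∀ g, lin (R g) = lin g
  tr_eq : ∀ g, tr (R g) = p • tr g
  odd : ¬ (2 : ℤ) ∣ p

namespace IsNorm

variable {R : Br 3 →* Br 3} {p : ℤ} (hR : IsNorm R p)
include hR

lemma map_mem_Wt {g : Br 3} (hg : g ∈ Wt) : R g ∈ Wt :=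
  mem_Wt_of_lin (by rw [hR.lin_eq]; exact lin_of_mem_Wt hg)

theorem map_zz : R (zz 3) ∈ Subgroup.zpowers (zz 3) := by
  have hta : ta ∈ Wt := mul_mem (pp_mem_Wt 1) (inv_mem (pp_mem_Wt 0))
  have h1 : lin (R (zz 3)) = 1 := by rw [hR.lin_eq, lin_zz]
  have h2 : lin (R ta) = 1 := by rw [hR.lin_eq, lin_ta]
  obtain ⟨f, hf, hft⟩ := exists_ev_of_lin_eq_one (g := ⟨_, hR.map_mem_Wt zz_mem_Wt⟩) h1
  obtain ⟨f', hf', hft'⟩ := exists_ev_of_lin_eq_one (g := ⟨_, hR.map_mem_Wt hta⟩) h2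
  refine (cls_eq_one_iff ⟨_, hR.map_mem_Wt zz_mem_Wt⟩).mp ?_
  rw [hf]
  by_cases h : f = 1
  · rw [h, map_one]
  exfalso
  have hc : f' * f = f * f' := by
    apply ev_injective
    rw [map_mul, map_mul, ← hf, ← hf', ← map_mul, ← map_mul]
    refine congrArg cls (Subtype.ext ?_)
    show R ta * R (zz 3) = R (zz 3) * R ta
    rw [← map_mul, ← map_mul, zz_comm]
  have h3 := map_eq_one_of_commute hc h evTr (by
    rw [hft]
    show Multiplicative.ofAdd (tr (R (zz 3)) 0) = 1
    rw [hR.tr_eq, tr_zz, smul_zero]; rfl)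
  rw [hft'] at h3
  have h4 : tr (R ta) 0 = 0 := h3
  rw [hR.tr_eq, tr_ta] at h4
  have := hR.odd
  simp at h4
  omega

end IsNorm

end BraidCoHopf

namespace BraidCoHopf

/-! ### Normalized endomorphisms are standard -/

lemma exists_conj_iv {w : W2} (hw : w ≠ 1) (h2 : w ^ 2 = 1) : ∃ u k, w = u * iv k * u⁻¹ := by
  have hcase {u : W2} {i : Fin 3} {k : ℤ} (h : u * w * u⁻¹ = iv i ^ k) : ∃ u k, w = u * iv k * u⁻¹ := by
    obtain ⟨l, hl | hl⟩ := Int.even_or_odd' k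
    · rw [hl, zpow_mul, zpow_ofNat, isFreeCyc_iv.pow, one_zpow] at h
      exact absurd (conj_eq_one_iff.mp h) hw
    · rw [hl, zpow_add, zpow_mul, zpow_ofNat, isFreeCyc_iv.pow, one_zpow, one_mul, zpow_one] at h
      exact ⟨u⁻¹, i, by rw [← h]; group⟩
  have hsplit (i : Fin 3) : (∃ u k, w = u * iv k * u⁻¹) ∨
      ∃ u, u * w * u⁻¹ ∈ blockSubgroup iv (fun j => !decide (j = i)) true := by
    obtain ⟨u, b, hu⟩ := (isFreeCyc_iv.isFreeProd fun j => decide (j = i)).conj_mem_of_pow_eq_one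
      two_ne_zero h2
    cases b with
    | true =>
      rw [IsFreeCyc.blockSubgroup_singleton] at hu
      obtain ⟨k, hk⟩ := hu
      exact Or.inl (hcase hk.symm)
    | false =>
      refine Or.inr ⟨u, ?_⟩
      convert hu using 1
      simp [blockSubgroup]
  obtain h | ⟨u, hu⟩ := hsplit 0
  · exact h
  obtain h | ⟨v, hv⟩ := hsplit 1
  · exact h
  obtain ⟨y, k, h⟩ := isFreeCyc_iv.exists_conj_zpow (i := 2) (by decide) hu hv
  exact hcase h

lemma two_dvd_tr_conj_pp {u : Br 3} (hu : u ∈ Wt) (k : Fin 3) (i : Fin 2) :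
    (2 : ℤ) ∣ tr (u * pp k * u⁻¹) i - pt k i := by
  have h : tr (u * pp k * u⁻¹) = tr u + (lin u : Matrix (Fin 2) (Fin 2) ℤ).mulVec (pt k) -
      (lin u : Matrix (Fin 2) (Fin 2) ℤ).mulVec (tr u⁻¹) := by
    rw [tr_mul, tr_mul, map_mul, lin_pp, tr_pp]
    simp [Matrix.neg_mulVec, sub_eq_add_neg]
  rw [h, lin_mulVec_tr_inv]
  obtain hl | hl := lin_of_mem_Wt hu
  · rw [hl]
    simp
    omega
  · rw [hl]
    simp [Matrix.neg_mulVec]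
    omega

lemma tr_mul_zz (g : Br 3) (k : ℤ) : tr (g * zz 3 ^ k) = tr g := by
  rw [tr_mul, tr_zpow lin_zz, tr_zz, smul_zero, Matrix.mulVec_zero, add_zero]

namespace IsNorm

variable {R : Br 3 →* Br 3} {p : ℤ} (hR : IsNorm R p)
include hR

lemma exists_hom : ∃ h : W2 →* W2, ∀ g (hg : g ∈ Wt), h (cls ⟨g, hg⟩) = cls ⟨R g, hR.map_mem_Wt hg⟩ := by
  let R' : Wt →* Wt := (R.comp Wt.subtype).codRestrict Wt fun g => hR.map_mem_Wt g.2
  obtain ⟨h, hh⟩ := isFreeCyc_iv.lift (fun i => cls (R' ⟨pp i, pp_mem_Wt i⟩)) fun i => by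
    rw [← map_pow, ← map_pow, cls_eq_one_iff]
    show R (pp i ^ 2) ∈ _
    rw [pp_sq]
    exact hR.map_zz
  have : h.comp cls = cls.comp R' := hom_ext_Wt fun i => by
    rw [MonoidHom.comp_apply, cls_pp, hh]; rfl
  exact ⟨h, fun g hg => DFunLike.congr_fun this ⟨g, hg⟩⟩

lemma isConj_cls (i : Fin 3) : IsConj (iv i) (cls ⟨R (pp i), hR.map_mem_Wt (pp_mem_Wt i)⟩) := by
  set w := cls ⟨R (pp i), hR.map_mem_Wt (pp_mem_Wt i)⟩ with hw
  have h1 : w ≠ 1 := fun h => by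
    obtain ⟨k, hk⟩ := (cls_eq_one_iff _).mp h
    have := hR.lin_eq (pp i)
    rw [← show zz 3 ^ k = R (pp i) from hk, map_zpow, lin_zz, lin_pp, one_zpow] at this
    exact absurd this (by decide +kernel)
  have h2 : w ^ 2 = 1 := by
    rw [hw, ← map_pow, cls_eq_one_iff]
    show R (pp i) ^ 2 ∈ _
    rw [← map_pow, pp_sq]
    exact hR.map_zz
  obtain ⟨u, k, hu⟩ := exists_conj_iv h1 h2
  obtain ⟨u, rfl⟩ := cls_surjective u
  rw [hw, ← cls_pp, ← map_inv, ← map_mul, ← map_mul] at hu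
  obtain ⟨l, hl⟩ := tr_of_cls_eq hu
  have hl : R (pp i) = u * pp k * (u : Br 3)⁻¹ * zz 3 ^ l := hl
  have ht := hR.tr_eq (pp i)
  rw [hl, tr_mul_zz, tr_pp] at ht
  have h3 := two_dvd_tr_conj_pp u.2 k
  rw [ht] at h3
  have hp := hR.odd
  have hk : k = i := by
    have h0 := h3 0
    have h1 := h3 1
    fin_cases i <;> fin_cases k <;> simp [pt] at h0 h1 ⊢ <;> omega
  subst hk
  rw [hw, hu, map_mul, map_mul, map_inv, cls_pp]
  exact isConj_iff.mpr ⟨_, rfl⟩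

lemma mul_inv_mem_Wt (g : Br 3) : R g * g⁻¹ ∈ Wt :=
  mem_Wt_of_lin (Or.inl (by rw [map_mul, map_inv, hR.lin_eq, mul_inv_cancel]))

lemma hasTwist_of {h : W2 →* W2} (hh : ∀ g (hg : g ∈ Wt), h (cls ⟨g, hg⟩) = cls ⟨R g, hR.map_mem_Wt hg⟩)
    {i j : Fin 3} {τ : Br 3} (hi : actIv τ (iv i) = iv i) (hj : actIv τ (iv j) = iv j)
    (hl : ∀ l, l ≠ i → l ≠ j → actIv τ (iv l) = (iv i * iv j) * iv l * (iv i * iv j)⁻¹) :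
    HasTwist h iv i j := by
  refine ⟨(actIv τ).toMonoidHom, cls ⟨_, hR.mul_inv_mem_Wt τ⟩, hi, hj, hl, fun w => ?_⟩
  obtain ⟨⟨g, hg⟩, rfl⟩ := cls_surjective w
  show h (actIv τ (cls ⟨g, hg⟩)) = _ * actIv τ (h (cls ⟨g, hg⟩)) * _
  rw [← cls_conj, hh, hh, ← cls_conj, ← map_mul, ← map_inv, ← map_mul]
  refine congrArg cls (Subtype.ext ?_)
  show R (τ * g * τ⁻¹) = R τ * τ⁻¹ * (τ * R g * τ⁻¹) * (R τ * τ⁻¹)⁻¹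
  rw [map_mul, map_mul, map_inv]
  group

theorem isStd : IsStd R := by
  obtain ⟨h, hh⟩ := hR.exists_hom
  have A2 := actIv_zero.other 2 (by decide) (by decide)
  have B0 := actIv_one.other 0 (by decide) (by decide)
  obtain ⟨u, hu⟩ := isFreeCyc_iv.eq_conj (by norm_num) le_rfl (h := h)
    (fun i => by rw [← cls_pp, hh, cls_pp]; exact hR.isConj_cls i) (fun i hi => by
      obtain rfl | rfl : i = 0 ∨ i = 1 := by omega
      · refine hR.hasTwist_of hh (τ := pp 0 * pp 1 * s 3 0 ^ 2) ?_ ?_ fun l h0 h1 => ?_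
        · show actIv _ (iv 0) = iv 0
          simp [actIv_pp, pow_two, actIv_zero.left, actIv_zero.right, mul_assoc,
            iv_mul_self, iv_mul_iv_mul, iv_inv]
        · show actIv _ (iv 1) = iv 1
          simp [actIv_pp, pow_two, actIv_zero.left, actIv_zero.right, mul_assoc,
            iv_mul_self, iv_mul_iv_mul, iv_inv]
        · obtain rfl : l = 2 := by fin_cases l <;> simp_all
          simp [actIv_pp, pow_two, A2, mul_assoc]
      · refine hR.hasTwist_of hh (τ := pp 1 * pp 2 * s 3 1 ^ 2) ?_ ?_ fun l h0 h1 => ?_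
        · show actIv _ (iv 1) = iv 1
          simp [actIv_pp, pow_two, actIv_one.left, actIv_one.right, mul_assoc,
            iv_mul_self, iv_mul_iv_mul, iv_inv]
        · show actIv _ (iv 2) = iv 2
          simp [actIv_pp, pow_two, actIv_one.left, actIv_one.right, mul_assoc,
            iv_mul_self, iv_mul_iv_mul, iv_inv]
        · obtain rfl : l = 0 := by fin_cases l <;> simp_all
          simp [actIv_pp, pow_two, B0, mul_assoc])
  obtain ⟨⟨v, hv⟩, rfl⟩ := cls_surjective u
  have key (g : Br 3) : ∃ k : ℤ, R g = v * g * v⁻¹ * zz 3 ^ k := by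
    have h1 : actIv (R g) * MulAut.conj (cls ⟨v, hv⟩) = MulAut.conj (cls ⟨v, hv⟩) * actIv g := by
      ext w
      obtain ⟨⟨w, hw⟩, rfl⟩ := cls_surjective w
      have h2 := hh (g * w * g⁻¹) (Wt_normal.conj_mem w hw g)
      have h3 : (⟨R (g * w * g⁻¹), hR.map_mem_Wt (Wt_normal.conj_mem w hw g)⟩ : Wt) =
          ⟨R g * R w * (R g)⁻¹, Wt_normal.conj_mem _ (hR.map_mem_Wt hw) _⟩ := Subtype.ext (by simp)
      rw [h3, cls_conj g ⟨w, hw⟩, cls_conj (R g) ⟨R w, hR.map_mem_Wt hw⟩, hu, ← hh, hu] at h2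
      exact h2.symm
    rw [conj_cls] at h1
    have h4 : actIv ((v * g * v⁻¹)⁻¹ * R g) = 1 := by
      rw [map_mul, map_inv, inv_mul_eq_one, map_mul, map_mul, map_inv, mul_inv_eq_iff_eq_mul]
      exact h1.symm
    have h5 : (v * g * v⁻¹)⁻¹ * R g ∈ Wt := by
      refine mem_Wt_of_lin (Or.inl ?_)
      rw [map_mul, map_inv, map_mul, map_mul, map_inv, hR.lin_eq]
      obtain h | h := lin_of_mem_Wt hv <;> rw [h] <;> simp
    have h6 : cls ⟨_, h5⟩ = 1 := conj_injective (by rw [conj_cls, map_one]; exact h4)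
    obtain ⟨k, hk⟩ := (cls_eq_one_iff _).mp h6
    exact ⟨k, by rw [show zz 3 ^ k = _ from hk, mul_inv_cancel_left]⟩
  choose k hk using fun i => key (s 3 i)
  have hconst (i : ℕ) (hi : i < 3) : k i = k 0 := by
    have h1 : expo 3 (R (s 3 i)) = expo 3 (R (s 3 0)) := by
      have := congrArg (fun g => expo 3 (R g)) (δ_pow_s hi)
      simp only [map_mul] at this
      rw [mul_comm] at this
      exact (mul_right_cancel this).symm
    rw [hk, hk] at h1
    simp only [map_mul, map_inv, expo_s hi, expo_s (show 0 < 3 by norm_num), map_zpow, expo_zz] at h1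
    have h2 := congrArg Multiplicative.toAdd h1
    simp at h2
    omega
  exact ⟨v, k 0, Or.inl fun i hi => by rw [hk, hconst i hi]⟩

end IsNorm

end BraidCoHopf

namespace BraidCoHopf

/-! ### Endomorphisms of the braid group on four strands -/

lemma IsStd.of_conj {m : ℕ} {R : Br m →* Br m} {β : Br m}
    (h : IsStd ((MulAut.conj β).toMonoidHom.comp R)) : IsStd R := by
  obtain ⟨u, k, h⟩ := h
  refine ⟨β⁻¹ * u, k, h.imp (fun h i hi => ?_) fun h i hi => ?_⟩
  all_goals
    have h1 : β * R (s m i) * β⁻¹ = _ := h i hi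
    have h2 : R (s m i) = β⁻¹ * (β * R (s m i) * β⁻¹) * β := by group
    rw [h2, h1]
    simp only [mul_inv_rev, inv_inv, mul_assoc, ← zz_zpow_comm β]

lemma two_dvd_of_perm_eq {g h : Br 3} (hgh : perm 3 g = perm 3 h) :
    (∀ a b, (2 : ℤ) ∣ lin g a b - lin h a b) ∧ ∀ i, (2 : ℤ) ∣ tr g i - tr h i := by
  have key (k : ℕ) (hk : k ≤ 3) (i : Fin 2) : (2 : ℤ) ∣ (tr g i + (lin g i 0 * pt k 0 +
      lin g i 1 * pt k 1)) - (tr h i + (lin h i 0 * pt k 0 + lin h i 1 * pt k 1)) := by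
    have := dvd_sub (pt_perm g k hk i) (pt_perm h k hk i)
    rw [hgh, Pi.sub_apply, Pi.sub_apply, sub_sub_sub_cancel_right] at this
    simpa only [Pi.add_apply, Matrix.mulVec, dotProduct, Fin.sum_univ_two] using this
  have ht (i : Fin 2) : (2 : ℤ) ∣ tr g i - tr h i := by simpa [pt] using key 3 le_rfl i
  have hl0 (i : Fin 2) : (2 : ℤ) ∣ lin g i 0 - lin h i 0 := by
    have h1 : (2 : ℤ) ∣ _ := key 2 (by norm_num) i
    have h2 := ht i
    simp [pt] at h1
    omega
  have hl1 (i : Fin 2) : (2 : ℤ) ∣ lin g i 1 - lin h i 1 := by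
    have h1 : (2 : ℤ) ∣ _ := key 0 (by norm_num) i
    have h2 := ht i
    simp [pt] at h1
    omega
  exact ⟨fun a b => by fin_cases b; exacts [hl0 a, hl1 a], ht⟩

lemma isStd_of_isAdm {R : Br 3 →* Br 3} (hR : IsAdm R) : IsStd R := by
  obtain ⟨β, p, hp, h | h⟩ := hR.exists_conj
  · exact IsStd.of_conj (β := β) (IsNorm.isStd (p := p) ⟨fun g => (h g).1, fun g => (h g).2, hp⟩)
  · refine IsStd.of_invert (IsStd.of_conj (β := β) (IsNorm.isStd (p := p) ⟨fun g => ?_, fun g => ?_, hp⟩))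
    exacts [(h g).1, (h g).2]

lemma isAdm_of_perm {R : Br 3 →* Br 3} (hδ : perm 3 (R (δ 3)) = perm 3 (δ 3))
    (h0 : perm 3 (R (s 3 0)) = perm 3 (s 3 0) ∨ perm 3 (R (s 3 0)) = perm 3 (δ 3 ^ 2 * s 3 0)) :
    IsAdm R := by
  have hδ2 : lin (δ 3 ^ 2) = -1 := lin_pp 1
  obtain ⟨ε, hε, hε0⟩ : ∃ ε : Br 3, (ε = 1 ∨ ε = δ 3 ^ 2) ∧
      perm 3 (R (s 3 0)) = perm 3 (ε * s 3 0) :=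
    h0.elim (fun h => ⟨1, Or.inl rfl, by rw [h, one_mul]⟩) fun h => ⟨_, Or.inr rfl, h⟩
  have hε1 : lin ε = 1 ∨ lin ε = -1 :=
    hε.imp (fun h => by rw [h, map_one]) fun h => by rw [h, hδ2]
  have hεδ (k : ℕ) : δ 3 ^ k * ε * (δ 3 ^ k)⁻¹ = ε := by
    obtain rfl | rfl := hε
    · group
    · rw [mul_inv_eq_iff_eq_mul, ← pow_add, ← pow_add, add_comm]
  have hs (i : ℕ) (hi : i < 3) : perm 3 (R (s 3 i)) = perm 3 (ε * s 3 i) := by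
    have e : s 3 i = δ 3 ^ i * s 3 0 * (δ 3 ^ i)⁻¹ := by rw [δ_pow_s hi, mul_inv_cancel_right]
    have e' : ε * s 3 i = δ 3 ^ i * (ε * s 3 0) * (δ 3 ^ i)⁻¹ := by
      have hc : δ 3 ^ i * ε = ε * δ 3 ^ i := mul_inv_eq_iff_eq_mul.1 (hεδ i)
      rw [e, ← mul_assoc, ← mul_assoc, ← hc]
      simp only [mul_assoc]
    rw [e', e]
    simp only [map_mul, map_inv, map_pow, hδ, hε0]
  have hta : perm 3 (R ta) = perm 3 (ε * ta * ε⁻¹) := by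
    rw [show ε * ta * ε⁻¹ = (ε * s 3 0) * (ε * s 3 2)⁻¹ by rw [ta_eq]; group, map_mul, map_inv,
      ta_eq, map_mul, map_mul, map_inv, map_inv, hs 0 (by norm_num), hs 2 (by norm_num)]
  have ht := (two_dvd_of_perm_eq hta).2
  rw [tr_conj lin_ta, tr_ta] at ht
  have ht' : (2 : ℤ) ∣ tr (R ta) 0 - 1 ∧ (2 : ℤ) ∣ tr (R ta) 1 := by
    have t0 := ht 0
    have t1 := ht 1
    obtain h | h := hε1 <;> rw [h] at t0 t1 <;> simp [Matrix.neg_mulVec] at t0 t1 <;> omega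
  refine ⟨fun i hi a b => ?_, fun a b => ?_, ht'.1, ht'.2⟩
  · have := (two_dvd_of_perm_eq (hs i hi)).1 a b
    obtain h | h := hε1 <;> rw [map_mul, h] at this <;> simp at this <;> omega
  · refine (two_dvd_of_perm_eq ?_).1 a b
    rw [pp_one, map_pow, map_pow, hδ, map_pow]

theorem isStd_three {R : Br 3 →* Br 3} {b : Br 3}
    (hδ : perm 3 (R (δ 3)) = perm 3 (b * δ 3 * b⁻¹))
    (h0 : perm 3 (R (s 3 0)) = perm 3 (b * s 3 0 * b⁻¹) ∨
      perm 3 (R (s 3 0)) = perm 3 (b * (δ 3 ^ 2 * s 3 0) * b⁻¹)) : IsStd R := by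
  have key {g h : Br 3} (hgh : perm 3 (R g) = perm 3 (b * h * b⁻¹)) :
      perm 3 (b⁻¹ * R g * b⁻¹⁻¹) = perm 3 h := by
    simp only [map_mul, map_inv, hgh]; group
  exact IsStd.of_conj (β := b⁻¹) (isStd_of_isAdm (isAdm_of_perm (key hδ) (h0.imp key key)))

/-- Endomorphisms compatible with the permutation representation are standard. -/
theorem isStd_of_perm {m : ℕ} (hm : 3 ≤ m) : ∀ {R : Br m →* Br m},
    (∀ g, perm m (R g) = perm m g) → IsStd R := by
  induction m, hm using Nat.le_induction with
  | base => exact fun h => isStd_three (b := 1) (by rw [h]; simp) (Or.inl (by rw [h]; simp))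
  | succ m hm ih => exact fun h => isStd_succ hm (fun R hR => ih hR) h

/-- Endomorphisms inducing an injective map modulo the center are standard. -/
theorem isStd_of_center {m : ℕ} (hm : 3 ≤ m) {R : Br m →* Br m}
    (hR : ∀ g, R g ∈ Subgroup.center (Br m) ↔ g ∈ Subgroup.center (Br m)) : IsStd R := by
  obtain rfl | hm4 := hm.eq_or_lt
  · obtain ⟨b, hδ, h0⟩ := exists_perm_map_three R hR
    exact isStd_three hδ h0
  · obtain ⟨b, hb⟩ := exists_perm_map hm4 R hR
    refine IsStd.of_conj (β := b⁻¹) (isStd_of_perm hm fun g => ?_)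
    show perm m (b⁻¹ * R g * b⁻¹⁻¹) = _
    simp only [map_mul, map_inv, hb]; group

end BraidCoHopf

namespace BraidCoHopf

/-! ### Endomorphisms modulo the center -/

lemma eq_of_mk_eq {m : ℕ} (hm : 2 ≤ m) {a b : Br m}
    (h : (a : Br m ⧸ Subgroup.center (Br m)) = b) (he : expo m a = expo m b) : a = b := by
  rw [QuotientGroup.eq, center_eq hm] at h
  obtain ⟨k, hk⟩ := h
  have hk' : zz m ^ k = a⁻¹ * b := hk
  have h1 := congrArg (expo m) hk'
  rw [map_zpow, expo_zz, map_mul (expo m), map_inv (expo m), he, inv_mul_cancel, ← ofAdd_zsmul,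
    ← ofAdd_zero, Multiplicative.ofAdd.apply_eq_iff_eq, smul_eq_mul] at h1
  have hk0 : k = 0 := by
    refine (mul_eq_zero.1 h1).resolve_right ?_
    have : (m : ℤ) ≠ 0 := by omega
    exact mul_ne_zero this (by omega)
  rw [hk0, zpow_zero, eq_comm, inv_mul_eq_one] at hk'
  exact hk'

/-- Endomorphisms of the quotient by the center lift to the braid group. -/
lemma exists_lift_of_center {m : ℕ} (hm : 2 ≤ m)
    (ρ : Br m ⧸ Subgroup.center (Br m) →* Br m ⧸ Subgroup.center (Br m)) :
    ∃ R : Br m →* Br m, ∀ g, (R g : Br m ⧸ Subgroup.center (Br m)) = ρ g := by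
  obtain ⟨t, ht⟩ := QuotientGroup.mk_surjective (ρ (δ m))
  obtain ⟨x, hx⟩ := QuotientGroup.mk_surjective (ρ (s m 0))
  let f : ℕ → Br m := fun i => t ^ i * x * (t ^ i)⁻¹
  have hf (i : ℕ) (hi : i < m) : (f i : Br m ⧸ Subgroup.center (Br m)) = ρ (s m i) := by
    rw [s_eq_conj hi]
    simp only [f, QuotientGroup.mk_mul, QuotientGroup.mk_pow, QuotientGroup.mk_inv, ht, hx,
      map_mul, map_inv, map_pow]
  have he (i : ℕ) : expo m (f i) = expo m x := by
    simp only [f, map_mul, map_inv, mul_inv_cancel_comm]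
  obtain ⟨R, hR⟩ := exists_lift (m := m) f (fun i hi => eq_of_mk_eq hm (by
      simp only [QuotientGroup.mk_mul, hf i (by omega), hf (i + 1) hi]
      simp only [← map_mul, ← QuotientGroup.mk_mul, s_braid hi])
      (by simp only [map_mul, he])) fun i j hij hj => eq_of_mk_eq hm (by
      simp only [QuotientGroup.mk_mul, hf i (by omega), hf j hj]
      simp only [← map_mul, ← QuotientGroup.mk_mul, s_comm m hij])
      (by simp only [map_mul, he])
  have key : (QuotientGroup.mk' (Subgroup.center (Br m))).comp R =
      ρ.comp (QuotientGroup.mk' (Subgroup.center (Br m))) := hom_ext fun i hi => by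
    simp only [MonoidHom.comp_apply, hR i hi]
    exact hf i hi
  exact ⟨R, DFunLike.congr_fun key⟩

theorem surjective_of_injective {m : ℕ} (hm : 3 ≤ m)
    (ρ : Br m ⧸ Subgroup.center (Br m) →* Br m ⧸ Subgroup.center (Br m))
    (hρ : Function.Injective ρ) : Function.Surjective ρ := by
  obtain ⟨R, hR⟩ := exists_lift_of_center (by omega) ρ
  obtain ⟨u, k, h⟩ := isStd_of_center hm (R := R) fun g => by
    rw [← QuotientGroup.eq_one_iff, hR, ← QuotientGroup.eq_one_iff, map_eq_one_iff ρ hρ]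
  let q := QuotientGroup.mk' (Subgroup.center (Br m))
  have hz : q (zz m ^ k) = 1 :=
    (QuotientGroup.eq_one_iff _).2 (Subgroup.zpow_mem _ (zz_mem_center m) k)
  have hK : ∀ g, g ∈ ρ.range.comap (q.comp (MulAut.conj u).toMonoidHom) := by
    refine le_of_s_mem fun i hi => ?_
    have hs : q (R (s m i)) ∈ ρ.range := ⟨_, (hR _).symm⟩
    show q (u * s m i * u⁻¹) ∈ ρ.range
    obtain h | h := h <;> rw [h i hi, map_mul q, hz, mul_one] at hs
    · exact hs
    · rw [show u * s m i * u⁻¹ = (u * (s m i)⁻¹ * u⁻¹)⁻¹ by group, map_inv]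
      exact inv_mem hs
  intro y
  obtain ⟨g, rfl⟩ := QuotientGroup.mk_surjective y
  have := hK (u⁻¹ * g * u)
  have h1 : q (u * (u⁻¹ * g * u) * u⁻¹) ∈ ρ.range := this
  rwa [show u * (u⁻¹ * g * u) * u⁻¹ = g by group] at h1

end BraidCoHopf

/-- For `n ≥ 4`, the group `B_n / Z(B_n)` is co-Hopfian: every injective
endomorphism is surjective. -/
theorem braidModCenter_coHopfian (n : ℕ) (hn : 4 ≤ n)
    (ρ : BraidGroup n ⧸ Subgroup.center (BraidGroup n) →*
         BraidGroup n ⧸ Subgroup.center (BraidGroup n))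
    (hρ : Function.Injective ρ) : Function.Surjective ρ := by
  exact BraidCoHopf.surjective_of_injective (by omega) ρ hρ
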